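/- arXiv:1906.04350 — 2 statements merged into one kernel-verified Lean document; each statement's English description precedes it below -/
import Mathlib

section
/- There exists a constant p > 3/2 such that for each K > 0 there is C₁ > 0 with the following property: for every sufficiently large n ∈ ℤ₊ and all functions u, V : ℤ³ → ℝ satisfying Δu(a) = V(a)·u(a) for all a ∈ Q_n and ‖V‖_∞ ≤ K, the number of points a ∈ Q_n with |u(a)| ≥ exp(-C₁·n)·|u(0)| is at least n^p. -/
/-- The standard basis vectors of `ℤ³`. -/
def stdv (i : Fin 3) : Fin 3 → ℤ := fun j => if j = i then 1 else 0

/-- The discrete Laplacian on `ℤ³`: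
`Δu(a) = -6 u(a) + ∑_{|a-b|=1} u(b)`. -/
noncomputable def discLap (u : (Fin 3 → ℤ) → ℝ) (a : Fin 3 → ℤ) : ℝ :=
  -6 * u a + ∑ i : Fin 3, (u (a + stdv i) + u (a - stdv i))

/-- The cube `Q_r(a) = a + ([-r, r] ∩ ℤ)³`. -/
def cube (a : Fin 3 → ℤ) (r : ℝ) : Set (Fin 3 → ℤ) :=
  {b | ∀ i, |((b i - a i : ℤ) : ℝ)| ≤ r}

/-- A function on `{0, …, N}` with small `k`-th differences which is small at `k` points is small. -/
theorem abs_le_of_fwdDiff_iter_small (h : ℕ → ℝ) (N k : ℕ) (η : ℝ) (hη : 0 ≤ η)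
    (hd : ∀ t, t + k ≤ N → |(fwdDiff 1)^[k] h t| ≤ η) (S : Finset ℕ)
    (hSN : ∀ t ∈ S, t ≤ N) (hSk : S.card = k) (hS : ∀ t ∈ S, |h t| ≤ η) (t : ℕ) (ht : t ≤ N) :
    |h t| ≤ (3 * (N + 1) : ℝ) ^ (N + 1) * η := by
  have hkN : k ≤ N + 1 := by
    rw [← hSk]
    have : S ⊆ Finset.range (N + 1) := fun x hx => by
      have := hSN x hx
      simp; omega
    simpa using Finset.card_le_card this
  -- higher differences
  have hdi : ∀ i t, t + k + i ≤ N → |(fwdDiff 1)^[k + i] h t| ≤ 2 ^ i * η := by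
    intro i
    induction i with
    | zero => intro t ht; simpa using hd t (by omega)
    | succ i ih =>
      intro t ht
      have e : (fwdDiff 1)^[k + (i + 1)] h t
          = (fwdDiff 1)^[k + i] h (t + 1) - (fwdDiff 1)^[k + i] h t := by
        rw [← add_assoc, Function.iterate_succ_apply']; rfl
      rw [e]
      have h1 := ih (t + 1) (by omega)
      have h2 := ih t (by omega)
      have := abs_sub ((fwdDiff 1)^[k + i] h (t + 1)) ((fwdDiff 1)^[k + i] h t)
      rw [pow_succ]; linarith
  set c : ℕ → ℝ := fun i => (fwdDiff 1)^[i] h 0 with hc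
  have newton : ∀ t, h t = ∑ i ∈ Finset.range (t + 1), (t.choose i : ℝ) * c i := by
    intro t
    have := shift_eq_sum_fwdDiff_iter 1 h t 0
    simpa [hc] using this
  set P : Polynomial ℝ := ∑ i ∈ Finset.range k,
    Polynomial.C (c i / (i.factorial : ℝ)) * descPochhammer ℝ i with hP
  have hPdeg : P.degree < (S.card : WithBot ℕ) := by
    rw [hSk, hP]
    refine Polynomial.mem_degreeLT.1 (Submodule.sum_mem _ fun i hi => Polynomial.mem_degreeLT.2 ?_)
    refine lt_of_le_of_lt Polynomial.degree_le_natDegree ?_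
    refine lt_of_le_of_lt (Nat.cast_le.2 (Polynomial.natDegree_C_mul_le _ _)) ?_
    rw [descPochhammer_natDegree]
    exact_mod_cast Finset.mem_range.1 hi
  have hPval : ∀ t : ℕ, P.eval (t : ℝ) = ∑ i ∈ Finset.range k, (t.choose i : ℝ) * c i := by
    intro t
    rw [hP, Polynomial.eval_finsetSum]
    refine Finset.sum_congr rfl fun i _ => ?_
    rw [Polynomial.eval_mul, Polynomial.eval_C, descPochhammer_eval_eq_descFactorial,
      Nat.descFactorial_eq_factorial_mul_choose]
    have : (i.factorial : ℝ) ≠ 0 := by positivity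
    push_cast
    field_simp
  have herr : ∀ t ≤ N, |h t - P.eval (t : ℝ)| ≤ 3 ^ N * η := by
    intro t ht
    have hbin : ∑ i ∈ Finset.range (t + 1), (t.choose i : ℝ) * 2 ^ i = 3 ^ t := by
      have := add_pow (2 : ℝ) 1 t
      norm_num at this
      rw [this]
      exact Finset.sum_congr rfl fun i _ => by ring
    have e : h t - P.eval (t : ℝ)
        = ∑ i ∈ (Finset.range (t + 1)).filter (fun i => k ≤ i), (t.choose i : ℝ) * c i := by
      rw [newton t, hPval, sub_eq_iff_eq_add,
        ← Finset.sum_filter_add_sum_filter_not (Finset.range (t + 1)) (fun i => k ≤ i)]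
      congr 1
      refine Finset.sum_subset ?_ ?_
      · intro i; simp
      · intro i hi hi'
        simp at hi hi'
        have : t < i := by
          by_contra hcon
          exact absurd (hi' (by omega)) (by omega)
        simp [Nat.choose_eq_zero_of_lt this]
    rw [e]
    refine (Finset.abs_sum_le_sum_abs _ _).trans ?_
    calc _ ≤ ∑ i ∈ (Finset.range (t + 1)).filter (fun i => k ≤ i), (t.choose i : ℝ) * 2 ^ i * η := by
          refine Finset.sum_le_sum fun i hi => ?_
          simp at hi
          rw [abs_mul, Nat.abs_cast, mul_assoc]
          refine mul_le_mul_of_nonneg_left ?_ (by positivity)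
          obtain ⟨j, rfl⟩ := Nat.exists_eq_add_of_le hi.2
          refine (hdi j 0 (by omega)).trans ?_
          refine mul_le_mul_of_nonneg_right ?_ hη
          exact pow_le_pow_right₀ (by norm_num) (by omega)
      _ ≤ ∑ i ∈ Finset.range (t + 1), (t.choose i : ℝ) * 2 ^ i * η := by
          refine Finset.sum_le_sum_of_subset_of_nonneg (Finset.filter_subset _ _) ?_
          intros; positivity
      _ = 3 ^ t * η := by rw [← Finset.sum_mul, hbin]
      _ ≤ 3 ^ N * η := by
          refine mul_le_mul_of_nonneg_right ?_ hη
          exact pow_le_pow_right₀ (by norm_num) ht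
  have hinj : Set.InjOn (fun i : ℕ => (i : ℝ)) S := Nat.cast_injective.injOn
  have hlag := Lagrange.eq_interpolate (s := S) (v := fun i : ℕ => (i : ℝ)) hinj hPdeg
  have hPt : |P.eval (t : ℝ)| ≤ k * ((N + 1 : ℝ) ^ N * ((1 + 3 ^ N) * η)) := by
    rw [hlag, Lagrange.interpolate_apply, Polynomial.eval_finsetSum]
    refine (Finset.abs_sum_le_sum_abs _ _).trans ?_
    rw [← hSk, ← nsmul_eq_mul]
    refine Finset.sum_le_card_nsmul _ _ _ ?_
    intro i hi
    rw [Polynomial.eval_mul, Polynomial.eval_C, abs_mul, mul_comm]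
    have h1 : |P.eval (i : ℝ)| ≤ (1 + 3 ^ N) * η := by
      have a1 := herr i (hSN i hi)
      have a2 := hS i hi
      have a3 : P.eval (i : ℝ) = h i - (h i - P.eval (i : ℝ)) := by ring
      rw [a3]
      refine (abs_sub _ _).trans ?_
      linarith
    refine mul_le_mul ?_ h1 (abs_nonneg _) (by positivity)
    rw [Lagrange.basis, Polynomial.eval_prod, Finset.abs_prod]
    calc _ ≤ ∏ j ∈ S.erase i, (N + 1 : ℝ) := by
          refine Finset.prod_le_prod (fun _ _ => abs_nonneg _) ?_
          intro j hj
          rw [Finset.mem_erase] at hj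
          rw [Lagrange.basisDivisor, Polynomial.eval_mul, Polynomial.eval_C, Polynomial.eval_sub,
            Polynomial.eval_X, Polynomial.eval_C, abs_mul, abs_inv]
          have hjN := hSN j hj.2
          have hij : (1 : ℝ) ≤ |(i : ℝ) - j| := by
            have : (1 : ℤ) ≤ |(i : ℤ) - j| := Int.one_le_abs (by omega)
            exact_mod_cast this
          have htj : |(t : ℝ) - j| ≤ N + 1 := by
            rw [abs_le]
            have : (t : ℝ) ≤ N := by exact_mod_cast ht
            have : (j : ℝ) ≤ N := by exact_mod_cast hjN
            constructor <;> linarith [(Nat.cast_nonneg t : (0:ℝ) ≤ t), (Nat.cast_nonneg j : (0:ℝ) ≤ j)]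
          calc _ ≤ 1 * (N + 1 : ℝ) :=
                mul_le_mul (inv_le_one_of_one_le₀ hij) htj (abs_nonneg _) (by norm_num)
            _ = _ := one_mul _
      _ = (N + 1 : ℝ) ^ (S.erase i).card := by rw [Finset.prod_const]
      _ ≤ (N + 1 : ℝ) ^ N := by
          refine pow_le_pow_right₀ (by linarith [(Nat.cast_nonneg N : (0:ℝ) ≤ N)]) ?_
          rw [Finset.card_erase_of_mem hi]; omega
  have h3 : (1 : ℝ) ≤ 3 ^ N := one_le_pow₀ (by norm_num)
  have hN1 : (1 : ℝ) ≤ (N + 1 : ℝ) ^ (N + 1) := one_le_pow₀ (by linarith [(Nat.cast_nonneg N : (0:ℝ) ≤ N)])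
  have hk1 : (k : ℝ) * (N + 1 : ℝ) ^ N ≤ (N + 1 : ℝ) ^ (N + 1) := by
    rw [pow_succ, mul_comm]
    refine mul_le_mul_of_nonneg_left ?_ (by positivity)
    exact_mod_cast hkN
  calc |h t| = |(h t - P.eval (t : ℝ)) + P.eval (t : ℝ)| := by ring_nf
    _ ≤ 3 ^ N * η + k * ((N + 1 : ℝ) ^ N * ((1 + 3 ^ N) * η)) :=
        (abs_add_le _ _).trans (add_le_add (herr t ht) hPt)
    _ = 3 ^ N * η + (k * (N + 1 : ℝ) ^ N) * ((1 + 3 ^ N) * η) := by ring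
    _ ≤ (N + 1 : ℝ) ^ (N + 1) * (3 ^ N * η) + (N + 1 : ℝ) ^ (N + 1) * ((3 ^ N + 3 ^ N) * η) := by
        refine add_le_add ?_ ?_
        · exact le_mul_of_one_le_left (by positivity) hN1
        · refine mul_le_mul hk1 ?_ (by positivity) (by positivity)
          exact mul_le_mul_of_nonneg_right (by linarith) hη
    _ = (3 * (N + 1) : ℝ) ^ (N + 1) * η := by rw [mul_pow]; ring

/-- If a solution of the triangle relation is small on the columns `s ≥ k`, and the column `0`
contains more than `k` small values, then the solution is small. -/
theorem triangle_small_of_column (F : ℕ → ℕ → ℝ) (N k : ℕ) (hkN : k ≤ N) (ε : ℝ) (hε : 0 ≤ ε)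
    (hrel : ∀ s t, s + t + 1 ≤ N → |F s t + F s (t + 1) + F (s + 1) t| ≤ ε)
    (hsm : ∀ s t, k ≤ s → s + t ≤ N → |F s t| ≤ ε)
    (T : Finset ℕ) (hT : ∀ t ≤ N, ε < |F 0 t| → t ∈ T) (hTc : T.card + k ≤ N)
    (s t : ℕ) (hst : s + t ≤ N) :
    |F s t| ≤ (12 * (N + 1) : ℝ) ^ (N + 1) * ε := by
  set g : ℕ → ℝ := fun t => (-1) ^ t * F 0 t with hg
  have hgabs : ∀ t, |g t| = |F 0 t| := fun t => by simp [hg, abs_mul]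
  have hdiff : ∀ s t, s + t ≤ N → |(fwdDiff 1)^[s] g t - (-1) ^ t * F s t| ≤ (2 ^ s - 1) * ε := by
    intro s
    induction s with
    | zero => intro t _; simp [hg]
    | succ s ih =>
      intro t ht
      rw [Function.iterate_succ_apply']
      have h1 := ih t (by omega)
      have h2 := ih (t + 1) (by omega)
      have h3 := hrel s t (by omega)
      have e : fwdDiff 1 ((fwdDiff 1)^[s] g) t - (-1) ^ t * F (s + 1) t
          = ((fwdDiff 1)^[s] g (t + 1) - (-1) ^ (t + 1) * F s (t + 1))
            - ((fwdDiff 1)^[s] g t - (-1) ^ t * F s t)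
            - (-1) ^ t * (F s t + F s (t + 1) + F (s + 1) t) := by
        simp only [fwdDiff]; ring
      have h4 : |(-1 : ℝ) ^ t * (F s t + F s (t + 1) + F (s + 1) t)| ≤ ε := by
        rw [abs_mul]; simpa using h3
      rw [e]
      refine (abs_sub _ _).trans ?_
      have := abs_sub ((fwdDiff 1)^[s] g (t + 1) - (-1) ^ (t + 1) * F s (t + 1))
        ((fwdDiff 1)^[s] g t - (-1) ^ t * F s t)
      have e2 : ((2 : ℝ) ^ (s + 1) - 1) * ε = (2 ^ s - 1) * ε + (2 ^ s - 1) * ε + ε := by ring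
      rw [e2]; linarith
  have h2N : (1 : ℝ) ≤ 2 ^ N := one_le_pow₀ (by norm_num)
  have hη : (0 : ℝ) ≤ 2 ^ N * ε := by positivity
  have hsmall : ((Finset.range (N + 1)) \ T).card ≥ k := by
    have := Finset.le_card_sdiff T (Finset.range (N + 1))
    simp at this; omega
  obtain ⟨S, hS, hSk⟩ := Finset.exists_subset_card_eq hsmall
  have hpow : ∀ s ≤ N, (2 : ℝ) ^ s ≤ 2 ^ N := fun s hs => pow_le_pow_right₀ (by norm_num) hs
  have hg0 : ∀ t ≤ N, |g t| ≤ (3 * (N + 1) : ℝ) ^ (N + 1) * (2 ^ N * ε) := by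
    refine abs_le_of_fwdDiff_iter_small g N k (2 ^ N * ε) hη ?_ S ?_ hSk ?_
    · intro t ht
      have h1 := hdiff k t (by omega)
      have h2 := hsm k t le_rfl (by omega)
      have h3 : |(-1 : ℝ) ^ t * F k t| ≤ ε := by rw [abs_mul]; simpa using h2
      have h4 := abs_sub_abs_le_abs_sub ((fwdDiff 1)^[k] g t) ((-1) ^ t * F k t)
      have h5 : (2 : ℝ) ^ k * ε ≤ 2 ^ N * ε := mul_le_mul_of_nonneg_right (hpow k hkN) hε
      linarith
    · intro t ht
      have := hS ht
      simp at this; omega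
    · intro t ht
      have h1 := hS ht
      simp at h1
      rw [hgabs]
      by_contra hcon
      push Not at hcon
      refine h1.2 (hT t (by omega) (lt_of_le_of_lt ?_ hcon))
      exact le_mul_of_one_le_left hε h2N
  set E : ℝ := (3 * (N + 1) : ℝ) ^ (N + 1) * (2 ^ N * ε) with hE
  have hN0 : (0 : ℝ) ≤ N := Nat.cast_nonneg N
  have hE1 : 2 ^ N * ε ≤ E := by
    refine le_mul_of_one_le_left hη (one_le_pow₀ (by linarith))
  have hE0 : 0 ≤ E := hη.trans hE1
  have hgs : ∀ s t, s + t ≤ N → |(fwdDiff 1)^[s] g t| ≤ 2 ^ s * E := by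
    intro s
    induction s with
    | zero => intro t ht; simpa using hg0 t (by omega)
    | succ s ih =>
      intro t ht
      rw [Function.iterate_succ_apply']
      have h1 := ih t (by omega)
      have h2 := ih (t + 1) (by omega)
      have := abs_sub ((fwdDiff 1)^[s] g (t + 1)) ((fwdDiff 1)^[s] g t)
      simp only [fwdDiff] at this ⊢
      rw [pow_succ]; linarith
  have h1 := hdiff s t hst
  have h2 := hgs s t hst
  have h3 : |F s t| = |(-1 : ℝ) ^ t * F s t| := by rw [abs_mul]; simp
  have h4 := abs_sub_abs_le_abs_sub ((-1 : ℝ) ^ t * F s t) ((fwdDiff 1)^[s] g t)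
  rw [abs_sub_comm] at h4
  have h5 : (2 : ℝ) ^ s * E ≤ 2 ^ N * E := mul_le_mul_of_nonneg_right (hpow s (by omega)) hE0
  have h6 : (2 ^ s - 1 : ℝ) * ε ≤ 2 ^ N * E := by
    have : (2 ^ s - 1 : ℝ) * ε ≤ 2 ^ N * ε :=
      mul_le_mul_of_nonneg_right (by linarith [hpow s (by omega)]) hε
    have : E ≤ 2 ^ N * E := le_mul_of_one_le_left hE0 h2N
    linarith
  calc |F s t| ≤ 2 * (2 ^ N * E) := by rw [h3]; linarith
    _ = (2 * 4 ^ N) * ((3 * (N + 1) : ℝ) ^ (N + 1) * ε) := by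
        have h7 : (4 : ℝ) ^ N = 2 ^ N * 2 ^ N := by rw [← mul_pow]; norm_num
        rw [hE, h7]; ring
    _ ≤ (4 ^ (N + 1)) * ((3 * (N + 1) : ℝ) ^ (N + 1) * ε) := by
        refine mul_le_mul_of_nonneg_right ?_ (by positivity)
        rw [pow_succ]
        have : (0 : ℝ) ≤ 4 ^ N := by positivity
        linarith
    _ = _ := by rw [← mul_assoc, ← mul_pow]; ring

/-- The triangle relation on the plane `x + y + z = L`, up to an error `ε`. -/
def TriRel (U : ℤ → ℤ → ℤ → ℝ) (ε : ℝ) (L A B C : ℤ) : Prop :=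
  ∀ x y z, A ≤ x → B ≤ y → C ≤ z → x + y + z = L - 1 →
    |U (x + 1) y z + U x (y + 1) z + U x y (z + 1)| ≤ ε

/-- Smallness on a triangle of the plane `x + y + z = L`. -/
def TriSmall (U : ℤ → ℤ → ℤ → ℝ) (ε : ℝ) (L A B C : ℤ) : Prop :=
  ∀ x y z, A ≤ x → B ≤ y → C ≤ z → x + y + z = L → |U x y z| ≤ ε

theorem triSmall_expand_fst (U : ℤ → ℤ → ℤ → ℝ) (ε : ℝ) (hε : 0 ≤ ε) (L A A' A'' B C : ℤ)
    (h₁ : A'' ≤ A') (h₂ : A' ≤ A) (hm : A + B + C ≤ L) (M : ℕ) (hM : L - A'' - B - C < M)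
    (hrel : TriRel U ε L A'' B C) (htri : TriSmall U ε L A B C) (S : Finset (ℤ × ℤ × ℤ))
    (hS : ∀ x y z, A'' ≤ x → x ≤ A' → B ≤ y → C ≤ z → x + y + z = L → ε < |U x y z| →
      (x, y, z) ∈ S)
    (hcard : (S.card : ℤ) < (L - A - B - C + 1) * (A' - A'' + 1)) :
    TriSmall U ((12 * M : ℝ) ^ M * ε) L A' B C := by
  obtain ⟨m, hm'⟩ := Int.eq_ofNat_of_zero_le (show 0 ≤ L - A - B - C by omega)
  have hcard' : S.card < (Finset.Icc A'' A').card * (m + 1) := by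
    rw [hm'] at hcard
    zify
    rw [Int.card_Icc, Int.toNat_of_nonneg (by omega)]
    linarith
  obtain ⟨col, hcol, hcolS⟩ :=
    Finset.exists_card_fiber_lt_of_card_lt_mul (f := fun p : ℤ × ℤ × ℤ => p.1) hcard'
  rw [Finset.mem_Icc] at hcol
  obtain ⟨N, hN⟩ := Int.eq_ofNat_of_zero_le (show 0 ≤ L - col - B - C by omega)
  obtain ⟨k, hk⟩ := Int.eq_ofNat_of_zero_le (show 0 ≤ A - col by omega)
  intro x y z hx hy hz hxyz
  obtain ⟨s, hs⟩ := Int.eq_ofNat_of_zero_le (show 0 ≤ x - col by omega)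
  obtain ⟨t, ht⟩ := Int.eq_ofNat_of_zero_le (show 0 ≤ y - B by omega)
  have key := triangle_small_of_column
    (fun s t => U (col + s) (B + t) (L - col - s - B - t)) N k (by omega) ε hε ?_ ?_
    ((S.filter fun p => p.1 = col).image fun p => (p.2.1 - B).toNat) ?_ ?_ s t (by omega)
  · have e1 : col + s = x := by omega
    have e2 : B + t = y := by omega
    have e3 : L - col - s - B - t = z := by omega
    simp only [e1, e2, e3] at key
    refine key.trans (mul_le_mul_of_nonneg_right ?_ hε)
    have hNM : N + 1 ≤ M := by omega
    have hNM' : (N + 1 : ℝ) ≤ M := by exact_mod_cast hNM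
    have h0 : (0 : ℝ) ≤ N := Nat.cast_nonneg N
    calc (12 * (N + 1) : ℝ) ^ (N + 1) ≤ (12 * M : ℝ) ^ (N + 1) :=
          pow_le_pow_left₀ (by positivity) (by linarith) _
      _ ≤ (12 * M : ℝ) ^ M := pow_le_pow_right₀ (by linarith) hNM
  · intro s t hst
    have := hrel (col + s) (B + t) (L - 1 - col - s - B - t) (by omega) (by omega) (by omega)
      (by omega)
    refine le_trans (le_of_eq ?_) this
    have e1 : L - 1 - col - s - B - t + 1 = L - col - s - B - t := by ring
    have e2 : L - col - s - B - (t + 1 : ℕ) = L - 1 - col - s - B - t := by push_cast; ring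
    have e3 : L - col - (s + 1 : ℕ) - B - t = L - 1 - col - s - B - t := by push_cast; ring
    have e4 : col + (s + 1 : ℕ) = col + s + 1 := by push_cast; ring
    have e5 : B + (t + 1 : ℕ) = B + t + 1 := by push_cast; ring
    simp only [e1, e2, e3, e4, e5]
    congr 1; ring
  · intro s t hks hst
    exact htri _ _ _ (by omega) (by omega) (by omega) (by omega)
  · intro t ht hb
    have := hS (col + (0 : ℕ)) (B + t) (L - col - (0 : ℕ) - B - t) (by omega) (by omega) (by omega)
      (by omega) (by omega) hb
    simp only [Finset.mem_image, Finset.mem_filter]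
    refine ⟨_, ⟨this, by simp⟩, by simp⟩
  · have := Finset.card_image_le (s := S.filter fun p => p.1 = col)
      (f := fun p => (p.2.1 - B).toNat)
    omega

theorem triSmall_expand_snd (U : ℤ → ℤ → ℤ → ℝ) (ε : ℝ) (hε : 0 ≤ ε) (L A B B' B'' C : ℤ)
    (h₁ : B'' ≤ B') (h₂ : B' ≤ B) (hm : A + B + C ≤ L) (M : ℕ) (hM : L - A - B'' - C < M)
    (hrel : TriRel U ε L A B'' C) (htri : TriSmall U ε L A B C) (S : Finset (ℤ × ℤ × ℤ))
    (hS : ∀ x y z, A ≤ x → B'' ≤ y → y ≤ B' → C ≤ z → x + y + z = L → ε < |U x y z| →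
      (x, y, z) ∈ S)
    (hcard : (S.card : ℤ) < (L - A - B - C + 1) * (B' - B'' + 1)) :
    TriSmall U ((12 * M : ℝ) ^ M * ε) L A B' C := by
  have key := triSmall_expand_fst (fun x y z => U y x z) ε hε L B B' B'' A C h₁ h₂ (by omega) M
    (by omega) ?_ ?_ (S.image fun p => (p.2.1, p.1, p.2.2)) ?_ ?_
  · exact fun x y z hx hy hz h => key y x z hy hx hz (by omega)
  · intro x y z hx hy hz h
    refine le_trans (le_of_eq ?_) (hrel y x z hy hx hz (by omega))
    congr 1; ring
  · exact fun x y z hx hy hz h => htri y x z hy hx hz (by omega)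
  · intro x y z hx hx' hy hz h hb
    exact Finset.mem_image.2 ⟨_, hS y x z hy hx hx' hz (by omega) hb, rfl⟩
  · refine lt_of_le_of_lt (Nat.cast_le.2 Finset.card_image_le) (hcard.trans_le (le_of_eq ?_))
    ring

theorem triSmall_expand_thd (U : ℤ → ℤ → ℤ → ℝ) (ε : ℝ) (hε : 0 ≤ ε) (L A B C C' C'' : ℤ)
    (h₁ : C'' ≤ C') (h₂ : C' ≤ C) (hm : A + B + C ≤ L) (M : ℕ) (hM : L - A - B - C'' < M)
    (hrel : TriRel U ε L A B C'') (htri : TriSmall U ε L A B C) (S : Finset (ℤ × ℤ × ℤ))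
    (hS : ∀ x y z, A ≤ x → B ≤ y → C'' ≤ z → z ≤ C' → x + y + z = L → ε < |U x y z| →
      (x, y, z) ∈ S)
    (hcard : (S.card : ℤ) < (L - A - B - C + 1) * (C' - C'' + 1)) :
    TriSmall U ((12 * M : ℝ) ^ M * ε) L A B C' := by
  have key := triSmall_expand_fst (fun x y z => U z y x) ε hε L C C' C'' B A h₁ h₂ (by omega) M
    (by omega) ?_ ?_ (S.image fun p => (p.2.2, p.2.1, p.1)) ?_ ?_
  · exact fun x y z hx hy hz h => key z y x hz hy hx (by omega)
  · intro x y z hx hy hz h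
    refine le_trans (le_of_eq ?_) (hrel z y x hz hy hx (by omega))
    congr 1; ring
  · exact fun x y z hx hy hz h => htri z y x hz hy hx (by omega)
  · intro x y z hx hx' hy hz h hb
    exact Finset.mem_image.2 ⟨_, hS z y x hz hy hx hx' (by omega) hb, rfl⟩
  · refine lt_of_le_of_lt (Nat.cast_le.2 Finset.card_image_le) (hcard.trans_le (le_of_eq ?_))
    ring

/-- Multi-scale averaging: some point of `P` sees few points of `S` at every scale. -/
theorem exists_good_center {α β : Type*} (P : Finset α) (S : Finset β) (R : ℕ → α → β → Prop)
    [∀ i a b, Decidable (R i a b)] (I : ℕ) (thr bnd : ℕ → ℕ) (hthr : ∀ i, 0 < thr i)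
    (h : ∀ i < I, ∀ s ∈ S, (P.filter fun p => R i p s).card ≤ bnd i * thr i)
    (hcard : S.card * ∑ i ∈ Finset.range I, bnd i < P.card) :
    ∃ p ∈ P, ∀ i < I, (S.filter fun s => R i p s).card < thr i := by
  classical
  by_contra hcon
  push Not at hcon
  have hcov : P ⊆ (Finset.range I).biUnion fun i =>
      P.filter fun p => thr i ≤ (S.filter fun s => R i p s).card := by
    intro p hp
    obtain ⟨i, hi, hi'⟩ := hcon p hp
    simp only [Finset.mem_biUnion, Finset.mem_filter, Finset.mem_range]
    exact ⟨i, hi, hp, hi'⟩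
  have h1 := (Finset.card_le_card hcov).trans Finset.card_biUnion_le
  have h2 : ∀ i ∈ Finset.range I,
      (P.filter fun p => thr i ≤ (S.filter fun s => R i p s).card).card ≤ S.card * bnd i := by
    intro i hi
    have := Finset.card_mul_le_card_mul (R i)
      (s := P.filter fun p => thr i ≤ (S.filter fun s => R i p s).card) (t := S)
      (m := thr i) (n := bnd i * thr i) ?_ ?_
    · rw [← mul_assoc] at this
      exact Nat.le_of_mul_le_mul_right this (hthr i)
    · intro a ha
      exact (Finset.mem_filter.1 ha).2
    · intro b hb
      refine le_trans (Finset.card_le_card ?_) (h i (Finset.mem_range.1 hi) b hb)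
      intro p hp
      rw [Finset.mem_bipartiteBelow, Finset.mem_filter] at hp
      exact Finset.mem_filter.2 ⟨hp.1.1, hp.2⟩
  have h3 := h1.trans (Finset.sum_le_sum h2)
  rw [← Finset.mul_sum] at h3
  omega

theorem TriRel.mono {U : ℤ → ℤ → ℤ → ℝ} {ε ε' : ℝ} {L A B C A' B' C' : ℤ}
    (h : TriRel U ε L A B C) (hε : ε ≤ ε') (hA : A ≤ A') (hB : B ≤ B') (hC : C ≤ C') :
    TriRel U ε' L A' B' C' :=
  fun x y z hx hy hz e => (h x y z (hA.trans hx) (hB.trans hy) (hC.trans hz) e).trans hε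

theorem TriSmall.mono {U : ℤ → ℤ → ℤ → ℝ} {ε ε' : ℝ} {L A B C A' B' C' : ℤ}
    (h : TriSmall U ε L A B C) (hε : ε ≤ ε') (hA : A ≤ A') (hB : B ≤ B') (hC : C ≤ C') :
    TriSmall U ε' L A' B' C' :=
  fun x y z hx hy hz e => (h x y z (hA.trans hx) (hB.trans hy) (hC.trans hz) e).trans hε

/-- Successive expansion of a small triangle in the three directions. -/
theorem triSmall_expand (U : ℤ → ℤ → ℤ → ℝ) (ε e : ℝ) (hε : 0 ≤ ε) (hεe : ε ≤ e)
    (L A B C A' B' C' A'' B'' C'' : ℤ)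
    (hA₁ : A'' ≤ A') (hA₂ : A' ≤ A) (hB₁ : B'' ≤ B') (hB₂ : B' ≤ B) (hC₁ : C'' ≤ C') (hC₂ : C' ≤ C)
    (hm : A + B + C ≤ L) (M : ℕ) (hM0 : 1 ≤ M) (hM : L - A'' - B'' - C'' < M)
    (hrel : TriRel U ε L A'' B'' C'') (htri : TriSmall U e L A B C) (S : Finset (ℤ × ℤ × ℤ))
    (hS₁ : ∀ x y z, A'' ≤ x → x ≤ A' → B ≤ y → C ≤ z → x + y + z = L → ε < |U x y z| →
      (x, y, z) ∈ S)
    (hS₂ : ∀ x y z, A' ≤ x → B'' ≤ y → y ≤ B' → C ≤ z → x + y + z = L → ε < |U x y z| →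
      (x, y, z) ∈ S)
    (hS₃ : ∀ x y z, A' ≤ x → B' ≤ y → C'' ≤ z → z ≤ C' → x + y + z = L → ε < |U x y z| →
      (x, y, z) ∈ S)
    (hcard₁ : (S.card : ℤ) < (L - A - B - C + 1) * (A' - A'' + 1))
    (hcard₂ : (S.card : ℤ) < (L - A - B - C + 1) * (B' - B'' + 1))
    (hcard₃ : (S.card : ℤ) < (L - A - B - C + 1) * (C' - C'' + 1)) :
    TriSmall U (((12 * M : ℝ) ^ M) ^ 3 * e) L A' B' C' := by
  have hM1 : (1 : ℝ) ≤ M := by exact_mod_cast hM0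
  have hf : (1 : ℝ) ≤ (12 * M : ℝ) ^ M := one_le_pow₀ (by linarith)
  set f := (12 * M : ℝ) ^ M with hfdef
  have he : 0 ≤ e := hε.trans hεe
  have h1e : e ≤ f * e := le_mul_of_one_le_left he hf
  have hfe : 0 ≤ f * e := he.trans h1e
  have h2e : f * e ≤ f * (f * e) := le_mul_of_one_le_left hfe hf
  have s1 := triSmall_expand_fst U e he L A A' A'' B C hA₁ hA₂ hm M (by omega)
    (hrel.mono hεe le_rfl (by omega) (by omega)) htri S
    (fun x y z a b c d h hb => hS₁ x y z a b c d h (hεe.trans_lt hb)) hcard₁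
  have s2 := triSmall_expand_snd U (f * e) hfe L A' B B' B'' C hB₁ hB₂ (by omega) M (by omega)
    (hrel.mono (hεe.trans h1e) (by omega) (by omega) (by omega)) s1 S
    (fun x y z a b c d h hb => hS₂ x y z a b c d h ((hεe.trans h1e).trans_lt hb))
    (hcard₂.trans_le (mul_le_mul_of_nonneg_right (by omega) (by omega)))
  have s3 := triSmall_expand_thd U (f * (f * e)) (hfe.trans h2e) L A' B' C C' C'' hC₁ hC₂
    (by omega) M (by omega)
    (hrel.mono (hεe.trans (h1e.trans h2e)) (by omega) (by omega) (by omega)) s2 S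
    (fun x y z a b c d h hb => hS₃ x y z a b c d h ((hεe.trans (h1e.trans h2e)).trans_lt hb))
    (hcard₃.trans_le (mul_le_mul_of_nonneg_right (by omega) (by omega)))
  refine s3.mono (le_of_eq ?_) le_rfl le_rfl le_rfl
  ring

/-- The loss factor of the two-dimensional lemma. -/
noncomputable def triFac (Λ : ℕ) : ℝ := ((12 * (2 ^ Λ : ℕ) : ℝ) ^ (2 ^ Λ)) ^ (3 * Λ + 3)

/-- Two-dimensional unique continuation: a function satisfying the triangle relation, which is
small off a sparse set, is small away from the boundary of the triangle. -/
theorem triSmall_of_card (U : ℤ → ℤ → ℤ → ℝ) (ε : ℝ) (hε : 0 ≤ ε) (L ℓ : ℤ) (Λ : ℕ)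
    (hL : 200 ≤ L) (hLΛ : L < 2 ^ Λ) (hℓ0 : 0 ≤ ℓ) (hℓ : 8 * ℓ ≤ L) (hrel : TriRel U ε L 0 0 0)
    (S : Finset (ℤ × ℤ × ℤ))
    (hS : ∀ x y z, 0 ≤ x → 0 ≤ y → 0 ≤ z → x + y + z = L → ε < |U x y z| → (x, y, z) ∈ S)
    (hcard : 100000 * (Λ : ℤ) * S.card < (ℓ + 1) * L) :
    TriSmall U (triFac Λ * ε) L ℓ ℓ ℓ := by
  set H0 : ℕ := (L / 8).toNat with hH0
  have hH0' : (H0 : ℤ) = L / 8 := Int.toNat_of_nonneg (by omega)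
  set I := Nat.log 2 H0 with hI
  have hIle : 2 ^ I ≤ H0 := Nat.pow_log_le_self 2 (by omega)
  have hIlt : H0 < 2 ^ (I + 1) := Nat.lt_pow_succ_log_self (by norm_num) _
  have hIle' : ((2 : ℤ) ^ I) ≤ L / 8 := by rw [← hH0']; exact_mod_cast hIle
  have hIlt' : L / 8 < (2 : ℤ) ^ I * 2 := by rw [← hH0', ← pow_succ]; exact_mod_cast hIlt
  have hIΛ : I < Λ := by
    have : (2 : ℤ) ^ I < 2 ^ Λ := by omega
    exact (pow_lt_pow_iff_right₀ (by norm_num)).1 this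
  set a : ℤ := (L + 3) / 4 with ha
  set d : ℤ := L / 12 with hd
  have hSc0 : (0 : ℤ) ≤ S.card := Nat.cast_nonneg _
  have hΛ1 : (1 : ℤ) ≤ Λ := by exact_mod_cast (by omega : 1 ≤ Λ)
  have hScL : 100000 * (S.card : ℤ) < (ℓ + 1) * L := by nlinarith
  have hgood := exists_good_center (Finset.Icc a (a + d) ×ˢ Finset.Icc a (a + d)) S
    (fun i p s => |s.1 - p.1| ≤ 5 * 2 ^ i ∧ |s.2.1 - p.2| ≤ 5 * 2 ^ i) (I + 1)
    (fun i => (2 ^ i) ^ 2) (fun _ => 121) (fun i => by positivity) ?_ ?_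
  rotate_left
  · intro i _ s _
    have hsub : ((Finset.Icc a (a + d) ×ˢ Finset.Icc a (a + d)).filter fun p : ℤ × ℤ =>
        |s.1 - p.1| ≤ 5 * 2 ^ i ∧ |s.2.1 - p.2| ≤ 5 * 2 ^ i) ⊆
        Finset.Icc (s.1 - 5 * 2 ^ i) (s.1 + 5 * 2 ^ i) ×ˢ
          Finset.Icc (s.2.1 - 5 * 2 ^ i) (s.2.1 + 5 * 2 ^ i) := by
      intro p hp
      simp only [Finset.mem_filter, Finset.mem_product, Finset.mem_Icc, abs_le] at hp ⊢
      omega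
    refine (Finset.card_le_card hsub).trans ?_
    have h1 : (1 : ℤ) ≤ 2 ^ i := one_le_pow₀ (by norm_num)
    have h2 : ∀ c : ℤ, (Finset.Icc (c - 5 * 2 ^ i) (c + 5 * 2 ^ i)).card ≤ 11 * 2 ^ i := by
      intro c
      rw [Int.card_Icc]
      have : ((11 * 2 ^ i : ℕ) : ℤ) = 11 * 2 ^ i := by push_cast; rfl
      omega
    rw [Finset.card_product]
    refine (Nat.mul_le_mul (h2 _) (h2 _)).trans (le_of_eq ?_)
    ring
  · rw [Finset.card_product, Finset.sum_const, Finset.card_range, smul_eq_mul]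
    have h1 : ((Finset.Icc a (a + d)).card : ℤ) = d + 1 := by
      rw [Int.card_Icc, Int.toNat_of_nonneg (by omega)]; ring
    zify
    rw [h1]
    have h2 : L ≤ 12 * (d + 1) := by omega
    have h3 : ((I : ℤ) + 1) ≤ Λ := by exact_mod_cast hIΛ
    have h4 : L * L ≤ 144 * ((d + 1) * (d + 1)) := by nlinarith
    have h5 : (S.card : ℤ) * ((I + 1) * 121) ≤ 121 * (Λ * S.card) := by nlinarith
    have h6 : 8 * ((ℓ + 1) * L) ≤ (L + 8) * L := by nlinarith
    have h7 : (L + 8) * L ≤ 2 * (L * L) := by nlinarith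
    nlinarith
  obtain ⟨p, hp, hpS⟩ := hgood
  simp only [Finset.mem_product, Finset.mem_Icc] at hp
  set p1 := p.1
  set p2 := p.2
  obtain ⟨p3, hp3⟩ : ∃ p3, p1 + p2 + p3 = L := ⟨L - p1 - p2, by ring⟩
  set f : ℝ := (12 * (2 ^ Λ : ℕ) : ℝ) ^ (2 ^ Λ) with hf
  have hf1 : 1 ≤ f := by
    refine one_le_pow₀ ?_
    have : (1 : ℝ) ≤ (2 ^ Λ : ℕ) := by exact_mod_cast Nat.one_le_two_pow
    linarith
  have hLM : L < ((2 ^ Λ : ℕ) : ℤ) := by push_cast; exact hLΛ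
  have hfe : ∀ n, ε ≤ f ^ n * ε := fun n => le_mul_of_one_le_left hε (one_le_pow₀ hf1)
  have step : ∀ i ≤ I, TriSmall U (f ^ (3 * i) * ε) L (p1 - 2 ^ i) (p2 - 2 ^ i) (p3 - 2 ^ i) := by
    intro i
    induction i with
    | zero =>
      intro _ x y z hx hy hz h
      by_contra hcon
      push Not at hcon
      have h1 := hS x y z (by omega) (by omega) (by omega) h (by simpa using hcon)
      have h2 := hpS 0 (by omega)
      simp only [pow_zero, one_pow, Nat.lt_one_iff, Finset.card_eq_zero] at h2
      refine absurd (Finset.mem_filter.2 ⟨h1, ?_⟩) (h2 ▸ Finset.notMem_empty _)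
      simp only [abs_le]; omega
    | succ i ih =>
      intro hi
      have ih := ih (by omega)
      have hcd := hpS i (by omega)
      set h : ℤ := 2 ^ i with hh
      have hh1 : 1 ≤ h := one_le_pow₀ (by norm_num)
      have hh2 : h * 2 ≤ L / 8 := by
        refine le_trans ?_ hIle'
        rw [hh, ← pow_succ]
        exact pow_le_pow_right₀ (by norm_num) hi
      have hpow : (2 : ℤ) ^ (i + 1) = 2 * h := by rw [pow_succ]; ring
      rw [hpow]
      set S' := S.filter fun s => |s.1 - p1| ≤ 5 * h ∧ |s.2.1 - p2| ≤ 5 * h with hS'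
      have hcd' : (S'.card : ℤ) < h ^ 2 := by
        rw [hh]; exact_mod_cast hcd
      have hcard₁ : ∀ s t : ℤ, t - s = h →
          (S'.card : ℤ) < (L - (p1 - h) - (p2 - h) - (p3 - h) + 1) * (t - s + 1) := by
        intro s t hst
        rw [hst, show L - (p1 - h) - (p2 - h) - (p3 - h) + 1 = 3 * h + 1 by omega]
        nlinarith
      have hmem : ∀ x y z, 0 ≤ x → 0 ≤ y → 0 ≤ z → x + y + z = L → ε < |U x y z| →
          |x - p1| ≤ 5 * h ∧ |y - p2| ≤ 5 * h → (x, y, z) ∈ S' := fun x y z a b c d e g =>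
        Finset.mem_filter.2 ⟨hS x y z a b c d e, g⟩
      have := triSmall_expand U ε (f ^ (3 * i) * ε) hε (hfe _) L (p1 - h) (p2 - h) (p3 - h)
        (p1 - 2 * h) (p2 - 2 * h) (p3 - 2 * h) (p1 - 3 * h) (p2 - 3 * h) (p3 - 3 * h)
        (by omega) (by omega) (by omega) (by omega) (by omega) (by omega) (by omega) (2 ^ Λ)
        Nat.one_le_two_pow (by omega) (hrel.mono le_rfl (by omega) (by omega) (by omega)) ih S'
        (fun x y z _ _ _ _ _ hb => hmem x y z (by omega) (by omega) (by omega) (by omega) hb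
          (by simp only [abs_le]; omega))
        (fun x y z _ _ _ _ _ hb => hmem x y z (by omega) (by omega) (by omega) (by omega) hb
          (by simp only [abs_le]; omega))
        (fun x y z _ _ _ _ _ hb => hmem x y z (by omega) (by omega) (by omega) (by omega) hb
          (by simp only [abs_le]; omega))
        (hcard₁ _ _ (by ring)) (hcard₁ _ _ (by ring)) (hcard₁ _ _ (by ring))
      refine this.mono (le_of_eq ?_) le_rfl le_rfl le_rfl
      rw [← mul_assoc, ← pow_add]; congr 2; ring
  have last := step I le_rfl
  set H : ℤ := 2 ^ I with hH
  have hcardH : (S.card : ℤ) < (3 * H + 1) * (ℓ + 1) := by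
    have h1 : (ℓ + 1) * L ≤ (ℓ + 1) * (16 * H) :=
      mul_le_mul_of_nonneg_left (by omega) (by omega)
    linarith
  have hcardF : (S.card : ℤ) < (L - (p1 - H) - (p2 - H) - (p3 - H) + 1) * (ℓ - 0 + 1) :=
    hcardH.trans_eq (by linear_combination (ℓ + 1) * hp3)
  have fin := triSmall_expand U ε (f ^ (3 * I) * ε) hε (hfe _) L (p1 - H) (p2 - H) (p3 - H)
    ℓ ℓ ℓ 0 0 0 hℓ0 (by omega) hℓ0 (by omega) hℓ0 (by omega) (by omega) (2 ^ Λ)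
    Nat.one_le_two_pow (by omega) hrel last S
    (fun x y z _ _ _ _ h hb => hS x y z (by omega) (by omega) (by omega) h hb)
    (fun x y z _ _ _ _ h hb => hS x y z (by omega) (by omega) (by omega) h hb)
    (fun x y z _ _ _ _ h hb => hS x y z (by omega) (by omega) (by omega) h hb)
    hcardF hcardF hcardF
  refine fin.mono ?_ le_rfl le_rfl le_rfl
  rw [← mul_assoc, ← pow_add]
  refine mul_le_mul_of_nonneg_right ?_ hε
  exact pow_le_pow_right₀ hf1 (by omega)

/-- `U` satisfies a discrete Schrödinger inequality at `(x, y, z)`. -/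
def SchRel (U : ℤ → ℤ → ℤ → ℝ) (κ : ℝ) (x y z : ℤ) : Prop :=
  |U (x + 1) y z + U (x - 1) y z + U x (y + 1) z + U x (y - 1) z + U x y (z + 1) + U x y (z - 1)|
    ≤ κ * |U x y z|

theorem one_le_triFac (Λ : ℕ) : 1 ≤ triFac Λ := by
  refine one_le_pow₀ (one_le_pow₀ ?_)
  have : (1 : ℝ) ≤ (2 ^ Λ : ℕ) := by exact_mod_cast Nat.one_le_two_pow
  linarith

/-- Propagation of smallness upwards from a two-layer base of the positive octant. -/
theorem small_tent (U : ℤ → ℤ → ℤ → ℝ) (κ ε : ℝ) (hκ : 0 ≤ κ) (hε : 0 ≤ ε) (W q : ℤ) (J Λ : ℕ)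
    (hW : 900 ≤ W) (hWΛ : 2 * W < 2 ^ Λ) (hq : 100 * q ≤ W) (hJ : 4 * (J : ℤ) ≤ W)
    (hbase : ∀ x y z, 0 ≤ x → 0 ≤ y → 0 ≤ z → W - 1 ≤ x + y + z → x + y + z ≤ W → |U x y z| ≤ ε)
    (hrel : ∀ x y z, 0 ≤ x → 0 ≤ y → 0 ≤ z → W ≤ x + y + z → x + y + z < W + J →
      SchRel U κ x y z)
    (S : Finset (ℤ × ℤ × ℤ))
    (hS : ∀ x y z, 0 ≤ x → 0 ≤ y → 0 ≤ z → W < x + y + z → x + y + z ≤ W + J → ε < |U x y z| →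
      (x, y, z) ∈ S)
    (hcard : 400000 * (Λ : ℤ) * S.card ≤ q * W) (j : ℕ) (hj : j ≤ J + 1) (x y z : ℤ)
    (hxyz : x + y + z = W - 1 + j) (hx : j + 2 * q ≤ 2 * x) (hy : j + 2 * q ≤ 2 * y)
    (hz : j + 2 * q ≤ 2 * z) :
    |U x y z| ≤ ((κ + 3) * triFac Λ) ^ j * ε := by
  set b : ℕ → ℕ := fun i => (S.filter fun s => s.1 + s.2.1 + s.2.2 = W - 1 + i).card with hb
  set ℓ : ℕ → ℤ := fun i => 400000 * Λ * b i / W with hℓ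
  have hℓ0 : ∀ i, 0 ≤ ℓ i := fun i => Int.ediv_nonneg (by positivity) (by omega)
  have hℓ1 : ∀ i, ℓ i * W ≤ 400000 * Λ * b i := fun i => Int.ediv_mul_le _ (by omega)
  have hℓ2 : ∀ i, 400000 * Λ * b i < (ℓ i + 1) * W := fun i =>
    Int.lt_ediv_add_one_mul_self _ (by omega)
  set T : ℕ → ℤ := fun j => ∑ i ∈ Finset.range (j + 1), ℓ i with hT
  have hTs : ∀ j, T (j + 1) = T j + ℓ (j + 1) := fun j => Finset.sum_range_succ _ _
  have hbS : ∀ j, ∑ i ∈ Finset.range (j + 1), b i ≤ S.card := by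
    intro j
    rw [hb, ← Finset.card_biUnion]
    · refine Finset.card_le_card fun s hs => ?_
      simp only [Finset.mem_biUnion, Finset.mem_filter] at hs
      obtain ⟨_, _, h, _⟩ := hs
      exact h
    · intro i _ i' _ hne
      rw [Function.onFun, Finset.disjoint_left]
      intro s hs hs'
      rw [Finset.mem_filter] at hs hs'
      omega
  have hTq : ∀ j, T j ≤ q := by
    intro j
    have h1 : T j * W ≤ 400000 * Λ * S.card := by
      calc T j * W = ∑ i ∈ Finset.range (j + 1), ℓ i * W := by rw [hT, Finset.sum_mul]
        _ ≤ ∑ i ∈ Finset.range (j + 1), 400000 * (Λ : ℤ) * b i := Finset.sum_le_sum fun i _ => hℓ1 i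
        _ = 400000 * Λ * ((∑ i ∈ Finset.range (j + 1), b i : ℕ) : ℤ) := by
            rw [← Finset.mul_sum]; push_cast; rfl
        _ ≤ _ := mul_le_mul_of_nonneg_left (by exact_mod_cast hbS j) (by positivity)
    exact le_of_mul_le_mul_right (h1.trans hcard) (by omega)
  have hT0 : ∀ j, 0 ≤ T j := fun j => Finset.sum_nonneg fun i _ => hℓ0 i
  have hℓq : ∀ j, ℓ (j + 1) ≤ q := fun j => by
    have := hTs j
    have := hTq (j + 1)
    have := hT0 j
    omega
  set G : ℝ := (κ + 3) * triFac Λ with hG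
  have hG1 : 1 ≤ G := by
    have := one_le_triFac Λ
    nlinarith
  have hGm : ∀ j, ε ≤ G ^ j * ε := fun j => le_mul_of_one_le_left hε (one_le_pow₀ hG1)
  have main : ∀ j : ℕ, j ≤ J → (∀ x y z : ℤ, x + y + z = W - 1 + j → j + 2 * T j ≤ 2 * x →
        j + 2 * T j ≤ 2 * y → j + 2 * T j ≤ 2 * z → |U x y z| ≤ G ^ j * ε) ∧
      (∀ x y z : ℤ, x + y + z = W - 1 + (j + 1 : ℕ) → (j + 1 : ℕ) + 2 * T (j + 1) ≤ 2 * x →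
        (j + 1 : ℕ) + 2 * T (j + 1) ≤ 2 * y → (j + 1 : ℕ) + 2 * T (j + 1) ≤ 2 * z →
        |U x y z| ≤ G ^ (j + 1) * ε) := by
    intro j
    induction j with
    | zero =>
      intro _
      have := hT0 0
      have := hT0 (0 + 1)
      constructor
      · intro x y z h hx hy hz
        exact (hbase x y z (by omega) (by omega) (by omega) (by omega) (by omega)).trans (hGm _)
      · intro x y z h hx hy hz
        exact (hbase x y z (by omega) (by omega) (by omega) (by omega) (by omega)).trans (hGm _)
    | succ j ih =>
      intro hj
      obtain ⟨ih0, ih1⟩ := ih (by omega)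
      refine ⟨ih1, ?_⟩
      have t0 := hT0 j
      have t1 := hTs j
      have t2 := hTs (j + 1)
      have t3 := hTq (j + 1)
      have t4 := hT0 (j + 1)
      have t5 := hℓ0 (j + 1)
      have t6 := hℓ0 (j + 1 + 1)
      have t7 := hℓq (j + 1)
      set D : ℤ := (j + 3) / 2 + T (j + 1) with hD
      set e : ℝ := G ^ (j + 1) * ε with he
      have he0 : 0 ≤ e := hε.trans (hGm _)
      have hee : G ^ j * ε ≤ e :=
        mul_le_mul_of_nonneg_right (pow_le_pow_right₀ hG1 (by omega)) hε
      have heκ : e ≤ (κ + 3) * e := le_mul_of_one_le_left he0 (by linarith)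
      have hLW : W ≤ 4 * (W + j + 1 - 3 * D) := by omega
      have key := triSmall_of_card (fun x y z => U (x + D) (y + D) (z + D)) ((κ + 3) * e)
        (he0.trans heκ) (W + j + 1 - 3 * D) (ℓ (j + 1 + 1)) Λ (by omega) (by omega) t6 (by omega)
        ?_ ((S.filter fun s => s.1 + s.2.1 + s.2.2 = W - 1 + (j + 1 + 1 : ℕ)).image
          fun s => (s.1 - D, s.2.1 - D, s.2.2 - D)) ?_ ?_
      · intro x y z h hx hy hz
        have := key (x - D) (y - D) (z - D) (by omega) (by omega) (by omega) (by omega)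
        simp only [sub_add_cancel] at this
        refine this.trans (le_of_eq ?_)
        rw [he, hG, pow_succ _ (j + 1)]; ring
      · intro x y z hx hy hz h
        have r := hrel (x + D) (y + D) (z + D) (by omega) (by omega) (by omega) (by omega)
          (by omega)
        rw [SchRel] at r
        have v0 := ih1 (x + D) (y + D) (z + D) (by omega) (by omega) (by omega) (by omega)
        have v1 := (ih0 (x + D - 1) (y + D) (z + D) (by omega) (by omega) (by omega)
          (by omega)).trans hee
        have v2 := (ih0 (x + D) (y + D - 1) (z + D) (by omega) (by omega) (by omega)
          (by omega)).trans hee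
        have v3 := (ih0 (x + D) (y + D) (z + D - 1) (by omega) (by omega) (by omega)
          (by omega)).trans hee
        have r' := r.trans (mul_le_mul_of_nonneg_left v0 hκ)
        beta_reduce
        rw [add_right_comm x 1 D, add_right_comm y 1 D, add_right_comm z 1 D]
        rw [abs_le] at *
        constructor <;> linarith
      · intro x y z hx hy hz h hb
        refine Finset.mem_image.2 ⟨(x + D, y + D, z + D), Finset.mem_filter.2 ⟨?_, ?_⟩, by simp⟩
        · exact hS _ _ _ (by omega) (by omega) (by omega) (by omega) (by omega)
            (((hGm _).trans heκ).trans_lt hb)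
        · push_cast; omega
      · have h1 : (((S.filter fun s => s.1 + s.2.1 + s.2.2 = W - 1 + (j + 1 + 1 : ℕ)).image
          fun s => (s.1 - D, s.2.1 - D, s.2.2 - D)).card : ℤ) ≤ b (j + 1 + 1) := by
          exact_mod_cast Finset.card_image_le
        have h2 := hℓ2 (j + 1 + 1)
        have h3 : (ℓ (j + 1 + 1) + 1) * W ≤ (ℓ (j + 1 + 1) + 1) * (4 * (W + j + 1 - 3 * D)) :=
          mul_le_mul_of_nonneg_left hLW (by omega)
        have h4 := mul_le_mul_of_nonneg_left h1 (by positivity : (0 : ℤ) ≤ 100000 * Λ)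
        linarith
  rcases j with _ | j
  · have := hTq 0
    exact (main 0 (by omega)).1 x y z hxyz (by omega) (by omega) (by omega)
  · have := hTq (j + 1)
    exact (main j (by omega)).2 x y z hxyz (by omega) (by omega) (by omega)

/-- Smallness on an octahedron, together with a Schrödinger inequality and a bound for the number
of large values on the doubled octahedron. -/
structure OctHyp (U : ℤ → ℤ → ℤ → ℝ) (κ ε : ℝ) (w : ℤ) (n : ℕ) : Prop where
  base : ∀ x y z, |x| + |y| + |z| ≤ w → |U x y z| ≤ ε
  rel : ∀ x y z, |x| + |y| + |z| ≤ 2 * w → SchRel U κ x y z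
  cover : ∃ S : Finset (ℤ × ℤ × ℤ), S.card ≤ n ∧
    ∀ x y z, |x| + |y| + |z| ≤ 2 * w → ε < |U x y z| → (x, y, z) ∈ S

namespace OctHyp

variable {U : ℤ → ℤ → ℤ → ℝ} {κ ε : ℝ} {w : ℤ} {n : ℕ}

theorem neg_fst (h : OctHyp U κ ε w n) : OctHyp (fun x y z => U (-x) y z) κ ε w n where
  base x y z hl := h.base _ _ _ (by rwa [abs_neg])
  rel x y z hl := by
    have := h.rel (-x) y z (by rwa [abs_neg])
    rw [SchRel] at this ⊢
    rw [show -(x + 1) = -x - 1 by ring, show -(x - 1) = -x + 1 by ring]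
    refine le_trans (le_of_eq ?_) this
    congr 1; ring
  cover := by
    obtain ⟨S, hS, hc⟩ := h.cover
    refine ⟨S.image fun p => (-p.1, p.2.1, p.2.2), Finset.card_image_le.trans hS, ?_⟩
    intro x y z hl hb
    exact Finset.mem_image.2 ⟨_, hc (-x) y z (by rwa [abs_neg]) hb, by simp⟩

theorem swap₁₂ (h : OctHyp U κ ε w n) : OctHyp (fun x y z => U y x z) κ ε w n where
  base x y z hl := h.base _ _ _ (by omega)
  rel x y z hl := by
    have := h.rel y x z (by omega)
    rw [SchRel] at this ⊢
    refine le_trans (le_of_eq ?_) this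
    congr 1; ring
  cover := by
    obtain ⟨S, hS, hc⟩ := h.cover
    refine ⟨S.image fun p => (p.2.1, p.1, p.2.2), Finset.card_image_le.trans hS, ?_⟩
    intro x y z hl hb
    exact Finset.mem_image.2 ⟨_, hc y x z (by omega) hb, by simp⟩

theorem swap₁₃ (h : OctHyp U κ ε w n) : OctHyp (fun x y z => U z y x) κ ε w n where
  base x y z hl := h.base _ _ _ (by omega)
  rel x y z hl := by
    have := h.rel z y x (by omega)
    rw [SchRel] at this ⊢
    refine le_trans (le_of_eq ?_) this
    congr 1; ring
  cover := by
    obtain ⟨S, hS, hc⟩ := h.cover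
    refine ⟨S.image fun p => (p.2.2, p.2.1, p.1), Finset.card_image_le.trans hS, ?_⟩
    intro x y z hl hb
    exact Finset.mem_image.2 ⟨_, hc z y x (by omega) hb, by simp⟩

theorem neg_snd (h : OctHyp U κ ε w n) : OctHyp (fun x y z => U x (-y) z) κ ε w n :=
  h.swap₁₂.neg_fst.swap₁₂

theorem neg_thd (h : OctHyp U κ ε w n) : OctHyp (fun x y z => U x y (-z)) κ ε w n :=
  h.swap₁₃.neg_fst.swap₁₃

theorem swap₂₃ (h : OctHyp U κ ε w n) : OctHyp (fun x y z => U x z y) κ ε w n :=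
  h.swap₁₂.swap₁₃.swap₁₂

theorem exists_abs (h : OctHyp U κ ε w n) (x y z : ℤ) :
    ∃ U', OctHyp U' κ ε w n ∧ U' |x| |y| |z| = U x y z := by
  have h1 : ∃ U', OctHyp U' κ ε w n ∧ U' |x| y z = U x y z := by
    rcases abs_choice x with hx | hx
    · exact ⟨U, h, by rw [hx]⟩
    · exact ⟨_, h.neg_fst, by simp only [hx, neg_neg]⟩
  obtain ⟨U₁, h₁, e₁⟩ := h1
  have h2 : ∃ U', OctHyp U' κ ε w n ∧ U' |x| |y| z = U x y z := by
    rcases abs_choice y with hy | hy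
    · exact ⟨U₁, h₁, by rw [hy, e₁]⟩
    · exact ⟨_, h₁.neg_snd, by simp only [hy, neg_neg, e₁]⟩
  obtain ⟨U₂, h₂, e₂⟩ := h2
  rcases abs_choice z with hz | hz
  · exact ⟨U₂, h₂, by rw [hz, e₂]⟩
  · exact ⟨_, h₂.neg_thd, by simp only [hz, neg_neg, e₂]⟩

/-- Growth over the faces of the octahedron. -/
theorem small_face (h : OctHyp U κ ε w n) (hκ : 0 ≤ κ) (hε : 0 ≤ ε) (q Λ : ℕ) (hq : 1 ≤ q)
    (hw : 1000 * (q : ℤ) ≤ w) (hwΛ : 2 * w < 2 ^ Λ) (hn : 1000 * Λ * n ≤ q ^ 2)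
    (x y z : ℤ) (hl : |x| + |y| + |z| ≤ w + 5 * q)
    (hx : |x| + |y| + |z| - w + 1 + 2 * q ≤ 2 * |x|)
    (hy : |x| + |y| + |z| - w + 1 + 2 * q ≤ 2 * |y|)
    (hz : |x| + |y| + |z| - w + 1 + 2 * q ≤ 2 * |z|) :
    |U x y z| ≤ ((κ + 3) * triFac Λ) ^ (5 * q + 1) * ε := by
  have hG1 : 1 ≤ (κ + 3) * triFac Λ := by
    have := one_le_triFac Λ
    nlinarith
  rcases le_or_gt (|x| + |y| + |z|) w with hlw | hlw
  · exact (h.base x y z hlw).trans (le_mul_of_one_le_left hε (one_le_pow₀ hG1))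
  obtain ⟨U', h', e⟩ := h.exists_abs x y z
  rw [← e]
  obtain ⟨S, hS, hc⟩ := h'.cover
  obtain ⟨j, hj⟩ := Int.eq_ofNat_of_zero_le (show 0 ≤ |x| + |y| + |z| - w + 1 by omega)
  have key := small_tent U' κ ε hκ hε w q (5 * q) Λ (by omega) hwΛ (by omega) (by omega)
    (fun x y z hx hy hz _ h2 => h'.base x y z (by
      rw [abs_of_nonneg hx, abs_of_nonneg hy, abs_of_nonneg hz]; exact h2))
    (fun x y z hx hy hz _ h2 => h'.rel x y z (by
      rw [abs_of_nonneg hx, abs_of_nonneg hy, abs_of_nonneg hz]; omega)) S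
    (fun x y z hx hy hz _ h2 hb => hc x y z (by
      rw [abs_of_nonneg hx, abs_of_nonneg hy, abs_of_nonneg hz]; omega) hb) ?_ j (by omega)
    |x| |y| |z| (by omega) (by omega) (by omega) (by omega)
  · refine key.trans (mul_le_mul_of_nonneg_right ?_ hε)
    exact pow_le_pow_right₀ hG1 (by omega)
  · have h1 : (1000 * Λ * S.card : ℤ) ≤ q ^ 2 := by
      exact_mod_cast (Nat.mul_le_mul_left _ hS).trans hn
    have : (q : ℤ) * (1000 * q) ≤ q * w := mul_le_mul_of_nonneg_left hw (by omega)
    nlinarith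

/-- Growth over the edges of the octahedron. -/
theorem small_edge (h : OctHyp U κ ε w n) (hκ : 0 ≤ κ) (hε : 0 ≤ ε) (q Λ : ℕ) (hq : 1 ≤ q)
    (hw : 1000 * (q : ℤ) ≤ w) (hwΛ : 2 * w < 2 ^ Λ) (hn : 1000 * Λ * n ≤ q ^ 2)
    (x y z : ℤ) (hl : |x| + |y| + |z| ≤ w + q) (hx : 8 * (q : ℤ) ≤ |x|) (hy : 8 * (q : ℤ) ≤ |y|) :
    |U x y z| ≤ ((κ + 3) * triFac Λ) ^ (9 * q + 2) * ε := by
  have hG1 : 1 ≤ (κ + 3) * triFac Λ := by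
    have := one_le_triFac Λ
    nlinarith
  rcases lt_or_ge (|x| + |y| + |z|) w with hlw | hlw
  · exact (h.base x y z hlw.le).trans (le_mul_of_one_le_left hε (one_le_pow₀ hG1))
  obtain ⟨U', h', e⟩ := h.exists_abs x y z
  rw [← e]
  obtain ⟨S, hS, hc⟩ := h'.cover
  set G := (κ + 3) * triFac Λ with hG
  have hz0 := abs_nonneg z
  have hE0 : ε ≤ G ^ (5 * q + 1) * ε := le_mul_of_one_le_left hε (one_le_pow₀ hG1)
  obtain ⟨j, hj⟩ := Int.eq_ofNat_of_zero_le (show 0 ≤ |x| + |y| + |z| - w + 3 * q + 1 by omega)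
  have key := small_tent (fun x y z => U' (x + 4 * q) (y + 4 * q) (z - 4 * q)) κ
    (G ^ (5 * q + 1) * ε) hκ (hε.trans hE0) (w - 7 * q) q (4 * q) Λ (by omega) (by omega)
    (by omega) (by omega) ?_ ?_ (S.image fun s => (s.1 - 4 * q, s.2.1 - 4 * q, s.2.2 + 4 * q)) ?_
    ?_ j (by omega) (|x| - 4 * q) (|y| - 4 * q) (|z| + 4 * q) (by omega) (by omega) (by omega)
    (by omega)
  · simp only [sub_add_cancel, add_sub_cancel_right] at key
    refine key.trans ?_
    rw [← mul_assoc, ← pow_add]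
    refine mul_le_mul_of_nonneg_right ?_ hε
    exact pow_le_pow_right₀ hG1 (by omega)
  · intro x y z hx hy hz h1 h2
    have hx' := abs_of_nonneg (show 0 ≤ x + 4 * (q : ℤ) by omega)
    have hy' := abs_of_nonneg (show 0 ≤ y + 4 * (q : ℤ) by omega)
    have hz' := abs_cases (z - 4 * (q : ℤ))
    rcases le_or_gt (|x + 4 * (q : ℤ)| + |y + 4 * (q : ℤ)| + |z - 4 * (q : ℤ)|) w with hlw | hlw
    · exact (h'.base _ _ _ hlw).trans hE0
    · exact h'.small_face hκ hε q Λ hq hw hwΛ hn _ _ _ (by omega) (by omega) (by omega) (by omega)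
  · intro x y z hx hy hz h1 h2
    have hx' := abs_of_nonneg (show 0 ≤ x + 4 * (q : ℤ) by omega)
    have hy' := abs_of_nonneg (show 0 ≤ y + 4 * (q : ℤ) by omega)
    have hz' := abs_cases (z - 4 * (q : ℤ))
    have := h'.rel (x + 4 * q) (y + 4 * q) (z - 4 * q) (by omega)
    rw [SchRel] at this ⊢
    refine le_trans (le_of_eq ?_) this
    simp only [add_sub_right_comm, add_right_comm, sub_right_comm]
  · intro x y z hx hy hz h1 h2 hb
    have hx' := abs_of_nonneg (show 0 ≤ x + 4 * (q : ℤ) by omega)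
    have hy' := abs_of_nonneg (show 0 ≤ y + 4 * (q : ℤ) by omega)
    have hz' := abs_cases (z - 4 * (q : ℤ))
    exact Finset.mem_image.2 ⟨_, hc (x + 4 * q) (y + 4 * q) (z - 4 * q) (by omega)
      (hE0.trans_lt hb), by simp⟩
  · have h1 : (1000 * Λ * S.card : ℤ) ≤ q ^ 2 := by
      exact_mod_cast (Nat.mul_le_mul_left _ hS).trans hn
    have h2 : (q : ℤ) * (500 * q) ≤ q * (w - 7 * q) := mul_le_mul_of_nonneg_left (by omega) (by omega)
    have h3 : ((S.image fun s => (s.1 - 4 * (q : ℤ), s.2.1 - 4 * (q : ℤ), s.2.2 + 4 * (q : ℤ))).card : ℤ)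
        ≤ S.card := by exact_mod_cast Finset.card_image_le
    have h4 := mul_le_mul_of_nonneg_left h3 (by positivity : (0 : ℤ) ≤ 400000 * Λ)
    nlinarith

/-- Growth near a vertex of the octahedron. -/
theorem small_vertex (h : OctHyp U κ ε w n) (hκ : 0 ≤ κ) (hε : 0 ≤ ε) (q Λ : ℕ) (hq : 1 ≤ q)
    (hw : 1000 * (q : ℤ) ≤ w) (hwΛ : 2 * w < 2 ^ Λ) (hn : 1000 * Λ * n ≤ q ^ 2)
    (x y z : ℤ) (hl : |x| + |y| + |z| ≤ w + q) (hz : 8 * (q : ℤ) ≤ |z|) :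
    |U x y z| ≤ (κ + 5) ^ (17 * q) * (((κ + 3) * triFac Λ) ^ (9 * q + 2) * ε) := by
  have hG1 : 1 ≤ (κ + 3) * triFac Λ := by
    have := one_le_triFac Λ
    nlinarith
  obtain ⟨U', h', e⟩ := h.exists_abs x y z
  rw [← e]
  set E := ((κ + 3) * triFac Λ) ^ (9 * q + 2) * ε with hE
  have hεE : ε ≤ E := le_mul_of_one_le_left hε (one_le_pow₀ hG1)
  have hE0 : 0 ≤ E := hε.trans hεE
  have hκ1 : 1 ≤ κ + 5 := by linarith
  have main : ∀ k : ℕ, ∀ x y z : ℤ, |x| + |y| + z ≤ w + q → 8 * (q : ℤ) ≤ z →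
      z ≤ w - 16 * q + k → |U' x y z| ≤ (κ + 5) ^ k * E := by
    intro k
    induction k with
    | zero =>
      intro x y z hl hz hzw
      have hz' := abs_of_nonneg (show 0 ≤ z by omega)
      rw [pow_zero, one_mul]
      rcases le_or_gt (|x| + |y| + |z|) w with hlw | hlw
      · exact (h'.base _ _ _ hlw).trans hεE
      rcases le_or_gt (8 * (q : ℤ)) |x| with hx | hx
      · exact h'.swap₂₃.small_edge hκ hε q Λ hq hw hwΛ hn x z y (by omega) hx (by omega)
      · exact h'.swap₁₃.small_edge hκ hε q Λ hq hw hwΛ hn z y x (by omega) (by omega) (by omega)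
    | succ k ih =>
      intro x y z hl hz hzw
      rcases le_or_gt z (w - 16 * q + k) with hzk | hzk
      · refine (ih x y z hl hz hzk).trans (mul_le_mul_of_nonneg_right ?_ hE0)
        exact pow_le_pow_right₀ hκ1 (by omega)
      have r := h'.rel x y (z - 1) (by rw [abs_of_nonneg (show 0 ≤ z - 1 by omega)]; omega)
      rw [SchRel, sub_add_cancel] at r
      push_cast at hzw
      have ax := abs_add_le x 1
      have ax' := abs_sub x 1
      have ay := abs_add_le y 1
      have ay' := abs_sub y 1
      rw [abs_one] at ax ax' ay ay'
      have v0 := ih x y (z - 1) (by omega) (by omega) (by omega)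
      have v1 := ih (x + 1) y (z - 1) (by omega) (by omega) (by omega)
      have v2 := ih (x - 1) y (z - 1) (by omega) (by omega) (by omega)
      have v3 := ih x (y + 1) (z - 1) (by omega) (by omega) (by omega)
      have v4 := ih x (y - 1) (z - 1) (by omega) (by omega) (by omega)
      have v5 := ih x y (z - 1 - 1) (by omega) (by omega) (by omega)
      have r' := r.trans (mul_le_mul_of_nonneg_left v0 hκ)
      rw [pow_succ, mul_comm _ (κ + 5), mul_assoc]
      rw [abs_le] at *
      constructor <;> linarith
  exact main (17 * q) _ _ _ (by rwa [abs_abs, abs_abs]) hz (by push_cast; have := abs_nonneg x; have := abs_nonneg y; omega)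

/-- Growth of the octahedron on which the function is small. -/
theorem grow (h : OctHyp U κ ε w n) (hκ : 0 ≤ κ) (hε : 0 ≤ ε) (q Λ : ℕ) (hq : 1 ≤ q)
    (hw : 1000 * (q : ℤ) ≤ w) (hwΛ : 2 * w < 2 ^ Λ) (hn : 1000 * Λ * n ≤ q ^ 2)
    (x y z : ℤ) (hl : |x| + |y| + |z| ≤ w + q) :
    |U x y z| ≤ ((κ + 5) * triFac Λ) ^ (28 * q) * ε := by
  have ht := one_le_triFac Λ
  have hG1 : 1 ≤ (κ + 5) * triFac Λ := by nlinarith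
  have hle : (κ + 5) ^ (17 * q) * (((κ + 3) * triFac Λ) ^ (9 * q + 2) * ε)
      ≤ ((κ + 5) * triFac Λ) ^ (28 * q) * ε := by
    rw [← mul_assoc]
    refine mul_le_mul_of_nonneg_right ?_ hε
    calc _ ≤ ((κ + 5) * triFac Λ) ^ (17 * q) * ((κ + 5) * triFac Λ) ^ (9 * q + 2) := by
          refine mul_le_mul (pow_le_pow_left₀ (by linarith) (le_mul_of_one_le_right (by linarith) ht) _)
            (pow_le_pow_left₀ (by nlinarith) (by nlinarith) _) (pow_nonneg (by nlinarith) _) (by positivity)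
      _ = ((κ + 5) * triFac Λ) ^ (17 * q + (9 * q + 2)) := (pow_add _ _ _).symm
      _ ≤ _ := pow_le_pow_right₀ hG1 (by omega)
  rcases le_or_gt (|x| + |y| + |z|) w with hlw | hlw
  · exact (h.base x y z hlw).trans (le_mul_of_one_le_left hε (one_le_pow₀ hG1))
  refine le_trans ?_ hle
  rcases le_or_gt (8 * (q : ℤ)) |z| with hz | hz
  · exact h.small_vertex hκ hε q Λ hq hw hwΛ hn x y z hl hz
  rcases le_or_gt (8 * (q : ℤ)) |x| with hx | hx
  · exact h.swap₁₃.small_vertex hκ hε q Λ hq hw hwΛ hn z y x (by omega) hx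
  · exact h.swap₂₃.small_vertex hκ hε q Λ hq hw hwΛ hn x z y (by omega) (by omega)

end OctHyp

/-- Quantitative unique continuation: a solution which is large at the origin is large at many
points of a cube, with a loss which is slightly worse than exponential in the area. -/
theorem small_center (U : ℤ → ℤ → ℤ → ℝ) (κ ε : ℝ) (hκ : 0 ≤ κ) (hε : 0 ≤ ε) (I : ℕ) (hI : 1 ≤ I)
    (R : ℤ) (hR : 2250 * 2 ^ I ≤ R)
    (hrel : ∀ x y z, |x| ≤ R → |y| ≤ R → |z| ≤ R → SchRel U κ x y z) (S : Finset (ℤ × ℤ × ℤ))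
    (hS : ∀ x y z, |x| ≤ R → |y| ≤ R → |z| ≤ R → ε < |U x y z| → (x, y, z) ∈ S)
    (hcard : 5000000 * (I + 11) * S.card ≤ (2 ^ I) ^ 2) :
    |U 0 0 0| ≤ ((κ + 5) * triFac (I + 11)) ^ (28000 * 2 ^ I) * ε := by
  set Λ := I + 11 with hΛ
  set d : ℤ := 250 * 2 ^ I with hd
  have hh1 : (1 : ℤ) ≤ 2 ^ I := one_le_pow₀ (by norm_num)
  have hgood := exists_good_center
    (Finset.Icc (-d) d ×ˢ (Finset.Icc (-d) d ×ˢ Finset.Icc (-d) d)) S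
    (fun i p s => |s.1 - p.1| ≤ 4000 * 2 ^ i ∧ |s.2.1 - p.2.1| ≤ 4000 * 2 ^ i ∧
      |s.2.2 - p.2.2| ≤ 4000 * 2 ^ i) I
    (fun i => (2 ^ i) ^ 2 / (1000 * Λ) + 1) (fun i => 8001 ^ 3 * (1000 * Λ) * 2 ^ i)
    (fun i => by positivity) ?_ ?_
  rotate_left
  · intro i _ s _
    refine (Finset.card_le_card (t := Finset.Icc (s.1 - 4000 * 2 ^ i) (s.1 + 4000 * 2 ^ i) ×ˢ
      (Finset.Icc (s.2.1 - 4000 * 2 ^ i) (s.2.1 + 4000 * 2 ^ i) ×ˢ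
        Finset.Icc (s.2.2 - 4000 * 2 ^ i) (s.2.2 + 4000 * 2 ^ i))) ?_).trans ?_
    · intro p hp
      simp only [Finset.mem_filter, Finset.mem_product, Finset.mem_Icc, abs_le] at hp ⊢
      omega
    have h1 : (1 : ℤ) ≤ 2 ^ i := one_le_pow₀ (by norm_num)
    have h2 : ∀ c : ℤ, (Finset.Icc (c - 4000 * 2 ^ i) (c + 4000 * 2 ^ i)).card ≤ 8001 * 2 ^ i := by
      intro c
      rw [Int.card_Icc]
      have : ((8001 * 2 ^ i : ℕ) : ℤ) = 8001 * 2 ^ i := by push_cast; rfl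
      omega
    rw [Finset.card_product, Finset.card_product]
    refine (Nat.mul_le_mul (h2 _) (Nat.mul_le_mul (h2 _) (h2 _))).trans ?_
    have h3 := (Nat.lt_mul_div_succ ((2 ^ i) ^ 2) (show 0 < 1000 * Λ by omega)).le
    calc _ = 8001 ^ 3 * 2 ^ i * (2 ^ i) ^ 2 := by ring
      _ ≤ 8001 ^ 3 * 2 ^ i * (1000 * Λ * ((2 ^ i) ^ 2 / (1000 * Λ) + 1)) :=
          Nat.mul_le_mul_left _ h3
      _ = _ := by ring
  · rw [← Finset.mul_sum, Finset.card_product, Finset.card_product]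
    have h1 : (Finset.Icc (-d) d).card = 500 * 2 ^ I + 1 := by
      rw [Int.card_Icc]
      have : ((500 * 2 ^ I : ℕ) : ℤ) = 500 * 2 ^ I := by push_cast; rfl
      omega
    have h2 : ∑ i ∈ Finset.range I, 2 ^ i < 2 ^ I := by
      have := Nat.geomSum_lt (m := 2) (n := I) (s := Finset.range I) le_rfl (by simp)
      exact this
    rw [h1]
    have h3 : 1 ≤ 2 ^ I := Nat.one_le_two_pow
    calc S.card * (8001 ^ 3 * (1000 * Λ) * ∑ i ∈ Finset.range I, 2 ^ i)
        ≤ S.card * (8001 ^ 3 * (1000 * Λ) * 2 ^ I) := by gcongr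
      _ ≤ 500 ^ 3 * (5000000 * Λ * S.card) * 2 ^ I := by
          have : 8001 ^ 3 * 1000 * (S.card * Λ * 2 ^ I) ≤
            500 ^ 3 * 5000000 * (S.card * Λ * 2 ^ I) := Nat.mul_le_mul_right _ (by norm_num)
          linarith
      _ ≤ 500 ^ 3 * (2 ^ I) ^ 2 * 2 ^ I := by gcongr
      _ = (500 * 2 ^ I) * ((500 * 2 ^ I) * (500 * 2 ^ I)) := by ring
      _ < (500 * 2 ^ I + 1) * ((500 * 2 ^ I + 1) * (500 * 2 ^ I + 1)) := by
          refine Nat.mul_lt_mul_of_lt_of_le (by omega) ?_ (by positivity)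
          gcongr <;> omega
  obtain ⟨⟨c1, c2, c3⟩, hc, hcS⟩ := hgood
  simp only [Finset.mem_product, Finset.mem_Icc] at hc hcS
  have hcS' : ∀ i < I, 1000 * Λ * (S.filter fun s => |s.1 - c1| ≤ 4000 * 2 ^ i ∧
      |s.2.1 - c2| ≤ 4000 * 2 ^ i ∧ |s.2.2 - c3| ≤ 4000 * 2 ^ i).card ≤ (2 ^ i) ^ 2 := by
    intro i hi
    exact (Nat.mul_le_mul_left _ (Nat.lt_succ_iff.1 (hcS i hi))).trans (Nat.mul_div_le _ _)
  set V : ℤ → ℤ → ℤ → ℝ := fun x y z => U (x + c1) (y + c2) (z + c3) with hV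
  set G : ℝ := (κ + 5) * triFac Λ with hG
  have hG1 : 1 ≤ G := by
    have := one_le_triFac Λ
    nlinarith
  have hEε : ∀ k, ε ≤ G ^ k * ε := fun k => le_mul_of_one_le_left hε (one_le_pow₀ hG1)
  have hbd : ∀ i < I, 2 * (2 : ℤ) ^ i ≤ 2 ^ I := by
    intro i hi
    calc 2 * (2 : ℤ) ^ i = 2 ^ (i + 1) := by ring
      _ ≤ 2 ^ I := pow_le_pow_right₀ (by norm_num) hi
  have hin : ∀ i < I, ∀ x y z : ℤ, |x| + |y| + |z| ≤ 4000 * 2 ^ i →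
      |x + c1| ≤ R ∧ |y + c2| ≤ R ∧ |z + c3| ≤ R := by
    intro i hi x y z hl
    have := hbd i hi
    have ax := abs_cases x
    have ay := abs_cases y
    have az := abs_cases z
    simp only [abs_le]
    omega
  have step : ∀ i ≤ I, ∀ x y z : ℤ, |x| + |y| + |z| ≤ 1000 * 2 ^ i →
      |V x y z| ≤ G ^ (28000 * 2 ^ i) * ε := by
    intro i
    induction i with
    | zero =>
      intro _ x y z hl
      by_contra hcon
      push Not at hcon
      have hl' : |x| + |y| + |z| ≤ 4000 * 2 ^ 0 := by omega
      obtain ⟨a1, a2, a3⟩ := hin 0 hI x y z hl'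
      have h1 := hS _ _ _ a1 a2 a3 ((hEε _).trans_lt hcon)
      have h2 := hcS' 0 hI
      have h3 : (S.filter fun s => |s.1 - c1| ≤ 4000 * 2 ^ 0 ∧
        |s.2.1 - c2| ≤ 4000 * 2 ^ 0 ∧ |s.2.2 - c3| ≤ 4000 * 2 ^ 0).card = 0 := by
        by_contra h0
        have := Nat.mul_le_mul (show 1000 ≤ 1000 * Λ by omega) (Nat.one_le_iff_ne_zero.2 h0)
        simp only [pow_zero, one_pow, mul_one] at h2 this
        omega
      rw [Finset.card_eq_zero] at h3
      refine absurd (Finset.mem_filter.2 ⟨h1, ?_⟩) (h3 ▸ Finset.notMem_empty _)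
      have ax := abs_nonneg x
      have ay := abs_nonneg y
      have az := abs_nonneg z
      simp only [add_sub_cancel_right]
      omega
    | succ i ih =>
      intro hi
      have ih := ih (by omega)
      have hb := hbd i (by omega)
      set q : ℕ := 2 ^ i with hq
      have hq1 : 1 ≤ q := Nat.one_le_two_pow
      have hqz : ((2 : ℤ) ^ i) = q := by rw [hq]; push_cast; rfl
      have sub : ∀ t : ℕ, t ≤ 1000 → ∀ x y z : ℤ, |x| + |y| + |z| ≤ 1000 * q + t * q →
          |V x y z| ≤ G ^ (28000 * q + 28 * q * t) * ε := by
        intro t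
        induction t with
        | zero =>
          intro _ x y z hl
          simpa using ih x y z (by rw [hqz]; simpa using hl)
        | succ t iht =>
          intro ht x y z hl
          have iht := iht (by omega)
          have htq : (t : ℤ) * q ≤ 999 * q := by
            refine mul_le_mul_of_nonneg_right ?_ (by positivity)
            omega
          have htq0 : 0 ≤ (t : ℤ) * q := by positivity
          have hin' : ∀ x y z : ℤ, |x| + |y| + |z| ≤ 2 * (1000 * q + t * q) →
              |x + c1| ≤ R ∧ |y + c2| ≤ R ∧ |z + c3| ≤ R := fun x y z hl =>
            hin i (by omega) x y z (by rw [hqz]; omega)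
          have hyp : OctHyp V κ (G ^ (28000 * q + 28 * q * t) * ε) (1000 * q + t * q)
              (S.filter fun s => |s.1 - c1| ≤ 4000 * 2 ^ i ∧
                |s.2.1 - c2| ≤ 4000 * 2 ^ i ∧ |s.2.2 - c3| ≤ 4000 * 2 ^ i).card := by
            refine ⟨iht, ?_, ?_⟩
            · intro x y z hl
              obtain ⟨a1, a2, a3⟩ := hin' x y z hl
              have := hrel _ _ _ a1 a2 a3
              rw [SchRel] at this ⊢
              refine le_trans (le_of_eq ?_) this
              simp only [hV, add_sub_right_comm, add_right_comm]
            · refine ⟨(S.filter fun s => |s.1 - c1| ≤ 4000 * 2 ^ i ∧ |s.2.1 - c2| ≤ 4000 * 2 ^ i ∧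
                |s.2.2 - c3| ≤ 4000 * 2 ^ i).image fun s => (s.1 - c1, s.2.1 - c2, s.2.2 - c3),
                Finset.card_image_le, ?_⟩
              intro x y z hl hbig
              obtain ⟨a1, a2, a3⟩ := hin' x y z hl
              refine Finset.mem_image.2 ⟨(x + c1, y + c2, z + c3), Finset.mem_filter.2
                ⟨hS _ _ _ a1 a2 a3 ((hEε _).trans_lt hbig), ?_⟩, by simp⟩
              have ax := abs_nonneg x
              have ay := abs_nonneg y
              have az := abs_nonneg z
              simp only [add_sub_cancel_right]
              omega
          have := hyp.grow hκ (hε.trans (hEε _)) q Λ hq1 (by omega) ?_ (hcS' i (by omega)) x y z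
            (by push_cast at hl; linarith)
          · refine this.trans (le_of_eq ?_)
            rw [← mul_assoc, ← pow_add]
            congr 2; ring
          · have h11 : (2 : ℤ) ^ Λ = 2048 * 2 ^ I := by rw [hΛ, pow_add]; ring
            omega
      intro x y z hl
      have := sub 1000 le_rfl x y z (by
        rw [pow_succ, hqz] at hl
        push_cast; linarith)
      refine this.trans (le_of_eq ?_)
      congr 2
      rw [pow_succ]; ring
  have fin := step I le_rfl (-c1) (-c2) (-c3) (by
    have a1 := abs_cases (-c1)
    have a2 := abs_cases (-c2)
    have a3 := abs_cases (-c3)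
    omega)
  simpa [hV] using fin

/-- The Schrödinger inequality on a cube centred at the origin. -/
def SchCube (U : ℤ → ℤ → ℤ → ℝ) (κ : ℝ) (R : ℤ) : Prop :=
  ∀ x y z, |x| ≤ R → |y| ≤ R → |z| ≤ R → SchRel U κ x y z

theorem SchCube.neg_fst {U : ℤ → ℤ → ℤ → ℝ} {κ : ℝ} {R : ℤ} (h : SchCube U κ R) :
    SchCube (fun x y z => U (-x) y z) κ R := by
  intro x y z hx hy hz
  have := h (-x) y z (by rwa [abs_neg]) hy hz
  rw [SchRel] at this ⊢
  rw [show -(x + 1) = -x - 1 by ring, show -(x - 1) = -x + 1 by ring]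
  refine le_trans (le_of_eq ?_) this
  congr 1; ring

theorem SchCube.swap₁₂ {U : ℤ → ℤ → ℤ → ℝ} {κ : ℝ} {R : ℤ} (h : SchCube U κ R) :
    SchCube (fun x y z => U y x z) κ R := by
  intro x y z hx hy hz
  have := h y x z hy hx hz
  rw [SchRel] at this ⊢
  refine le_trans (le_of_eq ?_) this
  congr 1; ring

theorem SchCube.swap₁₃ {U : ℤ → ℤ → ℤ → ℝ} {κ : ℝ} {R : ℤ} (h : SchCube U κ R) :
    SchCube (fun x y z => U z y x) κ R := by
  intro x y z hx hy hz
  have := h z y x hz hy hx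
  rw [SchRel] at this ⊢
  refine le_trans (le_of_eq ?_) this
  congr 1; ring

/-- The cone property: a chain of large values escapes to distance `r` inside a cone. -/
theorem exists_chain (U : ℤ → ℤ → ℤ → ℝ) (κ : ℝ) (hκ : 0 ≤ κ) (R : ℤ) (h : SchCube U κ R) (r : ℕ)
    (hr : (r : ℤ) ≤ R) :
    ∃ x y z : ℤ, r ≤ x ∧ x ≤ r + 1 ∧ |y| + |z| ≤ x ∧ |U 0 0 0| ≤ (κ + 5) ^ r * |U x y z| := by
  have hA : 1 ≤ κ + 5 := by linarith
  induction r with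
  | zero => exact ⟨0, 0, 0, by simp⟩
  | succ r ih =>
    obtain ⟨x, y, z, h1, h2, h3, h4⟩ := ih (by push_cast at hr; omega)
    push_cast at hr ⊢
    rcases h1.eq_or_lt with h1 | h1
    · by_contra hcon
      push Not at hcon
      have ay := abs_nonneg y
      have az := abs_nonneg z
      have r1 := h (x + 1) y z (by rw [abs_of_nonneg (by omega)]; omega) (by omega) (by omega)
      rw [SchRel, add_sub_cancel_right] at r1
      have ay1 := abs_add_le y 1
      have ay2 := abs_sub y 1
      have az1 := abs_add_le z 1
      have az2 := abs_sub z 1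
      rw [abs_one] at ay1 ay2 az1 az2
      have v0 := hcon (x + 1) y z (by omega) (by omega) (by omega)
      have v1 := hcon (x + 1 + 1) y z (by omega) (by omega) (by omega)
      have v2 := hcon (x + 1) (y + 1) z (by omega) (by omega) (by omega)
      have v3 := hcon (x + 1) (y - 1) z (by omega) (by omega) (by omega)
      have v4 := hcon (x + 1) y (z + 1) (by omega) (by omega) (by omega)
      have v5 := hcon (x + 1) y (z - 1) (by omega) (by omega) (by omega)
      have hP : 0 < (κ + 5) ^ r := by positivity
      rw [pow_succ, mul_assoc] at v0 v1 v2 v3 v4 v5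
      have w0 := lt_of_mul_lt_mul_left (v0.trans_le h4) hP.le
      have w1 := lt_of_mul_lt_mul_left (v1.trans_le h4) hP.le
      have w2 := lt_of_mul_lt_mul_left (v2.trans_le h4) hP.le
      have w3 := lt_of_mul_lt_mul_left (v3.trans_le h4) hP.le
      have w4 := lt_of_mul_lt_mul_left (v4.trans_le h4) hP.le
      have w5 := lt_of_mul_lt_mul_left (v5.trans_le h4) hP.le
      set t := |U x y z| with ht
      have hu : t ≤ κ * |U (x + 1) y z| + |U (x + 1 + 1) y z| + |U (x + 1) (y + 1) z|
          + |U (x + 1) (y - 1) z| + |U (x + 1) y (z + 1)| + |U (x + 1) y (z - 1)| := by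
        have e : U x y z = (U (x + 1 + 1) y z + U x y z + U (x + 1) (y + 1) z + U (x + 1) (y - 1) z
            + U (x + 1) y (z + 1) + U (x + 1) y (z - 1)) - U (x + 1 + 1) y z - U (x + 1) (y + 1) z
            - U (x + 1) (y - 1) z - U (x + 1) y (z + 1) - U (x + 1) y (z - 1) := by ring
        rw [ht, e]
        refine (abs_sub _ _).trans (add_le_add ?_ le_rfl)
        refine (abs_sub _ _).trans (add_le_add ?_ le_rfl)
        refine (abs_sub _ _).trans (add_le_add ?_ le_rfl)
        refine (abs_sub _ _).trans (add_le_add ?_ le_rfl)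
        exact (abs_sub _ _).trans (add_le_add r1 le_rfl)
      have hk := mul_le_mul_of_nonneg_left w0.le hκ
      have hmul : (κ + 5) * t ≤ (κ + 5) * (κ * |U (x + 1) y z| + |U (x + 1 + 1) y z|
          + |U (x + 1) (y + 1) z| + |U (x + 1) (y - 1) z| + |U (x + 1) y (z + 1)|
          + |U (x + 1) y (z - 1)|) := mul_le_mul_of_nonneg_left hu (by linarith)
      linarith
    · refine ⟨x, y, z, by omega, by omega, h3, h4.trans ?_⟩
      exact mul_le_mul_of_nonneg_right (pow_le_pow_right₀ hA (by omega)) (abs_nonneg _)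

/-- Two points are at sup-distance more than `D`. -/
def FarApart (D : ℤ) (p q : ℤ × ℤ × ℤ) : Prop :=
  ¬ (|p.1 - q.1| ≤ D ∧ |p.2.1 - q.2.1| ≤ D ∧ |p.2.2 - q.2.2| ≤ D)

/-- A point lies on a sphere of radius `r` or `r + 1` in the sup-norm. -/
def OnShell (r : ℤ) (p : ℤ × ℤ × ℤ) : Prop :=
  (|p.1| ≤ r + 1 ∧ |p.2.1| ≤ r + 1 ∧ |p.2.2| ≤ r + 1) ∧ (r ≤ |p.1| ∨ r ≤ |p.2.1| ∨ r ≤ |p.2.2|)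

/-- At every distance there are three well-separated large values. -/
theorem exists_three_far (U : ℤ → ℤ → ℤ → ℝ) (κ : ℝ) (hκ : 0 ≤ κ) (R : ℤ) (h : SchCube U κ R)
    (r : ℕ) (hr : (r : ℤ) ≤ R) (D : ℤ) (hDr : 2 * D + 2 ≤ r) :
    ∃ p : Fin 3 → ℤ × ℤ × ℤ, (∀ i, OnShell r (p i)) ∧ (∀ i j, i ≠ j → FarApart D (p i) (p j)) ∧
      ∀ i, |U 0 0 0| ≤ (κ + 5) ^ r * |U (p i).1 (p i).2.1 (p i).2.2| := by
  suffices H : ∃ p q s : ℤ × ℤ × ℤ, OnShell r p ∧ OnShell r q ∧ OnShell r s ∧ FarApart D p q ∧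
      FarApart D p s ∧ FarApart D q s ∧ |U 0 0 0| ≤ (κ + 5) ^ r * |U p.1 p.2.1 p.2.2| ∧
      |U 0 0 0| ≤ (κ + 5) ^ r * |U q.1 q.2.1 q.2.2| ∧
      |U 0 0 0| ≤ (κ + 5) ^ r * |U s.1 s.2.1 s.2.2| by
    obtain ⟨p, q, s, hp, hq, hs, hpq, hps, hqs, up, uq, us⟩ := H
    have symm : ∀ {a b}, FarApart D a b → FarApart D b a := fun hab hba =>
      hab ⟨by rw [abs_sub_comm]; exact hba.1, by rw [abs_sub_comm]; exact hba.2.1,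
        by rw [abs_sub_comm]; exact hba.2.2⟩
    refine ⟨![p, q, s], ?_, ?_, ?_⟩
    · intro i; fin_cases i <;> assumption
    · intro i j hij
      fin_cases i <;> fin_cases j <;> first | exact absurd rfl hij | assumption | (apply symm; assumption)
    · intro i; fin_cases i <;> assumption
  obtain ⟨x₁, y₁, z₁, a₁, b₁, c₁, d₁⟩ := exists_chain U κ hκ R h r hr
  obtain ⟨x₂, y₂, z₂, a₂, b₂, c₂, d₂⟩ := exists_chain _ κ hκ R h.neg_fst r hr
  obtain ⟨x₃, y₃, z₃, a₃, b₃, c₃, d₃⟩ := exists_chain _ κ hκ R h.swap₁₂ r hr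
  obtain ⟨x₄, y₄, z₄, a₄, b₄, c₄, d₄⟩ := exists_chain _ κ hκ R h.swap₁₂.neg_fst r hr
  obtain ⟨x₅, y₅, z₅, a₅, b₅, c₅, d₅⟩ := exists_chain _ κ hκ R h.swap₁₃ r hr
  simp only [neg_zero] at d₂ d₃ d₄ d₅
  have cone : ∀ {x y z : ℤ}, |y| + |z| ≤ x → y + z ≤ x ∧ y - z ≤ x ∧ z - y ≤ x ∧ -y - z ≤ x := by
    intro x y z h
    have := abs_cases y
    have := abs_cases z
    omega
  have shell : ∀ {x y z : ℤ}, r ≤ x → x ≤ r + 1 → y + z ≤ x ∧ y - z ≤ x ∧ z - y ≤ x ∧ -y - z ≤ x →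
      OnShell r (x, y, z) ∧ OnShell r (-x, y, z) ∧ OnShell r (y, x, z) ∧ OnShell r (y, -x, z) ∧
        OnShell r (z, y, x) := by
    intro x y z h1 h2 h3
    have hx : |x| = x := abs_of_nonneg (by omega)
    have hy : |y| ≤ r + 1 := abs_le.2 (by omega)
    have hz : |z| ≤ r + 1 := abs_le.2 (by omega)
    simp only [OnShell, abs_neg, hx, hy, hz, h1, h2]
    simp
  replace c₁ := cone c₁
  replace c₂ := cone c₂
  replace c₃ := cone c₃
  replace c₄ := cone c₄
  replace c₅ := cone c₅
  have o₁ := (shell a₁ b₁ c₁).1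
  have o₂ := (shell a₂ b₂ c₂).2.1
  have o₃ := (shell a₃ b₃ c₃).2.2.1
  have o₄ := (shell a₄ b₄ c₄).2.2.2.1
  have o₅ := (shell a₅ b₅ c₅).2.2.2.2
  have f₁₂ : FarApart D (x₁, y₁, z₁) (-x₂, y₂, z₂) := by
    simp only [FarApart, abs_le]
    omega
  rcases lt_or_ge (max y₁ y₂) (r - D) with hy | hy
  · rw [max_lt_iff] at hy
    refine ⟨_, _, _, o₁, o₂, o₃, f₁₂, ?_, ?_, d₁, d₂, d₃⟩ <;>
    · simp only [FarApart, abs_le]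
      omega
  rcases lt_or_ge (D - r) (min y₁ y₂) with hy' | hy'
  · rw [lt_min_iff] at hy'
    refine ⟨_, _, _, o₁, o₂, o₄, f₁₂, ?_, ?_, d₁, d₂, d₄⟩ <;>
    · simp only [FarApart, abs_le]
      omega
  · rw [le_max_iff] at hy
    rw [min_le_iff] at hy'
    refine ⟨_, _, _, o₁, o₂, o₅, f₁₂, ?_, ?_, d₁, d₂, d₅⟩ <;>
    · simp only [FarApart, abs_le]
      omega

/-- Every solution on the cube of radius `M` exceeding `G` at the origin has at least `F` values
exceeding `ε`. -/
def ManyLarge (κ ε : ℝ) (M : ℤ) (G F : ℝ) : Prop :=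
  ∀ (U : ℤ → ℤ → ℤ → ℝ) (S : Finset (ℤ × ℤ × ℤ)), SchCube U κ M →
    (∀ x y z, |x| ≤ M → |y| ≤ M → |z| ≤ M → ε < |U x y z| → (x, y, z) ∈ S) →
    G < |U 0 0 0| → F ≤ S.card

theorem ManyLarge.of_translate {κ ε G F : ℝ} {M R : ℤ} (h : ManyLarge κ ε M G F)
    (U : ℤ → ℤ → ℤ → ℝ) (S : Finset (ℤ × ℤ × ℤ)) (hU : SchCube U κ R)
    (hS : ∀ x y z, |x| ≤ R → |y| ≤ R → |z| ≤ R → ε < |U x y z| → (x, y, z) ∈ S)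
    (p : ℤ × ℤ × ℤ) (h1 : |p.1| + M ≤ R) (h2 : |p.2.1| + M ≤ R) (h3 : |p.2.2| + M ≤ R)
    (hG : G < |U p.1 p.2.1 p.2.2|) :
    F ≤ (S.filter fun q => |q.1 - p.1| ≤ M ∧ |q.2.1 - p.2.1| ≤ M ∧ |q.2.2 - p.2.2| ≤ M).card := by
  obtain ⟨a, b, c⟩ := p
  simp only at h1 h2 h3 hG
  have bd : ∀ {x a : ℤ}, |a| + M ≤ R → |x| ≤ M → |x + a| ≤ R := fun h h' => by
    refine (abs_add_le _ _).trans ?_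
    omega
  refine (h (fun x y z => U (x + a) (y + b) (z + c))
    ((S.filter fun q => |q.1 - a| ≤ M ∧ |q.2.1 - b| ≤ M ∧ |q.2.2 - c| ≤ M).image
      fun q => (q.1 - a, q.2.1 - b, q.2.2 - c)) ?_ ?_ ?_).trans
      (by exact_mod_cast Finset.card_image_le)
  · intro x y z hx hy hz
    have := hU (x + a) (y + b) (z + c) (bd h1 hx) (bd h2 hy) (bd h3 hz)
    simp only [SchRel] at this ⊢
    rw [add_right_comm x 1, add_right_comm y 1, add_right_comm z 1, sub_add_eq_add_sub,
      sub_add_eq_add_sub, sub_add_eq_add_sub]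
    exact this
  · intro x y z hx hy hz hε
    rw [Finset.mem_image]
    refine ⟨(x + a, y + b, z + c), ?_, by simp⟩
    rw [Finset.mem_filter]
    refine ⟨hS _ _ _ (bd h1 hx) (bd h2 hy) (bd h3 hz) hε, ?_⟩
    simpa using ⟨hx, hy, hz⟩
  · simpa using hG

theorem OnShell.farApart {r s D : ℤ} {p q : ℤ × ℤ × ℤ} (hp : OnShell r p) (hq : OnShell s q)
    (h : r + D + 2 ≤ s) : FarApart D p q := by
  rintro ⟨h1, h2, h3⟩
  obtain ⟨⟨a1, a2, a3⟩, -⟩ := hp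
  have t : ∀ {x y : ℤ}, |x - y| ≤ D → |x| ≤ r + 1 → ¬ s ≤ |y| := by
    intro x y h1 h2 h3
    have := abs_cases (x - y)
    have := abs_cases x
    have := abs_cases y
    omega
  rcases hq.2 with b | b | b
  · exact t h1 a1 b
  · exact t h2 a2 b
  · exact t h3 a3 b

theorem FarApart.symm {D : ℤ} {p q : ℤ × ℤ × ℤ} (h : FarApart D p q) : FarApart D q p := by
  simp only [FarApart] at h ⊢
  rwa [abs_sub_comm, abs_sub_comm q.2.1, abs_sub_comm q.2.2]

/-- A cube contains 27 disjoint cubes, of 24 times smaller size, with a large central value. -/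
theorem ManyLarge.step {κ ε G F : ℝ} (hκ : 0 ≤ κ) {M : ℕ} (hM : 23 ≤ M)
    (h : ManyLarge κ ε M G F) :
    ManyLarge κ ε ((24 * M : ℕ) : ℤ) ((κ + 5) ^ (24 * M) * G) (27 * F) := by
  intro U S hU hS hc
  have hA : 1 ≤ κ + 5 := by linarith
  have ex := fun j : Fin 9 => exists_three_far U κ hκ _ hU ((2 * M + 2) * (j + 3))
    (by have := j.2; push_cast; nlinarith) (2 * M) (by push_cast; nlinarith)
  choose p hp hfar hbig using ex
  have hnear : ∀ {j i}, |(p j i).1| + M ≤ (24 * M : ℕ) ∧ |(p j i).2.1| + M ≤ (24 * M : ℕ) ∧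
      |(p j i).2.2| + M ≤ (24 * M : ℕ) := by
    intro j i
    have h1 := (hp j i).1
    have h2 : (((2 * M + 2) * (j + 3) : ℕ) : ℤ) ≤ (2 * M + 2) * 11 := by
      have : (j : ℕ) + 3 ≤ 11 := by have := j.2; omega
      exact_mod_cast Nat.mul_le_mul_left _ this
    push_cast at h1 h2 ⊢
    omega
  have hlarge : ∀ j i, G < |U (p j i).1 (p j i).2.1 (p j i).2.2| := by
    intro j i
    have h1 := hc.trans_le (hbig j i)
    have h2 : (2 * M + 2) * ((j : ℕ) + 3) ≤ 24 * M := by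
      have := j.2
      nlinarith
    have h3 := mul_le_mul_of_nonneg_right (pow_le_pow_right₀ hA h2)
      (abs_nonneg (U (p j i).1 (p j i).2.1 (p j i).2.2))
    exact lt_of_mul_lt_mul_left (h1.trans_le h3) (by positivity)
  set T : Fin 9 × Fin 3 → Finset (ℤ × ℤ × ℤ) := fun x => S.filter fun q =>
    |q.1 - (p x.1 x.2).1| ≤ M ∧ |q.2.1 - (p x.1 x.2).2.1| ≤ M ∧ |q.2.2 - (p x.1 x.2).2.2| ≤ M
    with hT
  have hTF : ∀ x, F ≤ (T x).card := fun x =>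
    h.of_translate U S hU hS (p x.1 x.2) hnear.1 hnear.2.1 hnear.2.2 (hlarge _ _)
  have hsep : ∀ x y : Fin 9 × Fin 3, x ≠ y → FarApart (2 * M) (p x.1 x.2) (p y.1 y.2) := by
    rintro ⟨j, i⟩ ⟨j', i'⟩ hne
    have level : ∀ {a b : Fin 9}, a < b →
        (((2 * M + 2) * (a + 3) : ℕ) : ℤ) + 2 * M + 2 ≤ ((2 * M + 2) * (b + 3) : ℕ) := by
      intro a b hab
      have : (a : ℕ) + 3 + 1 ≤ b + 3 := by have := Fin.lt_def.1 hab; omega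
      have := Nat.mul_le_mul_left (2 * M + 2) this
      zify at this
      push_cast
      linarith
    rcases lt_trichotomy j j' with hj | rfl | hj
    · exact (hp j i).farApart (hp j' i') (level hj)
    · exact hfar j i i' fun e => hne (by rw [e])
    · exact ((hp j' i').farApart (hp j i) (level hj)).symm
  have hdisj : ∀ x ∈ Finset.univ, ∀ y ∈ Finset.univ, x ≠ y → Disjoint (T x) (T y) := by
    intro x _ y _ hxy
    rw [Finset.disjoint_left]
    intro q hqx hqy
    rw [hT, Finset.mem_filter] at hqx hqy
    have t : ∀ {a b c : ℤ}, |c - a| ≤ M → |c - b| ≤ M → |a - b| ≤ 2 * M := by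
      intro a b c h1 h2
      rw [abs_le] at *
      omega
    exact hsep x y hxy ⟨t hqx.2.1 hqy.2.1, t hqx.2.2.1 hqy.2.2.1, t hqx.2.2.2 hqy.2.2.2⟩
  have hsub : Finset.univ.biUnion T ⊆ S :=
    Finset.biUnion_subset.2 fun x _ => Finset.filter_subset _ _
  have hle := Finset.card_le_card hsub
  rw [Finset.card_biUnion hdisj] at hle
  calc 27 * F = ∑ _x : Fin 9 × Fin 3, F := by
        simp only [Finset.sum_const, Finset.card_univ, Fintype.card_prod, Fintype.card_fin,
          nsmul_eq_mul]
        norm_num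
    _ ≤ ∑ x, ((T x).card : ℝ) := Finset.sum_le_sum fun x _ => hTF x
    _ ≤ S.card := by exact_mod_cast hle

theorem ManyLarge.iterate {κ ε G F : ℝ} (hκ : 0 ≤ κ) (hG : 0 ≤ G) {m : ℕ} (hm : 23 ≤ m)
    (h : ManyLarge κ ε m G F) (k : ℕ) :
    ManyLarge κ ε ((24 ^ k * m : ℕ) : ℤ) ((κ + 5) ^ (2 * (24 ^ k * m)) * G) (27 ^ k * F) := by
  have hA : 1 ≤ κ + 5 := by linarith
  induction k with
  | zero =>
    intro U S hU hS hc
    rw [pow_zero, one_mul] at *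
    refine h U S hU hS (lt_of_le_of_lt ?_ hc)
    exact le_mul_of_one_le_left hG (one_le_pow₀ hA)
  | succ k ih =>
    intro U S hU hS hc
    have hk : 1 ≤ 24 ^ k := Nat.one_le_pow _ _ (by norm_num)
    have e : 24 ^ (k + 1) * m = 24 * (24 ^ k * m) := by ring
    rw [e] at hU hS hc
    have := ih.step hκ (by nlinarith) U S hU hS (lt_of_le_of_lt ?_ hc)
    · rwa [pow_succ' (27 : ℝ), mul_assoc]
    · rw [← mul_assoc, ← pow_add]
      exact mul_le_mul_of_nonneg_right (pow_le_pow_right₀ hA (by omega)) hG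

theorem manyLarge_base {κ ε : ℝ} (hκ : 0 ≤ κ) (hε : 0 ≤ ε) {I : ℕ} (hI : 1 ≤ I) :
    ManyLarge κ ε ((2250 * 2 ^ I : ℕ) : ℤ)
      (((κ + 5) * triFac (I + 11)) ^ (28000 * 2 ^ I) * ε)
      (((2 : ℝ) ^ I) ^ 2 / (5000000 * (I + 11))) := by
  intro U S hU hS hc
  by_contra hF
  push Not at hF
  refine absurd hc (not_lt.2 (small_center U κ ε hκ hε I hI _ (by push_cast; rfl) hU S hS ?_))
  rw [lt_div_iff₀ (by positivity)] at hF
  have : ((5000000 * (I + 11) * S.card : ℕ) : ℝ) ≤ ((2 ^ I) ^ 2 : ℕ) := by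
    push_cast
    linarith
  exact_mod_cast this

theorem triFac_le_exp (t : ℕ) :
    triFac (9 * t + 11) ≤ Real.exp (2048 * 540 * 512 ^ t * (t + 1) ^ 2) := by
  have h1 : (12 * (2 ^ (9 * t + 11) : ℕ) : ℝ) ≤ Real.exp (9 * t + 15) := by
    have h2 : (2 : ℝ) ≤ Real.exp 1 := by
      have := Real.add_one_le_exp (1 : ℝ)
      linarith
    calc (12 * (2 ^ (9 * t + 11) : ℕ) : ℝ) ≤ 2 ^ (9 * t + 15) := by
          push_cast
          rw [show 9 * t + 15 = 9 * t + 11 + 4 by ring, pow_add (2 : ℝ) (9 * t + 11) 4]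
          linarith [show (0 : ℝ) < 2 ^ (9 * t + 11) by positivity]
      _ ≤ Real.exp 1 ^ (9 * t + 15) := pow_le_pow_left₀ (by norm_num) h2 _
      _ = Real.exp (9 * t + 15) := by
          rw [← Real.exp_nat_mul]
          push_cast
          ring_nf
  rw [triFac, ← pow_mul]
  refine (pow_le_pow_left₀ (by positivity) h1 _).trans ?_
  rw [← Real.exp_nat_mul, Real.exp_le_exp]
  push_cast
  have h3 : (2 : ℝ) ^ (9 * t + 11) = 2048 * 512 ^ t := by
    rw [pow_add, pow_mul]
    norm_num
    ring
  rw [h3]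
  have h4 : (3 * (9 * t + 11) + 3) * (9 * t + 15) ≤ 540 * ((t : ℝ) + 1) ^ 2 := by
    nlinarith [show (0 : ℝ) ≤ t by positivity]
  have h5 : (0 : ℝ) ≤ 2048 * 512 ^ t := by positivity
  nlinarith [mul_le_mul_of_nonneg_left h4 h5]

/-- Polynomial factors are absorbed by exponentials. -/
theorem exists_poly_mul_pow_le (j : ℕ) {r : ℝ} (h0 : 0 ≤ r) (h1 : r < 1) :
    ∃ B : ℝ, 0 < B ∧ ∀ t : ℕ, ((t : ℝ) + 1) ^ j * r ^ t ≤ B := by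
  rcases h0.eq_or_lt with rfl | h0
  · refine ⟨1, one_pos, fun t => ?_⟩
    rcases t with _ | t
    · simp
    · simp
  have h := (tendsto_pow_const_mul_const_pow_of_abs_lt_one j (r := r)
    (by rwa [abs_of_pos h0])).bddAbove_range
  obtain ⟨B, hB⟩ := h
  refine ⟨max 1 (B / r), by positivity, fun t => le_max_of_le_right ?_⟩
  rw [le_div_iff₀ h0]
  have := hB ⟨t + 1, rfl⟩
  push_cast at this
  rw [pow_succ] at this
  linarith

theorem exists_exp_bound {A : ℝ} (hA : 1 ≤ A) :
    ∃ C : ℝ, 0 < C ∧ ∀ t n : ℕ, 2250 * 294912 ^ t ≤ n →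
      A ^ (2 * n) * (A * triFac (9 * t + 11)) ^ (28000 * 2 ^ (9 * t)) ≤ Real.exp (C * n) := by
  obtain ⟨B, hB, hB'⟩ := exists_poly_mul_pow_le 2 (r := 8 / 9) (by norm_num) (by norm_num)
  refine ⟨2 * A + 28000 * (A + 2048 * 540) * B, by positivity, fun t n hn => ?_⟩
  have hAe : A ≤ Real.exp A := by
    have := Real.add_one_le_exp A
    linarith
  have hpow : (2 : ℝ) ^ (9 * t) = 512 ^ t := by
    rw [pow_mul]
    norm_num
  have h1 : A * triFac (9 * t + 11) ≤
      Real.exp ((A + 2048 * 540) * 512 ^ t * (t + 1) ^ 2) := by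
    have h2 : A ≤ Real.exp (A * 512 ^ t * (t + 1) ^ 2) := by
      refine hAe.trans (Real.exp_le_exp.2 ?_)
      rw [mul_assoc]
      refine le_mul_of_one_le_right (by linarith) ?_
      refine one_le_mul_of_one_le_of_one_le (one_le_pow₀ (by norm_num)) (one_le_pow₀ ?_)
      have : (0 : ℝ) ≤ t := by positivity
      linarith
    refine (mul_le_mul h2 (triFac_le_exp t) (zero_le_one.trans (one_le_triFac _))
      (Real.exp_nonneg _)).trans ?_
    rw [← Real.exp_add]
    exact Real.exp_le_exp.2 (le_of_eq (by ring))
  have h3 : (512 : ℝ) ^ t * 512 ^ t * (t + 1) ^ 2 ≤ B * n := by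
    have h4 : (512 : ℝ) ^ t * 512 ^ t = 294912 ^ t * (8 / 9) ^ t := by
      rw [← mul_pow, ← mul_pow]
      norm_num
    have h5 : (294912 : ℝ) ^ t ≤ n := by
      have : 294912 ^ t ≤ n := by omega
      exact_mod_cast this
    calc (512 : ℝ) ^ t * 512 ^ t * (t + 1) ^ 2 = 294912 ^ t * ((t + 1) ^ 2 * (8 / 9) ^ t) := by
          rw [h4]; ring
      _ ≤ n * B := mul_le_mul h5 (hB' t) (by positivity) (by positivity)
      _ = B * n := mul_comm _ _
  have ht := one_le_triFac (9 * t + 11)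
  calc A ^ (2 * n) * (A * triFac (9 * t + 11)) ^ (28000 * 2 ^ (9 * t))
      ≤ Real.exp A ^ (2 * n) *
        Real.exp ((A + 2048 * 540) * 512 ^ t * (t + 1) ^ 2) ^ (28000 * 2 ^ (9 * t)) := by
        gcongr
    _ = Real.exp (2 * A * n + 28000 * (A + 2048 * 540) * (512 ^ t * 512 ^ t * (t + 1) ^ 2)) := by
        rw [← Real.exp_nat_mul, ← Real.exp_nat_mul, ← Real.exp_add]
        push_cast
        rw [hpow]
        ring_nf
    _ ≤ Real.exp ((2 * A + 28000 * (A + 2048 * 540) * B) * n) := by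
        rw [Real.exp_le_exp]
        have := mul_le_mul_of_nonneg_left h3 (show 0 ≤ 28000 * (A + 2048 * 540) by positivity)
        linarith

theorem exponent_bound : (294912 : ℝ) ^ (301 / 200 : ℝ) ≤ 171500000 := by
  have h1 : (294912 : ℝ) ^ (1 / 2 : ℝ) ≤ 543.1 := by
    refine (Real.rpow_le_rpow (by norm_num) (show (294912 : ℝ) ≤ 543.1 ^ (2 : ℝ) by norm_num)
      (by norm_num)).trans ?_
    rw [← Real.rpow_mul (by norm_num)]
    norm_num
  have h2 : (294912 : ℝ) ^ (1 / 200 : ℝ) ≤ 1.07 := by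
    refine (Real.rpow_le_rpow (by norm_num)
      (show (294912 : ℝ) ≤ 1.07 ^ ((200 : ℕ) : ℝ) by rw [Real.rpow_natCast]; norm_num)
      (by norm_num)).trans ?_
    rw [← Real.rpow_mul (by norm_num)]
    norm_num
  rw [show (301 / 200 : ℝ) = 1 + 1 / 2 + 1 / 200 by norm_num, Real.rpow_add (by norm_num),
    Real.rpow_add (by norm_num), Real.rpow_one]
  calc (294912 : ℝ) * 294912 ^ (1 / 2 : ℝ) * 294912 ^ (1 / 200 : ℝ)
      ≤ 294912 * 543.1 * 1.07 := by gcongr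
    _ ≤ 171500000 := by norm_num

theorem exists_count_bound : ∃ t₀ : ℕ, ∀ t n : ℕ, t₀ ≤ t → n ≤ 2250 * 294912 ^ (t + 1) →
    (n : ℝ) ^ (301 / 200 : ℝ) ≤
      27 ^ (2 * t) * (((2 : ℝ) ^ (9 * t)) ^ 2 / (5000000 * ((9 * t : ℕ) + 11))) := by
  have hlim := tendsto_pow_const_mul_const_pow_of_abs_lt_one 1 (r := (171500000 / 191102976 : ℝ))
    (by rw [abs_of_pos (by norm_num)]; norm_num)
  set c : ℝ := 2250 ^ (301 / 200 : ℝ) * 171500000 * (5000000 * 20) with hc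
  have hcpos : 0 < c := by positivity
  have hev := hlim.eventually (gt_mem_nhds (show (0 : ℝ) < 1 / c by positivity))
  obtain ⟨t₀, ht₀⟩ := Filter.eventually_atTop.1 hev
  refine ⟨t₀ + 1, fun t n ht hn => ?_⟩
  have h1 := ht₀ t (by omega)
  rw [pow_one, lt_div_iff₀ hcpos, div_pow] at h1
  have ht1 : (1 : ℝ) ≤ t := by
    have : 1 ≤ t := by omega
    exact_mod_cast this
  have hn' : (n : ℝ) ^ (301 / 200 : ℝ) ≤ 2250 ^ (301 / 200 : ℝ) * 171500000 ^ (t + 1) := by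
    have h2 : (n : ℝ) ≤ 2250 * 294912 ^ (t + 1) := by exact_mod_cast hn
    refine (Real.rpow_le_rpow (by positivity) h2 (by norm_num)).trans ?_
    rw [Real.mul_rpow (by norm_num) (by positivity)]
    refine mul_le_mul_of_nonneg_left ?_ (by positivity)
    rw [← Real.rpow_natCast, ← Real.rpow_mul (by norm_num), mul_comm, Real.rpow_mul (by norm_num),
      Real.rpow_natCast]
    exact pow_le_pow_left₀ (by positivity) exponent_bound _
  have hz : (27 : ℝ) ^ (2 * t) * ((2 : ℝ) ^ (9 * t)) ^ 2 = 191102976 ^ t := by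
    rw [← pow_mul, mul_right_comm 9 t 2, pow_mul, pow_mul, ← mul_pow]
    norm_num
  refine hn'.trans ?_
  rw [← mul_div_assoc, hz, le_div_iff₀ (by positivity)]
  have hzp : (0 : ℝ) < 191102976 ^ t := by positivity
  rw [mul_div_assoc', div_mul_eq_mul_div, div_lt_one hzp] at h1
  refine le_trans ?_ h1.le
  rw [hc, pow_succ]
  push_cast
  have h6 : (9 * (t : ℝ) + 11) ≤ 20 * t := by linarith
  have h7 : (0 : ℝ) ≤ 2250 ^ (301 / 200 : ℝ) * 171500000 ^ t * 171500000 * 5000000 := by positivity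
  have := mul_le_mul_of_nonneg_left h6 h7
  linarith

theorem finite_cube (n : ℕ) : (cube 0 (n : ℝ)).Finite := by
  refine (Set.finite_Icc (fun _ => -(n : ℤ)) (fun _ => (n : ℤ))).subset fun b hb => ?_
  have h : ∀ i, |b i| ≤ n := fun i => by
    have := hb i
    rw [Pi.zero_apply, sub_zero] at this
    exact_mod_cast this
  exact ⟨fun i => (abs_le.1 (h i)).1, fun i => (abs_le.1 (h i)).2⟩

theorem vec_mem_cube {n : ℕ} {x y z : ℤ} (hx : |x| ≤ n) (hy : |y| ≤ n) (hz : |z| ≤ n) :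
    ![x, y, z] ∈ cube 0 (n : ℝ) := by
  intro i
  rw [Pi.zero_apply, sub_zero]
  fin_cases i
  · exact_mod_cast hx
  · exact_mod_cast hy
  · exact_mod_cast hz

theorem sq_le_ncard_cube (n : ℕ) : n ^ 2 ≤ (cube 0 (n : ℝ)).ncard := by
  have hinj : Function.Injective fun q : ℕ × ℕ => (![(q.1 : ℤ), (q.2 : ℤ), 0] : Fin 3 → ℤ) := by
    intro q r h
    have h0 := congrFun h 0
    have h1 := congrFun h 1
    simp only [Matrix.cons_val_zero, Matrix.cons_val_one, Nat.cast_inj] at h0 h1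
    exact Prod.ext h0 h1
  have hsub : (((Finset.range n ×ˢ Finset.range n).image
      fun q : ℕ × ℕ => (![(q.1 : ℤ), (q.2 : ℤ), 0] : Fin 3 → ℤ) : Finset (Fin 3 → ℤ)) :
      Set (Fin 3 → ℤ)) ⊆ cube 0 (n : ℝ) := by
    intro a ha
    simp only [Finset.coe_image, Set.mem_image, Finset.mem_coe, Finset.mem_product,
      Finset.mem_range] at ha
    obtain ⟨⟨i, j⟩, ⟨hi, hj⟩, rfl⟩ := ha
    simp only at hi hj
    exact vec_mem_cube (by rw [Nat.abs_cast]; omega) (by rw [Nat.abs_cast]; omega) (by simp)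
  have h := Set.ncard_le_ncard hsub (finite_cube n)
  rw [Set.ncard_coe_finset, Finset.card_image_of_injective _ hinj, Finset.card_product,
    Finset.card_range] at h
  rwa [sq]

theorem schCube_of_discLap {K : ℝ} {n : ℕ} {u V : (Fin 3 → ℤ) → ℝ}
    (hu : ∀ a ∈ cube 0 (n : ℝ), discLap u a = V a * u a) (hV : ∀ a, |V a| ≤ K) :
    SchCube (fun x y z => u ![x, y, z]) (K + 6) n := by
  intro x y z hx hy hz
  have h := hu _ (vec_mem_cube hx hy hz)
  have e0 : ![x, y, z] + stdv 0 = ![x + 1, y, z] := by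
    ext i; fin_cases i <;> simp [stdv]
  have e1 : ![x, y, z] + stdv 1 = ![x, y + 1, z] := by
    ext i; fin_cases i <;> simp [stdv]
  have e2 : ![x, y, z] + stdv 2 = ![x, y, z + 1] := by
    ext i; fin_cases i <;> simp [stdv]
  have d0 : ![x, y, z] - stdv 0 = ![x - 1, y, z] := by
    ext i; fin_cases i <;> simp [stdv]
  have d1 : ![x, y, z] - stdv 1 = ![x, y - 1, z] := by
    ext i; fin_cases i <;> simp [stdv]
  have d2 : ![x, y, z] - stdv 2 = ![x, y, z - 1] := by
    ext i; fin_cases i <;> simp [stdv]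
  rw [discLap, Fin.sum_univ_three, e0, e1, e2, d0, d1, d2] at h
  have hs : u ![x + 1, y, z] + u ![x - 1, y, z] + u ![x, y + 1, z] + u ![x, y - 1, z]
      + u ![x, y, z + 1] + u ![x, y, z - 1] = (V ![x, y, z] + 6) * u ![x, y, z] := by
    linarith
  simp only [SchRel]
  rw [hs, abs_mul]
  refine mul_le_mul_of_nonneg_right ((abs_add_le _ _).trans ?_) (abs_nonneg _)
  rw [abs_of_pos (show (0 : ℝ) < 6 by norm_num)]
  exact add_le_add (hV _) le_rfl

/-- 3D discrete unique continuation principle: for eigenfunctions of `Δ - V` in `Q_n`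
with bounded potential, the set of points where `|u| ≥ exp(-C₁ n) |u(0)|`
has cardinality at least `n^p` with `p > 3/2`. -/
theorem discrete_unique_continuation :
    ∃ p : ℝ, 3 / 2 < p ∧
      ∀ K : ℝ, 0 < K → ∃ C₁ : ℝ, 0 < C₁ ∧ ∃ n₀ : ℕ,
        ∀ n : ℕ, n₀ ≤ n →
          ∀ u V : (Fin 3 → ℤ) → ℝ,
            (∀ a ∈ cube 0 (n : ℝ), discLap u a = V a * u a) →
            (∀ a, |V a| ≤ K) →
            (n : ℝ) ^ p ≤
              (({a | a ∈ cube 0 (n : ℝ) ∧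
                Real.exp (-C₁ * n) * |u 0| ≤ |u a|}).ncard : ℝ) := by
  obtain ⟨t₀, hcount⟩ := exists_count_bound
  refine ⟨301 / 200, by norm_num, fun K hK => ?_⟩
  obtain ⟨C, hC, hloss⟩ := exists_exp_bound (A := K + 6 + 5) (by linarith)
  refine ⟨C + 1, by positivity, 2250 * 294912 ^ (t₀ + 1), fun n hn u V hu hV => ?_⟩
  have hn1 : 1 ≤ n := by
    have : 1 ≤ 294912 ^ (t₀ + 1) := Nat.one_le_pow _ _ (by norm_num)
    omega
  have hfin : {a | a ∈ cube 0 (n : ℝ) ∧ Real.exp (-(C + 1) * n) * |u 0| ≤ |u a|}.Finite :=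
    (finite_cube n).subset fun a ha => ha.1
  rcases eq_or_ne (u 0) 0 with h0 | h0
  · have hset : {a | a ∈ cube 0 (n : ℝ) ∧ Real.exp (-(C + 1) * n) * |u 0| ≤ |u a|}
        = cube 0 (n : ℝ) := by
      ext a
      simp [h0]
    rw [hset]
    have h1 : (n : ℝ) ^ (301 / 200 : ℝ) ≤ (n : ℝ) ^ (2 : ℝ) :=
      Real.rpow_le_rpow_of_exponent_le (by exact_mod_cast hn1) (by norm_num)
    rw [Real.rpow_two] at h1
    exact h1.trans (by exact_mod_cast sq_le_ncard_cube n)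
  have hq : n / 2250 ≠ 0 := by
    have : 1 ≤ 294912 ^ (t₀ + 1) := Nat.one_le_pow _ _ (by norm_num)
    omega
  set t := Nat.log 294912 (n / 2250) with ht
  have ht1 : 294912 ^ t ≤ n / 2250 := Nat.pow_log_le_self _ hq
  have ht2 : n / 2250 < 294912 ^ (t + 1) := Nat.lt_pow_succ_log_self (by norm_num) _
  have ht0 : t₀ + 1 ≤ t := Nat.le_log_of_pow_le (by norm_num) (by omega)
  have hM : 24 ^ (2 * t) * (2250 * 2 ^ (9 * t)) ≤ n := by
    have : 24 ^ (2 * t) * (2250 * 2 ^ (9 * t)) = 2250 * 294912 ^ t := by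
      rw [mul_left_comm, pow_mul, pow_mul, ← mul_pow]
      norm_num
    omega
  refine (hcount t n (by omega) (by omega)).trans ?_
  set ε := Real.exp (-(C + 1) * n) * |u 0| with hε
  have hupos : 0 < |u 0| := abs_pos.2 h0
  have hε0 : 0 ≤ ε := by positivity
  have htri := one_le_triFac (9 * t + 11)
  have hbase := manyLarge_base (κ := K + 6) (by linarith) hε0 (I := 9 * t) (by omega)
  have hmany := hbase.iterate (by linarith) (by positivity)
    (by have := Nat.one_le_pow (9 * t) 2 (by norm_num); omega) (2 * t)
  have hU := schCube_of_discLap hu hV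
  set S := hfin.toFinset.image fun a => (a 0, a 1, a 2) with hS
  have hle : ∀ {x : ℤ}, |x| ≤ (24 ^ (2 * t) * (2250 * 2 ^ (9 * t)) : ℕ) → |x| ≤ n :=
    fun h => h.trans (by exact_mod_cast hM)
  have hfinal := hmany (fun x y z => u ![x, y, z]) S
    (fun x y z hx hy hz => hU x y z (hle hx) (hle hy) (hle hz)) ?_ ?_
  · refine hfinal.trans ?_
    rw [Set.ncard_eq_toFinset_card _ hfin]
    exact_mod_cast Finset.card_image_le
  · intro x y z hx hy hz hbig
    refine Finset.mem_image.2 ⟨![x, y, z], ?_, by simp⟩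
    rw [Set.Finite.mem_toFinset]
    exact ⟨vec_mem_cube (hle hx) (hle hy) (hle hz), hbig.le⟩
  · have hz : (![0, 0, 0] : Fin 3 → ℤ) = 0 := by
      ext i; fin_cases i <;> rfl
    simp only [hz]
    have h1 := hloss t n (by omega)
    have h2 : (K + 6 + 5) ^ (2 * (24 ^ (2 * t) * (2250 * 2 ^ (9 * t)))) ≤ (K + 6 + 5) ^ (2 * n) :=
      pow_le_pow_right₀ (by linarith) (by omega)
    have hn0 : (1 : ℝ) ≤ n := by exact_mod_cast hn1
    calc (K + 6 + 5) ^ (2 * (24 ^ (2 * t) * (2250 * 2 ^ (9 * t)))) *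
          (((K + 6 + 5) * triFac (9 * t + 11)) ^ (28000 * 2 ^ (9 * t)) * ε)
        ≤ (K + 6 + 5) ^ (2 * n) *
          (((K + 6 + 5) * triFac (9 * t + 11)) ^ (28000 * 2 ^ (9 * t)) * ε) :=
          mul_le_mul_of_nonneg_right h2 (by positivity)
      _ = (K + 6 + 5) ^ (2 * n) *
          ((K + 6 + 5) * triFac (9 * t + 11)) ^ (28000 * 2 ^ (9 * t)) * ε := by ring
      _ ≤ Real.exp (C * n) * ε := mul_le_mul_of_nonneg_right h1 hε0
      _ = Real.exp (-n) * |u 0| := by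
          rw [hε, ← mul_assoc, ← Real.exp_add]
          ring_nf
      _ < |u 0| := mul_lt_of_lt_one_left hupos (by
          rw [← Real.exp_zero, Real.exp_lt_exp]
          linarith)
end

section
/- There is a universal constant C₃ > 0 and, for each K > 0, a constant C₂ > 0 depending only on K, such that for every integer n ≥ 2 and all functions u, V : ℤ³ → ℝ satisfying Δu(a) = V(a)·u(a) for all a ∈ Q_n and ‖V‖_∞ ≤ K, the number of points a ∈ Q_n with |u(a)| ≥ exp(-C₂·n³)·|u(0)| is at least C₃·n²·(log₂ n)^{-1}. -/
/-- The sequence `x ↦ (-1) ^ x * r x` on `[0, N)` has no weakly alternating subsequence of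
length `j + 1` (for one choice of the initial sign), with tolerance `θ`. -/
def NoAlt (j N : ℕ) (θ : ℝ) (r : ℕ → ℝ) : Prop :=
  ∃ σ : ℝ, (σ = 1 ∨ σ = -1) ∧ ∀ x : ℕ → ℕ, (∀ i < j, x i < x (i + 1)) → (∀ i ≤ j, x i < N) →
    ∃ i ≤ j, θ < σ * (-1) ^ i * ((-1) ^ x i * r (x i))

/-- If the increment of `h` over `[a, b]` is at most a nonnegative number, then so is some unit
increment. -/
lemma exists_increment_le {h : ℕ → ℝ} {a b : ℕ} (hab : a < b) {c : ℝ} (hc : 0 ≤ c)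
    (hle : h b - h a ≤ c) : ∃ y, a ≤ y ∧ y < b ∧ h (y + 1) - h y ≤ c := by
  by_contra! hcon
  have key : ∀ d, 1 ≤ d → a + d ≤ b → c < h (a + d) - h a := by
    intro d hd
    induction d, hd using Nat.le_induction with
    | base => intro hb; exact hcon a le_rfl (by omega)
    | succ d hd ih =>
      intro hb
      have h1 := ih (by omega)
      have h2 := hcon (a + d) (by omega) (by omega)
      rw [← add_assoc]
      linarith
  have := key (b - a) (by omega) (by omega)
  rw [show a + (b - a) = b by omega] at this
  linarith

/-- Discrete Rolle theorem: the absence of alternations passes to a discrete antiderivative, at the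
cost of one more sign change. -/
lemma NoAlt.step {j N : ℕ} {θ η : ℝ} {r r' : ℕ → ℝ} (hθ : 0 ≤ θ)
    (h : NoAlt j N (2 * θ + η) r)
    (hr : ∀ x < N, |r' x + r' (x + 1) + r x| ≤ η) : NoAlt (j + 1) (N + 1) θ r' := by
  obtain ⟨σ, hσ, h⟩ := h
  refine ⟨-σ, by rcases hσ with h | h <;> simp [h], fun x hx hxN => ?_⟩
  by_contra! hcon
  set g : ℕ → ℝ := fun x => (-1) ^ x * r' x with hg
  have hstep : ∀ x < N, ∀ τ : ℝ, (τ = 1 ∨ τ = -1) →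
      τ * ((-1) ^ x * r x) ≤ τ * (g (x + 1) - g x) + η := by
    intro x hx τ hτ
    have h1 := abs_le.1 (hr x hx)
    have h2 : g (x + 1) - g x = (-1) ^ x * r x - (-1) ^ x * (r' x + r' (x + 1) + r x) := by
      simp only [hg, pow_succ]; ring
    rw [h2]
    rcases neg_one_pow_eq_or ℝ x with e | e <;> rcases hτ with t | t <;> rw [e, t] <;> linarith
  have hsgn : ∀ i : ℕ, (σ * (-1) ^ i = 1 ∨ σ * (-1) ^ i = -1) := by
    intro i
    rcases neg_one_pow_eq_or ℝ i with e | e <;> rcases hσ with t | t <;> rw [e, t] <;> simp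
  have hex : ∀ i, ∃ y, i ≤ j → (x i ≤ y ∧ y < x (i + 1) ∧
      σ * (-1) ^ i * (g (y + 1) - g y) ≤ 2 * θ) := by
    intro i
    by_cases hi : i ≤ j
    · have h1 := hcon i (by omega)
      have h2 := hcon (i + 1) (by omega)
      obtain ⟨y, hy1, hy2, hy3⟩ := exists_increment_le (h := fun x => σ * (-1) ^ i * g x)
        (hx i (by omega)) (c := 2 * θ) (by linarith) (by
          simp only [hg]
          rw [pow_succ] at h2
          linarith)
      exact ⟨y, fun _ => ⟨hy1, hy2, by linarith⟩⟩
    · exact ⟨0, fun h => absurd h hi⟩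
  choose y hy using hex
  obtain ⟨i, hi, hlt⟩ := h y (fun i hi => by
      have h1 := hy i hi.le
      have h2 := hy (i + 1) hi
      omega) (fun i hi => by
      have h1 := hy i hi
      have h2 := hxN (i + 1) (by omega)
      omega)
  obtain ⟨h1, h2, h3⟩ := hy i hi
  have h4 := hxN (i + 1) (by omega)
  have h5 := hstep (y i) (by omega) _ (hsgn i)
  linarith

lemma NoAlt.card_le {j N : ℕ} {θ : ℝ} {r : ℕ → ℝ} (hθ : 0 ≤ θ) (h : NoAlt j N θ r) :
    N ≤ ((Finset.range N).filter (fun x => r x ≠ 0)).card + j := by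
  by_contra! hcon
  obtain ⟨σ, -, h⟩ := h
  have hsum := Finset.card_filter_add_card_filter_not (s := Finset.range N) (fun x => r x ≠ 0)
  rw [Finset.card_range] at hsum
  set Z := (Finset.range N).filter (fun x => ¬ r x ≠ 0) with hZ
  have hc : j + 1 ≤ Z.card := by omega
  let e := Z.orderEmbOfFin rfl
  have hmem : ∀ i, e i < N ∧ r (e i) = 0 := by
    intro i
    have h1 : e i ∈ Z := Z.orderEmbOfFin_mem rfl i
    have h2 := Finset.mem_filter.1 h1
    exact ⟨Finset.mem_range.1 h2.1, not_not.1 h2.2⟩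
  obtain ⟨i, hi, hlt⟩ := h (fun i => if hi : i < Z.card then e ⟨i, hi⟩ else 0) (fun i hi => by
      rw [dif_pos (by omega), dif_pos (by omega)]
      exact e.strictMono (by simp)) (fun i hi => by
      rw [dif_pos (by omega)]
      exact (hmem ⟨i, by omega⟩).1)
  rw [dif_pos (by omega)] at hlt
  rw [(hmem ⟨i, by omega⟩).2] at hlt
  simp at hlt
  linarith

/-- A sequence with values in `{0} ∪ {|t| ≥ 1}` whose consecutive sums are small is nowhere zero
as soon as it is somewhere nonzero. -/
lemma row_ne_zero {N : ℕ} {η : ℝ} {r : ℕ → ℝ} (hη : η < 1) (hgap : ∀ x, r x = 0 ∨ 1 ≤ |r x|)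
    (hr : ∀ x, x + 1 < N → |r x + r (x + 1)| ≤ η) {x₀ : ℕ} (hx₀ : x₀ < N) (hne : r x₀ ≠ 0) :
    ∀ x < N, r x ≠ 0 := by
  have hiff : ∀ x, x + 1 < N → (r x = 0 ↔ r (x + 1) = 0) := by
    intro x hx
    have h := hr x hx
    constructor <;> intro h0 <;> rw [h0] at h
    · rcases hgap (x + 1) with h1 | h1
      · exact h1
      · rw [zero_add] at h; linarith
    · rcases hgap x with h1 | h1
      · exact h1
      · rw [add_zero] at h; linarith
  have hall : ∀ x < N, (r x = 0 ↔ r 0 = 0) := by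
    intro x
    induction x with
    | zero => simp
    | succ x ih => intro hx; rw [← hiff x hx]; exact ih (by omega)
  intro x hx h0
  exact hne ((hall x₀ hx₀).2 ((hall x hx).1 h0))

lemma noAlt_zero {N : ℕ} {η θ : ℝ} {r : ℕ → ℝ} (hη : η < 1) (hθ : θ < 1)
    (hgap : ∀ x, r x = 0 ∨ 1 ≤ |r x|) (hr : ∀ x, x + 1 < N → |r x + r (x + 1)| ≤ η)
    (hne : ∀ x < N, r x ≠ 0) : NoAlt 0 N θ r := by
  have hone : ∀ x < N, 1 ≤ |r x| := fun x hx => (hgap x).resolve_left (hne x hx)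
  rcases Nat.eq_zero_or_pos N with rfl | hN
  · exact ⟨1, Or.inl rfl, fun x _ h => absurd (h 0 le_rfl) (by omega)⟩
  have key : ∀ σ : ℝ, (σ = 1 ∨ σ = -1) → 1 ≤ σ * r 0 →
      ∀ x < N, 1 ≤ σ * ((-1) ^ x * r x) := by
    intro σ hσ h0 x
    induction x with
    | zero => intro _; simpa using h0
    | succ x ih =>
      intro hx
      have h1 := ih (by omega)
      have h2 := abs_le.1 (hr x hx)
      have h3 := le_abs.1 (hone (x + 1) hx)
      rw [pow_succ]
      rcases neg_one_pow_eq_or ℝ x with e | e <;> rcases hσ with t | t <;> rw [e, t] at h1 ⊢ <;>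
        rcases h3 with h3 | h3 <;> linarith
  rcases le_abs.1 (hone 0 hN) with h0 | h0
  · refine ⟨1, Or.inl rfl, fun x _ h => ⟨0, le_rfl, ?_⟩⟩
    have := key 1 (Or.inl rfl) (by linarith) (x 0) (h 0 le_rfl)
    simp only [pow_zero, mul_one]; linarith
  · refine ⟨-1, Or.inr rfl, fun x _ h => ⟨0, le_rfl, ?_⟩⟩
    have := key (-1) (Or.inr rfl) (by linarith) (x 0) (h 0 le_rfl)
    simp only [pow_zero, mul_one]; linarith

/-- The `x`-th point of the row `{a | ∑ k, a k = s, a i = c}`, starting at `a (i + 1) = d`. -/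
def pt (s : ℤ) (i : Fin 3) (c d : ℤ) (x : ℕ) : Fin 3 → ℤ :=
  fun k => if k = i then c else if k = i + 1 then d + x else s - c - d - x

lemma fin3_forall {p : Fin 3 → Prop} (i : Fin 3) : (∀ k, p k) ↔ p i ∧ p (i + 1) ∧ p (i + 2) := by
  rw [Fin.forall_fin_succ, Fin.forall_fin_two]
  fin_cases i
  · rfl
  · exact ⟨fun h => ⟨h.2.1, h.2.2, h.1⟩, fun h => ⟨h.2.2, h.1, h.2.1⟩⟩
  · exact ⟨fun h => ⟨h.2.2, h.1, h.2.1⟩, fun h => ⟨h.2.1, h.2.2, h.1⟩⟩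

lemma fin3_sum {M : Type*} [AddCommMonoid M] (g : Fin 3 → M) (i : Fin 3) :
    ∑ k, g k = g i + g (i + 1) + g (i + 2) := by
  rw [Fin.sum_univ_three]
  fin_cases i
  · rfl
  · show g 0 + g 1 + g 2 = g 1 + g 2 + g 0
    abel
  · show g 0 + g 1 + g 2 = g 2 + g 0 + g 1
    abel

lemma fin3_ne (i : Fin 3) : i + 1 ≠ i ∧ i + 2 ≠ i ∧ i + 2 ≠ i + 1 := by
  fin_cases i <;> decide

lemma pt_self (s : ℤ) (i : Fin 3) (c d : ℤ) (x : ℕ) : pt s i c d x i = c := by simp [pt]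

lemma pt_one (s : ℤ) (i : Fin 3) (c d : ℤ) (x : ℕ) : pt s i c d x (i + 1) = d + x := by
  simp [pt]

lemma pt_two (s : ℤ) (i : Fin 3) (c d : ℤ) (x : ℕ) : pt s i c d x (i + 2) = s - c - d - x := by
  have h := fin3_ne i
  simp [pt]

lemma sum_pt (s : ℤ) (i : Fin 3) (c d : ℤ) (x : ℕ) : ∑ k, pt s i c d x k = s := by
  rw [fin3_sum _ i, pt_self, pt_one, pt_two]; ring

lemma stdv_self (i : Fin 3) : stdv i i = 1 := by simp [stdv]

lemma stdv_of_ne {i k : Fin 3} (h : k ≠ i) : stdv i k = 0 := by simp [stdv, h]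

lemma sum_stdv (i : Fin 3) : ∑ k, stdv i k = 1 := by simp [stdv]

lemma stdv_nonneg (i k : Fin 3) : 0 ≤ stdv i k := by
  unfold stdv; split_ifs <;> norm_num

lemma stdv_le_one (i k : Fin 3) : stdv i k ≤ 1 := by
  unfold stdv; split_ifs <;> norm_num

lemma fin3_ext {a b : Fin 3 → ℤ} (i : Fin 3) (h0 : a i = b i) (h1 : a (i + 1) = b (i + 1))
    (h2 : a (i + 2) = b (i + 2)) : a = b :=
  funext ((fin3_forall i).2 ⟨h0, h1, h2⟩)

lemma eq_pt {s : ℤ} {a : Fin 3 → ℤ} {i : Fin 3} {c d : ℤ} (hs : ∑ k, a k = s) (hc : a i = c)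
    (hd : d ≤ a (i + 1)) : a = pt s i c d (a (i + 1) - d).toNat := by
  rw [fin3_sum _ i] at hs
  refine fin3_ext i ?_ ?_ ?_
  · rw [pt_self, hc]
  · rw [pt_one]; omega
  · rw [pt_two]; omega

lemma pt_add_self (s : ℤ) (i : Fin 3) (c d : ℤ) (x : ℕ) :
    pt s i c d x + stdv i = pt (s + 1) i (c + 1) d x := by
  obtain ⟨h1, h2, h3⟩ := fin3_ne i
  refine fin3_ext i ?_ ?_ ?_ <;>
    simp only [Pi.add_apply, pt_self, pt_one, pt_two, stdv_self, stdv_of_ne h1, stdv_of_ne h2]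
  all_goals ring

lemma pt_add_one (s : ℤ) (i : Fin 3) (c d : ℤ) (x : ℕ) :
    pt s i c d x + stdv (i + 1) = pt (s + 1) i c d (x + 1) := by
  obtain ⟨h1, h2, h3⟩ := fin3_ne i
  refine fin3_ext i ?_ ?_ ?_ <;>
    simp only [Pi.add_apply, pt_self, pt_one, pt_two, stdv_self, stdv_of_ne h1.symm,
      stdv_of_ne h3]
  all_goals push_cast; ring

lemma pt_add_two (s : ℤ) (i : Fin 3) (c d : ℤ) (x : ℕ) :
    pt s i c d x + stdv (i + 2) = pt (s + 1) i c d x := by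
  obtain ⟨h1, h2, h3⟩ := fin3_ne i
  refine fin3_ext i ?_ ?_ ?_ <;>
    simp only [Pi.add_apply, pt_self, pt_one, pt_two, stdv_self, stdv_of_ne h2.symm,
      stdv_of_ne h3.symm]
  all_goals ring

lemma pt_sub_self (s : ℤ) (i : Fin 3) (c d : ℤ) (x : ℕ) :
    pt s i c d x - stdv i = pt (s - 1) i (c - 1) d x := by
  rw [sub_eq_iff_eq_add, pt_add_self]; simp

lemma pt_injective (s : ℤ) (i : Fin 3) (c d : ℤ) : Function.Injective (pt s i c d) := by
  intro x y h
  have := congrFun h (i + 1)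
  rw [pt_one, pt_one] at this
  omega

/-- The number of nonzero values on a row without long alternations. -/
lemma card_row {f : (Fin 3 → ℤ) → ℝ} {F : Finset (Fin 3 → ℤ)} (hF : ∀ a, f a ≠ 0 → a ∈ F)
    {j N : ℕ} {θ : ℝ} {s c d : ℤ} {i : Fin 3} (hθ : 0 ≤ θ)
    (h : NoAlt j N θ (fun x => f (pt s i c d x))) :
    N ≤ (F.filter (fun a => ∑ k, a k = s ∧ a i = c ∧ d ≤ a (i + 1) ∧ a (i + 1) < d + N)).card
      + j := by
  refine (h.card_le hθ).trans (Nat.add_le_add_right ?_ _)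
  refine Finset.card_le_card_of_injOn (pt s i c d) ?_ (pt_injective s i c d).injOn
  intro x hx
  have hx := Finset.mem_filter.1 hx
  rw [Finset.mem_range] at hx
  simp only [Finset.coe_filter, Set.mem_ofPred_eq]
  refine ⟨hF _ hx.2, sum_pt .., pt_self .., ?_, ?_⟩ <;> rw [pt_one] <;> omega

/-- While lowering the corner of an empty triangle towards that of a nonempty one, there is a first
elementary step that meets the support of `f`. -/
lemma exists_touch {f : (Fin 3 → ℤ) → ℝ} {s : ℤ} {A B : Fin 3 → ℤ} (hBA : ∀ k, B k ≤ A k)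
    (hA : ∀ a, ∑ k, a k = s → (∀ k, A k ≤ a k) → f a = 0)
    (hB : ∃ a, ∑ k, a k = s ∧ (∀ k, B k ≤ a k) ∧ f a ≠ 0) :
    ∃ A' : Fin 3 → ℤ, ∃ i, (∀ k, B k ≤ A' k - stdv i k) ∧ (∀ k, A' k ≤ A k) ∧
      (∀ a, ∑ k, a k = s → (∀ k, A' k ≤ a k) → f a = 0) ∧
      ∃ a, ∑ k, a k = s ∧ (∀ k, A' k - stdv i k ≤ a k) ∧ f a ≠ 0 := by
  obtain ⟨N, hN⟩ : ∃ N : ℕ, ∑ k, A k - ∑ k, B k = N := by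
    refine ⟨(∑ k, A k - ∑ k, B k).toNat, ?_⟩
    have := Finset.sum_le_sum (s := Finset.univ) fun k _ => hBA k
    omega
  induction N generalizing A with
  | zero =>
    exfalso
    obtain ⟨a, ha, hBa, hne⟩ := hB
    refine hne (hA a ha fun k => ?_)
    have h : ∀ k, A k = B k := by
      rw [fin3_sum _ 0, fin3_sum _ 0] at hN
      have := hBA
      rw [fin3_forall 0] at this ⊢
      omega
    rw [h]; exact hBa k
  | succ N ih =>
    obtain ⟨i, hi⟩ : ∃ i, B i < A i := by
      by_contra! hcon
      have := Finset.sum_le_sum (s := Finset.univ) fun k _ => hcon k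
      omega
    have hB' : ∀ k, B k ≤ A k - stdv i k := by
      intro k
      by_cases hk : k = i
      · subst hk; rw [stdv_self]; omega
      · rw [stdv_of_ne hk]; have := hBA k; omega
    by_cases hex : ∃ a, ∑ k, a k = s ∧ (∀ k, A k - stdv i k ≤ a k) ∧ f a ≠ 0
    · exact ⟨A, i, hB', fun _ => le_rfl, hA, hex⟩
    · push Not at hex
      obtain ⟨A', j, h1, h2, h3⟩ := ih (A := A - stdv i) hB' hex (by
        simp only [Pi.sub_apply, Finset.sum_sub_distrib, sum_stdv]
        push_cast at hN
        omega)
      refine ⟨A', j, h1, fun k => (h2 k).trans ?_, h3⟩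
      have := stdv_nonneg i k
      simp only [Pi.sub_apply]; omega

/-- If a triangle of the plane `∑ k, a k = s` is empty but becomes nonempty after adding one row,
then that row is nowhere zero, and the rows below it have few zeros. -/
lemma rows_below {f : (Fin 3 → ℤ) → ℝ} {F : Finset (Fin 3 → ℤ)} (hF : ∀ a, f a ≠ 0 → a ∈ F)
    (hgap : ∀ a, f a = 0 ∨ 1 ≤ |f a|) {s : ℤ} {A : Fin 3 → ℤ} {i : Fin 3} {J : ℕ} {η : ℝ}
    (hη0 : 0 ≤ η) (hη : η ≤ (1 / 2) ^ (J + 1))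
    (hA : ∀ a, ∑ k, a k = s → (∀ k, A k ≤ a k) → f a = 0)
    (hne : ∃ a, ∑ k, a k = s ∧ (∀ k, A k - stdv i k ≤ a k) ∧ f a ≠ 0)
    (hrel : ∀ b, ∑ k, b k = s - 1 → A i - 1 - J ≤ b i → A (i + 1) ≤ b (i + 1) →
      A (i + 2) ≤ b (i + 2) → |∑ k, f (b + stdv k)| ≤ η)
    {L : ℕ} (hL : (L : ℤ) = s - ∑ k, A k + 2) :
    (∀ x < L, f (pt s i (A i - 1) (A (i + 1)) x) ≠ 0) ∧
    (J + 1) * L ≤ (F.filter (fun a => ∑ k, a k = s ∧ A i - 1 - J ≤ a i ∧ A (i + 1) ≤ a (i + 1) ∧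
      A (i + 2) ≤ a (i + 2))).card := by
  obtain ⟨n1, n2, n3⟩ := fin3_ne i
  rw [fin3_sum _ i] at hL
  have hη1 : η ≤ 1 / 2 := hη.trans (by
    have := pow_le_one₀ (n := J) (show (0 : ℝ) ≤ 1 / 2 by norm_num) (by norm_num)
    rw [pow_succ]; linarith)
  have hrow : ∀ t : ℕ, t ≤ J → ∀ x : ℕ, x + 1 < L + t →
      |f (pt s i (A i - 1 - t) (A (i + 1)) x) + f (pt s i (A i - 1 - t) (A (i + 1)) (x + 1))
        + f (pt s i (A i - t) (A (i + 1)) x)| ≤ η := by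
    intro t ht x hx
    have h := hrel (pt (s - 1) i (A i - 1 - t) (A (i + 1)) x) (sum_pt ..)
      (by rw [pt_self]; omega) (by rw [pt_one]; omega) (by rw [pt_two]; omega)
    rw [fin3_sum _ i, pt_add_self, pt_add_one, pt_add_two, sub_add_cancel,
      show A i - 1 - (t : ℤ) + 1 = A i - t by ring] at h
    convert h using 2
    ring
  have hrow0 : ∀ x : ℕ, x + 1 < L →
      |f (pt s i (A i - 1) (A (i + 1)) x) + f (pt s i (A i - 1) (A (i + 1)) (x + 1))| ≤ η := by
    intro x hx
    have h := hrow 0 (Nat.zero_le _) x (by omega)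
    rw [hA (pt s i (A i - (0 : ℕ)) (A (i + 1)) x) (sum_pt ..) ((fin3_forall i).2 ⟨by
      rw [pt_self]; omega, by rw [pt_one]; omega, by rw [pt_two]; omega⟩)] at h
    simpa using h
  have hnz : ∀ x < L, f (pt s i (A i - 1) (A (i + 1)) x) ≠ 0 := by
    obtain ⟨a, ha, haA, hfa⟩ := hne
    have h3 := (fin3_forall i).1 haA
    rw [stdv_self, stdv_of_ne n1, stdv_of_ne n2] at h3
    have hai : a i = A i - 1 := by
      by_contra hcon
      exact hfa (hA a ha ((fin3_forall i).2 (by omega)))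
    have e := eq_pt ha hai (d := A (i + 1)) (by omega)
    rw [e] at hfa
    rw [fin3_sum _ i] at ha
    exact row_ne_zero (r := fun x => f (pt s i (A i - 1) (A (i + 1)) x)) (η := η) (by linarith)
      (fun x => hgap _) hrow0 (x₀ := (a (i + 1) - A (i + 1)).toNat) (by omega) hfa
  refine ⟨hnz, ?_⟩
  have hno : ∀ t : ℕ, t ≤ J → NoAlt t (L + t) ((1 / 2) ^ (t + 1) - η)
      (fun x => f (pt s i (A i - 1 - t) (A (i + 1)) x)) := by
    intro t
    induction t with
    | zero =>
      intro _
      have := noAlt_zero (r := fun x => f (pt s i (A i - 1) (A (i + 1)) x)) (η := η)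
        (θ := (1 / 2) ^ (0 + 1) - η) (N := L) (by linarith) (by norm_num; linarith)
        (fun x => hgap _) hrow0 hnz
      simpa using this
    | succ t ih =>
      intro ht
      have h1 := ih (by omega)
      rw [← add_assoc]
      refine NoAlt.step (η := η) (r := fun x => f (pt s i (A i - 1 - t) (A (i + 1)) x)) ?_ ?_ ?_
      · rw [sub_nonneg]
        exact hη.trans (pow_le_pow_of_le_one (by norm_num) (by norm_num) (by omega))
      · convert h1 using 1
        rw [pow_succ _ (t + 1)]; ring
      · intro x hx
        have := hrow (t + 1) ht x (by omega)
        rw [show A i - ((t + 1 : ℕ) : ℤ) = A i - 1 - t by push_cast; ring] at this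
        exact this
  have hcard : ∀ t ∈ Finset.range (J + 1), L ≤ ((F.filter (fun a => ∑ k, a k = s ∧
      A i - 1 - J ≤ a i ∧ A (i + 1) ≤ a (i + 1) ∧ A (i + 2) ≤ a (i + 2))).filter
      (fun a => (A i - 1 - a i).toNat = t)).card := by
    intro t ht
    rw [Finset.mem_range] at ht
    have h1 := card_row hF (by
      rw [sub_nonneg]
      exact hη.trans (pow_le_pow_of_le_one (by norm_num) (by norm_num) (by omega)))
      (hno t (by omega))
    have h2 : L ≤ (F.filter (fun a => ∑ k, a k = s ∧ a i = A i - 1 - t ∧ A (i + 1) ≤ a (i + 1) ∧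
      a (i + 1) < A (i + 1) + ((L + t : ℕ) : ℤ))).card := by omega
    refine h2.trans (Finset.card_le_card ?_)
    intro a ha
    simp only [Finset.mem_filter] at ha ⊢
    obtain ⟨haF, hs, h4, h5, h6⟩ := ha
    have hs' := hs
    rw [fin3_sum _ i] at hs'
    push_cast at h6
    exact ⟨⟨haF, hs, by omega, by omega, by omega⟩, by omega⟩
  calc (J + 1) * L = ∑ t ∈ Finset.range (J + 1), L := by simp
    _ ≤ _ := Finset.sum_le_sum hcard
    _ ≤ _ := (Finset.sum_card_fiberwise_eq_card_filter ..).trans_le (Finset.card_filter_le ..)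

lemma mem_Icc_of_abs {a p : ℤ} {N : ℕ} (h : |a - p| ≤ N) : a ∈ Finset.Icc (p - N) (p + N) := by
  rw [abs_le] at h
  rw [Finset.mem_Icc]
  omega

lemma card_Icc_symm (p : ℤ) (N : ℕ) : (Finset.Icc (p - N) (p + N)).card = 2 * N + 1 := by
  rw [Int.card_Icc]; omega

lemma card_box_le {S : Finset (Fin 3 → ℤ)} {p : Fin 3 → ℤ} {N : ℕ}
    (h : ∀ a ∈ S, ∀ k, |a k - p k| ≤ N) : S.card ≤ (2 * N + 1) ^ 3 := by
  have hsub : S ⊆ Fintype.piFinset fun k => Finset.Icc (p k - N) (p k + N) := fun a ha =>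
    Fintype.mem_piFinset.2 fun k => mem_Icc_of_abs (h a ha k)
  refine (Finset.card_le_card hsub).trans ?_
  rw [Fintype.card_piFinset]
  simp only [card_Icc_symm]
  simp

lemma card_plane_box_le {S : Finset (Fin 3 → ℤ)} {p : Fin 3 → ℤ} {N : ℕ} {s : ℤ}
    (hs : ∀ a ∈ S, ∑ k, a k = s) (h : ∀ a ∈ S, ∀ k, |a k - p k| ≤ N) :
    S.card ≤ (2 * N + 1) ^ 2 := by
  have : S.card ≤ (Finset.Icc (p 0 - N) (p 0 + N) ×ˢ Finset.Icc (p 1 - N) (p 1 + N)).card := by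
    refine Finset.card_le_card_of_injOn (fun a => (a 0, a 1)) ?_ ?_
    · intro a ha
      exact Finset.mem_coe.2 (Finset.mem_product.2
        ⟨mem_Icc_of_abs (h a ha 0), mem_Icc_of_abs (h a ha 1)⟩)
    · intro a ha b hb hab
      simp only [Prod.mk.injEq] at hab
      have h1 := hs a ha
      have h2 := hs b hb
      rw [Fin.sum_univ_three] at h1 h2
      funext k
      fin_cases k
      · exact hab.1
      · exact hab.2
      · show a 2 = b 2
        omega
  rw [Finset.card_product, card_Icc_symm, card_Icc_symm] at this
  rw [pow_two]; exact this

/-- A counting form of the Vitali covering lemma. -/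
lemma vitali_card {P F : Finset (Fin 3 → ℤ)} {R : (Fin 3 → ℤ) → ℕ} {A : ℕ}
    (h : ∀ p ∈ P, (P.filter (fun a => ∀ k, |a k - p k| ≤ ((5 * R p : ℕ) : ℤ))).card ≤
      A * (F.filter (fun a => ∀ k, |a k - p k| ≤ (R p : ℤ))).card) :
    P.card ≤ A * F.card := by
  classical
  have hball : ∀ (a p : Fin 3 → ℤ) (N : ℕ),
      a ∈ Metric.closedBall p (N : ℝ) ↔ ∀ k, |a k - p k| ≤ (N : ℤ) := by
    intro a p N
    rw [Metric.mem_closedBall, dist_pi_le_iff (Nat.cast_nonneg N)]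
    refine forall_congr' fun k => ?_
    rw [Int.dist_eq']
    exact_mod_cast Iff.rfl
  obtain ⟨u, huP, hdisj, hcov⟩ :=
    Vitali.exists_disjoint_subfamily_covering_enlargement_closedBall (P : Set (Fin 3 → ℤ))
      (fun p => p) (fun p => (R p : ℝ)) (∑ p ∈ P, (R p : ℝ))
      (fun p hp => Finset.single_le_sum (f := fun p => (R p : ℝ)) (fun _ _ => Nat.cast_nonneg _) hp)
      5 (by norm_num)
  set U := P.filter (fun p => p ∈ u) with hU
  have hUP : ∀ p ∈ U, p ∈ P := fun p hp => (Finset.mem_filter.1 hp).1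
  have hPsub : P ⊆ U.biUnion fun p => P.filter (fun a => ∀ k, |a k - p k| ≤ ((5 * R p : ℕ) : ℤ)) := by
    intro a ha
    obtain ⟨b, hb, hab⟩ := hcov a ha
    refine Finset.mem_biUnion.2 ⟨b, Finset.mem_filter.2 ⟨huP hb, hb⟩, Finset.mem_filter.2 ⟨ha, ?_⟩⟩
    rw [← hball]
    have := hab (Metric.mem_closedBall_self (Nat.cast_nonneg _))
    push_cast
    exact this
  calc P.card ≤ _ := Finset.card_le_card hPsub
    _ ≤ ∑ p ∈ U, (P.filter (fun a => ∀ k, |a k - p k| ≤ ((5 * R p : ℕ) : ℤ))).card :=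
        Finset.card_biUnion_le
    _ ≤ ∑ p ∈ U, A * (F.filter (fun a => ∀ k, |a k - p k| ≤ (R p : ℤ))).card :=
        Finset.sum_le_sum fun p hp => h p (hUP p hp)
    _ = A * (U.biUnion fun p => F.filter (fun a => ∀ k, |a k - p k| ≤ (R p : ℤ))).card := by
        rw [← Finset.mul_sum, Finset.card_biUnion]
        intro p hp q hq hpq
        have hd := hdisj (Finset.mem_filter.1 hp).2 (Finset.mem_filter.1 hq).2 hpq
        refine Finset.disjoint_left.2 fun a ha hb => ?_
        exact Set.disjoint_left.1 hd ((hball _ _ _).2 (Finset.mem_filter.1 ha).2)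
          ((hball _ _ _).2 (Finset.mem_filter.1 hb).2)
    _ ≤ A * F.card := Nat.mul_le_mul_left _ (Finset.card_le_card
        (Finset.biUnion_subset.2 fun _ _ => Finset.filter_subset _ _))

/-- A function on a planar triangle which satisfies the zero-sum relation up to a small error and
does not vanish at some deep point has a support of positive density. -/
lemma card_triangle {f : (Fin 3 → ℤ) → ℝ} {F : Finset (Fin 3 → ℤ)} (hF : ∀ a, f a ≠ 0 → a ∈ F)
    (hgap : ∀ a, f a = 0 ∨ 1 ≤ |f a|) {s D : ℤ} {l m : ℕ} {η : ℝ} (hl : (l : ℤ) = s - 3 * D)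
    (hm : 10 * m ≤ l) (hm' : l ≤ 10 * m + 9) (hη0 : 0 ≤ η) (hη : η ≤ (1 / 2) ^ (l + 1))
    (hrel : ∀ b, ∑ k, b k = s - 1 → (∀ k, D ≤ b k) → |∑ k, f (b + stdv k)| ≤ η)
    (hne : ∃ a, ∑ k, a k = s ∧ (∀ k, D + m ≤ a k) ∧ f a ≠ 0) :
    l ^ 2 ≤ 200000 * (F.filter (fun a => ∑ k, a k = s ∧ ∀ k, D ≤ a k)).card := by
  set F' := F.filter (fun a => ∑ k, a k = s ∧ ∀ k, D ≤ a k) with hF'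
  set P : Finset (Fin 3 → ℤ) := (Finset.Icc (fun _ => D + m) (fun _ => s - 2 * (D + m))).filter
    (fun a => ∑ k, a k = s) with hP
  have hPmem : ∀ p ∈ P, ∑ k, p k = s ∧ ∀ k, D + m ≤ p k := by
    intro p hp
    rw [hP, Finset.mem_filter, Finset.mem_Icc] at hp
    exact ⟨hp.2, hp.1.1⟩
  have hPcard : l ^ 2 ≤ 9 * P.card := by
    set t := (l - 3 * m) / 2 with ht
    have h1 : ((Finset.range (t + 1)) ×ˢ (Finset.range (t + 1))).card ≤ P.card := by
      refine Finset.card_le_card_of_injOn (fun q => pt s 0 (D + m + q.1) (D + m) q.2) ?_ ?_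
      · intro q hq
        have hq := Finset.mem_product.1 (Finset.mem_coe.1 hq)
        rw [Finset.mem_range, Finset.mem_range] at hq
        refine Finset.mem_coe.2 (Finset.mem_filter.2 ⟨Finset.mem_Icc.2 ⟨?_, ?_⟩, sum_pt ..⟩)
        · refine (fin3_forall 0).2 ⟨?_, ?_, ?_⟩
          · beta_reduce; rw [pt_self]; omega
          · beta_reduce; rw [pt_one]; omega
          · beta_reduce; rw [pt_two]; omega
        · refine (fin3_forall 0).2 ⟨?_, ?_, ?_⟩
          · beta_reduce; rw [pt_self]; omega
          · beta_reduce; rw [pt_one]; omega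
          · beta_reduce; rw [pt_two]; omega
      · intro q _ q' _ h
        have h0 := congrFun h 0
        have h1 := congrFun h (0 + 1)
        simp only [pt_self, pt_one] at h0 h1
        exact Prod.ext (by omega) (by omega)
    rw [Finset.card_product, Finset.card_range] at h1
    have h2 : l ≤ 3 * (t + 1) := by omega
    nlinarith
  have hlocal : ∀ p ∈ P, ∃ R : ℕ,
      (P.filter (fun a => ∀ k, |a k - p k| ≤ ((5 * R : ℕ) : ℤ))).card ≤
      21142 * (F'.filter (fun a => ∀ k, |a k - p k| ≤ (R : ℤ))).card := by
    intro p hp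
    obtain ⟨hps, hpm⟩ := hPmem p hp
    by_cases hfp : f p = 0
    swap
    · refine ⟨0, (card_plane_box_le (N := 0) (s := s) (p := p)
        (fun a ha => (hPmem a (Finset.mem_filter.1 ha).1).1)
        (fun a ha => (Finset.mem_filter.1 ha).2)).trans ?_⟩
      have : 0 < (F'.filter (fun a => ∀ k, |a k - p k| ≤ ((0 : ℕ) : ℤ))).card := by
        refine Finset.card_pos.2 ⟨p, Finset.mem_filter.2 ⟨Finset.mem_filter.2 ⟨hF p hfp, hps, fun k => ?_⟩, ?_⟩⟩
        · have := hpm k; omega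
        · simp
      omega
    let T : ℕ → Fin 3 → ℤ := fun r k => max (p k - r) (D + m)
    have hps' := hps
    rw [fin3_sum _ 0] at hps'
    have hpm' := (fin3_forall 0).1 hpm
    have hex : ∃ r, ∃ a, ∑ k, a k = s ∧ (∀ k, T r k ≤ a k) ∧ f a ≠ 0 := by
      obtain ⟨a, h1, h2, h3⟩ := hne
      refine ⟨l, a, h1, fun k => ?_, h3⟩
      refine max_le ?_ (h2 k)
      have h2' := (fin3_forall 0).1 h2
      refine (fin3_forall (p := fun k => p k - l ≤ a k) 0).2 ?_ k
      omega
    classical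
    obtain ⟨r, hr0, hr1⟩ : ∃ r, (∀ a, ∑ k, a k = s → (∀ k, T r k ≤ a k) → f a = 0) ∧
        ∃ a, ∑ k, a k = s ∧ (∀ k, T (r + 1) k ≤ a k) ∧ f a ≠ 0 := by
      have h0 : Nat.find hex ≠ 0 := by
        intro h0
        obtain ⟨a, h1, h2, h3⟩ := Nat.find_spec hex
        rw [h0] at h2
        have : a = p := by
          rw [fin3_sum _ 0] at h1
          have h2' := (fin3_forall 0).1 h2
          simp only [T] at h2'
          exact fin3_ext 0 (by omega) (by omega) (by omega)
        exact h3 (this ▸ hfp)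
      obtain ⟨r, hr⟩ := Nat.exists_eq_succ_of_ne_zero h0
      refine ⟨r, ?_, ?_⟩
      · have := Nat.find_min hex (m := r) (by omega)
        push Not at this
        exact this
      · have := Nat.find_spec hex
        rw [hr] at this
        exact this
    have hrl : r < l := by
      by_contra! hcon
      obtain ⟨a, h1, h2, h3⟩ := hne
      refine h3 (hr0 a h1 fun k => max_le ?_ (h2 k))
      have h2' := (fin3_forall 0).1 h2
      refine (fin3_forall (p := fun k => p k - r ≤ a k) 0).2 ?_ k
      omega
    obtain ⟨A, i, hA1, hA2, hA3, hA4⟩ := exists_touch (A := T r) (B := T (r + 1))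
      (fun k => by simp only [T]; omega) hr0 hr1
    have hA1' := (fin3_forall i).1 hA1
    have hA2' := (fin3_forall i).1 hA2
    obtain ⟨n1, n2, n3⟩ := fin3_ne i
    rw [stdv_self, stdv_of_ne n1, stdv_of_ne n2] at hA1'
    simp only [T, max_le_iff, le_max_iff] at hA1' hA2'
    have hps'' := hps
    rw [fin3_sum _ i] at hps''
    have hpm' := (fin3_forall i).1 hpm
    have hsum := fin3_sum A i
    clear_value T
    clear hps' hex
    have hle : (r : ℤ) + 1 ≤ 2 * (s - ∑ k, A k + 2) := by
      rw [hsum]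
      obtain ⟨h1, h2, h3⟩ := hA2'
      rcases h1 with h1 | h1 <;> rcases h2 with h2 | h2 <;> rcases h3 with h3 | h3 <;> omega
    obtain ⟨L, hL⟩ : ∃ L : ℕ, (L : ℤ) = s - ∑ k, A k + 2 := ⟨(s - ∑ k, A k + 2).toNat, by omega⟩
    obtain ⟨J, hJm, hJr, hJ⟩ : ∃ J, J ≤ m ∧ J ≤ r ∧ r + 1 ≤ 11 * (J + 1) := by
      rcases le_total m r with h | h
      · exact ⟨m, le_rfl, h, by omega⟩
      · exact ⟨r, h, le_rfl, by omega⟩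
    have hbase : D + m ≤ A i - 1 ∧ D + m ≤ A (i + 1) ∧ D + m ≤ A (i + 2) := by omega
    have hlow : p i - r ≤ A i ∧ p (i + 1) - (r + 1) ≤ A (i + 1) ∧ p (i + 2) - (r + 1) ≤ A (i + 2) := by
      push_cast at hA1'
      omega
    clear hA1' hA2'
    obtain ⟨-, hcard⟩ := rows_below hF hgap (J := J) hη0
      (hη.trans (pow_le_pow_of_le_one (by norm_num) (by norm_num) (by omega))) hA3 hA4
      (fun b hb h1 h2 h3 => hrel b hb ((fin3_forall i).2 ⟨by omega, by omega, by omega⟩)) hL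
    have hLr : r + 1 ≤ 2 * L := by omega
    have hgain : (r + 1) ^ 2 ≤ 22 * ((J + 1) * L) := by
      calc (r + 1) ^ 2 = (r + 1) * (r + 1) := pow_two _
        _ ≤ (11 * (J + 1)) * (2 * L) := Nat.mul_le_mul hJ hLr
        _ = _ := by ring
    refine ⟨3 * (r + 1), ?_⟩
    have h1 : (P.filter (fun a => ∀ k, |a k - p k| ≤ ((5 * (3 * (r + 1)) : ℕ) : ℤ))).card ≤
        (2 * (5 * (3 * (r + 1))) + 1) ^ 2 :=
      card_plane_box_le (s := s) (fun a ha => (hPmem a (Finset.mem_filter.1 ha).1).1)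
        (fun a ha => (Finset.mem_filter.1 ha).2)
    have h2 : (2 * (5 * (3 * (r + 1))) + 1) ^ 2 ≤ 961 * (r + 1) ^ 2 := by
      calc (2 * (5 * (3 * (r + 1))) + 1) ^ 2 ≤ (31 * (r + 1)) ^ 2 :=
            Nat.pow_le_pow_left (by omega) 2
        _ = _ := by ring
    have h3 : (J + 1) * L ≤
        (F'.filter (fun a => ∀ k, |a k - p k| ≤ ((3 * (r + 1) : ℕ) : ℤ))).card := by
      refine hcard.trans (Finset.card_le_card fun a ha => ?_)
      obtain ⟨haF, has, h4, h5, h6⟩ := Finset.mem_filter.1 ha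
      have has' := has
      rw [fin3_sum _ i] at has'
      refine Finset.mem_filter.2 ⟨Finset.mem_filter.2 ⟨haF, has, (fin3_forall i).2 ⟨by omega, by omega, by omega⟩⟩, ?_⟩
      refine (fin3_forall i).2 ⟨?_, ?_, ?_⟩ <;> rw [abs_le] <;> push_cast <;> omega
    omega
  choose! R hR using hlocal
  have := vitali_card hR
  omega

/-- `f` vanishes at the points of the plane `∑ k, a k = s` all of whose coordinates are at
least `D`. -/
def VanishFrom (f : (Fin 3 → ℤ) → ℝ) (s D : ℤ) : Prop :=
  ∀ a, ∑ k, a k = s → (∀ k, D ≤ a k) → f a = 0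

lemma VanishFrom.mono {f : (Fin 3 → ℤ) → ℝ} {s D D' : ℤ} (h : VanishFrom f s D) (hD : D ≤ D') :
    VanishFrom f s D' :=
  fun a ha hD' => h a ha fun k => hD.trans (hD' k)

/-- In the plane `∑ k, a k = s`, one of the three rows `a i = c`, restricted to the points whose
other coordinates are at least `M`, has no alternating subsequence of length `j + 1`. -/
def RowNoAlt (f : (Fin 3 → ℤ) → ℝ) (M : ℕ) (η : ℝ) (s c : ℤ) (j : ℕ) : Prop :=
  ∃ i, ∀ N : ℕ, (N : ℤ) = s - c - 2 * M + 1 →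
    NoAlt j N ((1 / 2) ^ (j + 1) - η) fun x => f (pt s i c M x)

/-- A row of nonzero values obtained from a zero-sum relation in which the row above vanishes. -/
lemma rowNoAlt_zero {f : (Fin 3 → ℤ) → ℝ} (hgap : ∀ a, f a = 0 ∨ 1 ≤ |f a|) {s c : ℤ} {M : ℕ}
    {η : ℝ} (hη : η ≤ 1 / 4) (hη0 : 0 ≤ η) {i : Fin 3}
    (hrel : ∀ x : ℕ, (x : ℤ) + 1 ≤ s - c - 2 * M →
      |f (pt s i c M x) + f (pt s i c M (x + 1))| ≤ η)
    (hne : ∀ x : ℕ, (x : ℤ) ≤ s - c - 2 * M → f (pt s i c M x) ≠ 0) : RowNoAlt f M η s c 0 := by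
  refine ⟨i, fun N hN => noAlt_zero (η := η) (by linarith) (by norm_num; linarith)
    (fun x => hgap _) (fun x hx => hrel x (by omega)) (fun x hx => hne x (by omega))⟩

lemma layer_touch {f : (Fin 3 → ℤ) → ℝ} {F : Finset (Fin 3 → ℤ)} (hF : ∀ a, f a ≠ 0 → a ∈ F)
    (hgap : ∀ a, f a = 0 ∨ 1 ≤ |f a|) {s : ℤ} {D l M : ℕ} {η : ℝ} (hl : (l : ℤ) = s - 3 * D)
    (hl1 : 1 ≤ l) (hη0 : 0 ≤ η) (hη : η ≤ (1 / 2) ^ (l + 1))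
    (hrel : ∀ b, ∑ k, b k = s - 1 → (∀ k, (D : ℤ) ≤ b k) → |∑ k, f (b + stdv k)| ≤ η)
    (hne : ¬ VanishFrom f s D) (hM : D + l / 10 ≤ M)
    (hcount : 200000 * (F.filter (fun a => ∑ k, a k = s ∧ ∀ k, (D : ℤ) ≤ a k)).card < l ^ 2) :
    ∃ m : ℕ, D ≤ m ∧ m + 1 ≤ D + l / 10 ∧ VanishFrom f s (m + 1 : ℕ) ∧ RowNoAlt f M η s m 0 ∧
      ∀ L : ℕ, (L : ℤ) ≤ s - 3 * m - 1 →
        (m + 1 - D) * L ≤ (F.filter (fun a => ∑ k, a k = s ∧ ∀ k, (D : ℤ) ≤ a k)).card := by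
  classical
  have hdeep : VanishFrom f s (D + l / 10 : ℕ) := by
    intro a ha hD
    by_contra hfa
    have := card_triangle hF hgap (m := l / 10) hl (by omega) (by omega) hη0 hη hrel
      ⟨a, ha, fun k => by have := hD k; push_cast at this ⊢; exact this, hfa⟩
    omega
  obtain ⟨m, hDm, hm, hm0, hm1⟩ : ∃ m : ℕ, D ≤ m ∧ m + 1 ≤ D + l / 10 ∧
      VanishFrom f s (m + 1 : ℕ) ∧ ¬ VanishFrom f s m := by
    have hex : ∃ t : ℕ, VanishFrom f s (D + t : ℕ) := ⟨l / 10, hdeep⟩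
    have h0 : Nat.find hex ≠ 0 := fun h0 => hne (by simpa [h0] using Nat.find_spec hex)
    obtain ⟨t, ht⟩ := Nat.exists_eq_succ_of_ne_zero h0
    refine ⟨D + t, by omega, ?_, ?_, ?_⟩
    · have := Nat.find_min' hex hdeep
      omega
    · have := Nat.find_spec hex
      rw [ht] at this
      exact this
    · exact Nat.find_min hex (by omega)
  obtain ⟨A, i, hA1, hA2, hA3, hA4⟩ := exists_touch (f := f) (s := s) (A := fun _ => (m + 1 : ℕ))
    (B := fun _ => m) (fun k => by push_cast; omega) hm0 (by
      simp only [VanishFrom] at hm1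
      push Not at hm1
      exact hm1)
  have hA1' := (fin3_forall i).1 hA1
  have hA2' := (fin3_forall i).1 hA2
  obtain ⟨n1, n2, n3⟩ := fin3_ne i
  rw [stdv_self, stdv_of_ne n1, stdv_of_ne n2] at hA1'
  push_cast at hA2'
  have hsum := fin3_sum A i
  have hAi : A i - 1 = m := by omega
  obtain ⟨L, hL⟩ : ∃ L : ℕ, (L : ℤ) = s - ∑ k, A k + 2 := ⟨(s - ∑ k, A k + 2).toNat, by omega⟩
  obtain ⟨hnz, hcard⟩ := rows_below hF hgap (J := m - D) hη0
    (hη.trans (pow_le_pow_of_le_one (by norm_num) (by norm_num) (by omega))) hA3 hA4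
    (fun b hb h1 h2 h3 => hrel b hb ((fin3_forall i).2 ⟨by omega, by omega, by omega⟩)) hL
  refine ⟨m, hDm, hm, hm0, ?_, fun L' hL' => ?_⟩
  · refine rowNoAlt_zero hgap (i := i) (hη.trans ?_) hη0 (fun x hx => ?_) (fun x hx => ?_)
    · calc ((1 : ℝ) / 2) ^ (l + 1) ≤ (1 / 2) ^ 2 :=
            pow_le_pow_of_le_one (by norm_num) (by norm_num) (by omega)
        _ = 1 / 4 := by norm_num
    · have h := hrel (pt (s - 1) i m M x) (sum_pt ..) ((fin3_forall i).2 ⟨by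
        rw [pt_self]; omega, by rw [pt_one]; omega, by rw [pt_two]; omega⟩)
      rw [fin3_sum _ i, pt_add_self, pt_add_one, pt_add_two, sub_add_cancel,
        hm0 (pt s i (m + 1) M x) (sum_pt ..) ((fin3_forall i).2 ⟨by
        rw [pt_self]; omega, by rw [pt_one]; omega, by rw [pt_two]; omega⟩)] at h
      rw [add_comm]
      simpa using h
    · have h := hnz (M + x - A (i + 1)).toNat (by omega)
      rw [hAi] at h
      convert h using 2
      refine fin3_ext i ?_ ?_ ?_
      · simp only [pt_self]
      · simp only [pt_one]; omega
      · simp only [pt_two]; omega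
  · calc (m + 1 - D) * L' ≤ (m - D + 1) * L := Nat.mul_le_mul (by omega) (by omega)
      _ ≤ _ := hcard
      _ ≤ _ := Finset.card_le_card fun a ha => by
        obtain ⟨h1, h2, h3⟩ := Finset.mem_filter.1 ha
        exact Finset.mem_filter.2 ⟨h1, h2, (fin3_forall i).2 ⟨by omega, by omega, by omega⟩⟩

/-- Propagation of a row without long alternations by two layers. -/
lemma RowNoAlt.step {f : (Fin 3 → ℤ) → ℝ} {M j : ℕ} {η : ℝ} {s D : ℤ}
    (h : RowNoAlt f M η (s - 1) (D - 1) j) (hη : η ≤ (1 / 2) ^ (j + 2))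
    (hM : D + 1 ≤ M) (hN : 0 ≤ s - D - 2 * M)
    (h0 : VanishFrom f (s - 1) D) (h2 : VanishFrom f (s + 1) (D + 1))
    (hrel : ∀ b, ∑ k, b k = s → (∀ k, D ≤ b k) →
      |∑ k, (f (b + stdv k) + f (b - stdv k))| ≤ η) :
    RowNoAlt f M η (s + 1) D (j + 1) := by
  obtain ⟨i, h⟩ := h
  obtain ⟨n1, n2, n3⟩ := fin3_ne i
  refine ⟨i, fun N hN' => ?_⟩
  obtain ⟨N, rfl⟩ : ∃ N', N = N' + 1 := ⟨N - 1, by omega⟩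
  refine NoAlt.step (η := η) (r := fun x => f (pt (s - 1) i (D - 1) M x)) ?_ ?_ ?_
  · rw [sub_nonneg]; exact hη
  · have := h N (by push_cast at hN'; omega)
    convert this using 1
    rw [pow_succ _ (j + 1)]; ring
  · intro x hx
    have h1 := hrel (pt s i D M x) (sum_pt ..) ((fin3_forall i).2 ⟨by
      rw [pt_self], by rw [pt_one]; omega, by rw [pt_two]; push_cast at hN'; omega⟩)
    rw [fin3_sum _ i, pt_add_self, pt_add_one, pt_add_two, pt_sub_self,
      h2 (pt (s + 1) i (D + 1) M x) (sum_pt ..) ((fin3_forall i).2 ⟨by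
        rw [pt_self], by rw [pt_one]; omega, by rw [pt_two]; push_cast at hN'; omega⟩),
      h0 (pt s i D M x - stdv (i + 1)) (by
        simp only [Pi.sub_apply, Finset.sum_sub_distrib, sum_pt, sum_stdv])
        ((fin3_forall i).2 ?_),
      h0 (pt s i D M x - stdv (i + 2)) (by
        simp only [Pi.sub_apply, Finset.sum_sub_distrib, sum_pt, sum_stdv])
        ((fin3_forall i).2 ?_)] at h1
    · convert h1 using 2
      ring
    · simp only [Pi.sub_apply, pt_self, pt_one, pt_two, stdv_self, stdv_of_ne n2.symm,
        stdv_of_ne n3.symm]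
      push_cast at hN'
      omega
    · simp only [Pi.sub_apply, pt_self, pt_one, pt_two, stdv_self, stdv_of_ne n1.symm,
        stdv_of_ne n3]
      push_cast at hN'
      omega

lemma RowNoAlt.card_le {f : (Fin 3 → ℤ) → ℝ} {F : Finset (Fin 3 → ℤ)} (hF : ∀ a, f a ≠ 0 → a ∈ F)
    {M j : ℕ} {η : ℝ} {s D : ℤ} (h : RowNoAlt f M η s D j) (hη : η ≤ (1 / 2) ^ (j + 1))
    (hD : 0 ≤ D) {N : ℕ} (hN : (N : ℤ) + j ≤ s - D - 2 * M + 1) :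
    N ≤ (F.filter (fun a => ∑ k, a k = s ∧ ∀ k, 0 ≤ a k)).card := by
  obtain ⟨i, h⟩ := h
  obtain ⟨N', hN'⟩ : ∃ N' : ℕ, (N' : ℤ) = s - D - 2 * M + 1 :=
    ⟨(s - D - 2 * M + 1).toNat, by omega⟩
  have h1 := card_row hF (sub_nonneg.2 hη) (h N' hN')
  have h2 : (F.filter (fun a => ∑ k, a k = s ∧ a i = D ∧ (M : ℤ) ≤ a (i + 1) ∧
      a (i + 1) < (M : ℤ) + N')).card ≤ (F.filter (fun a => ∑ k, a k = s ∧ ∀ k, 0 ≤ a k)).card := by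
    refine Finset.card_le_card fun a ha => ?_
    obtain ⟨h3, h4, h5, h6, h7⟩ := Finset.mem_filter.1 ha
    have h4' := h4
    rw [fin3_sum _ i] at h4'
    exact Finset.mem_filter.2 ⟨h3, h4, (fin3_forall i).2 ⟨by omega, by omega, by omega⟩⟩
  omega

/-- The standing assumptions for the layer-by-layer argument in an octant: `f` vanishes on the
`ℓ¹`-ball of radius `ρ`, is almost harmonic where it vanishes, and has small support. -/
structure SparseOutsideBall (f : (Fin 3 → ℤ) → ℝ) (F : Finset (Fin 3 → ℤ)) (ρ : ℕ) (η : ℝ) :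
    Prop where
  mem : ∀ a, f a ≠ 0 → a ∈ F
  gap : ∀ a, f a = 0 ∨ 1 ≤ |f a|
  le_radius : 1000 ≤ ρ
  nonneg : 0 ≤ η
  le_pow : η ≤ (1 / 2) ^ (2 * ρ + 2)
  rel : ∀ b, (∀ k, |b k| ≤ 2 * (ρ : ℤ)) → f b = 0 → |∑ k, (f (b + stdv k) + f (b - stdv k))| ≤ η
  zero : ∀ a, ∑ k, |a k| ≤ (ρ : ℤ) → f a = 0
  card_lt : 1000000 * (F.filter (fun a => ∀ k, |a k| ≤ 2 * (ρ : ℤ))).card < ρ ^ 2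

/-- The points of `F` in the nonnegative octant lying in the layers `ρ + 1, …, ρ + k`. -/
def layers (F : Finset (Fin 3 → ℤ)) (ρ k : ℕ) : Finset (Fin 3 → ℤ) :=
  F.filter fun a => ((ρ : ℤ) + 1 ≤ ∑ i, a i ∧ ∑ i, a i ≤ ρ + k) ∧ ∀ i, 0 ≤ a i

lemma card_layers_add_le (F : Finset (Fin 3 → ℤ)) (ρ k : ℕ) :
    (layers F ρ k).card + (F.filter fun a => ∑ i, a i = (ρ : ℤ) + k + 1 ∧ ∀ i, 0 ≤ a i).card ≤
      (layers F ρ (k + 1)).card := by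
  rw [← Finset.card_union_of_disjoint]
  · refine Finset.card_le_card fun a ha => ?_
    simp only [layers, Finset.mem_union, Finset.mem_filter] at ha ⊢
    push_cast
    rcases ha with ⟨h1, h2, h3⟩ | ⟨h1, h2, h3⟩
    · exact ⟨h1, by omega, h3⟩
    · exact ⟨h1, by omega, h3⟩
  · refine Finset.disjoint_left.2 fun a ha hb => ?_
    have h1 := (Finset.mem_filter.1 ha).2.1
    have h2 := (Finset.mem_filter.1 hb).2.1
    omega

/-- The state of the layer-by-layer argument after `k` layers: in the layer `ρ + k` the function
vanishes at depth `D`, a row without long alternations lies just outside of the zero region, and the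
support contains at least about `ρ * D / 8` points. -/
def LayerState (f : (Fin 3 → ℤ) → ℝ) (F : Finset (Fin 3 → ℤ)) (ρ : ℕ) (η : ℝ) (k D : ℕ) : Prop :=
  1 ≤ D ∧ VanishFrom f (ρ + k) D ∧ (ρ / 8) * D ≤ (layers F ρ k).card + ρ / 8 ∧
    ((VanishFrom f (ρ + k - 1) (D - 1) ∧
        (∃ j ≤ k, RowNoAlt f (ρ / 5) η (ρ + k) (D - 1) j) ∧ k + 1 ≤ 2 * D) ∨
      (VanishFrom f (ρ + k - 1) D ∧
        (∃ j ≤ k, RowNoAlt f (ρ / 5) η (ρ + k - 1) (D - 1) j) ∧ k ≤ 2 * D))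

namespace SparseOutsideBall

variable {f : (Fin 3 → ℤ) → ℝ} {F : Finset (Fin 3 → ℤ)} {ρ : ℕ} {η : ℝ}

lemma le_pow_of_le (h : SparseOutsideBall f F ρ η) {t : ℕ} (ht : t ≤ 2 * ρ + 2) :
    η ≤ (1 / 2) ^ t :=
  h.le_pow.trans (pow_le_pow_of_le_one (by norm_num) (by norm_num) ht)

lemma rel_of_nonneg (h : SparseOutsideBall f F ρ η) {k D : ℕ} (hk : k ≤ ρ)
    (hV : VanishFrom f (ρ + k) D) (b : Fin 3 → ℤ) (hb : ∑ k, b k = ρ + k)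
    (hD : ∀ k, (D : ℤ) ≤ b k) : |∑ k, (f (b + stdv k) + f (b - stdv k))| ≤ η := by
  refine h.rel b ((fin3_forall 0).2 ?_) (hV b hb hD)
  have hD' := (fin3_forall 0).1 hD
  rw [fin3_sum _ 0] at hb
  simp only [abs_le]
  omega

lemma card_le (h : SparseOutsideBall f F ρ η) {p : (Fin 3 → ℤ) → Prop} [DecidablePred p]
    (hp : ∀ a, p a → (∀ k, 0 ≤ a k) ∧ ∑ k, a k ≤ 2 * ρ) :
    1000000 * (F.filter p).card < ρ ^ 2 := by
  refine lt_of_le_of_lt (Nat.mul_le_mul_left _ (Finset.card_le_card fun a ha => ?_)) h.card_lt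
  obtain ⟨h1, h2⟩ := Finset.mem_filter.1 ha
  obtain ⟨h3, h4⟩ := hp a h2
  refine Finset.mem_filter.2 ⟨h1, (fin3_forall 0).2 ?_⟩
  have h3' := (fin3_forall 0).1 h3
  rw [fin3_sum _ 0] at h4
  simp only [abs_le]
  omega

lemma depth_le (h : SparseOutsideBall f F ρ η) {k D : ℕ} (hk : k ≤ ρ)
    (hD : (ρ / 8) * D ≤ (layers F ρ k).card + ρ / 8) : D ≤ ρ / 40 := by
  by_contra! hcon
  have h1 : 1000000 * (layers F ρ k).card < ρ ^ 2 :=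
    h.card_le fun a ha => ⟨ha.2, by have := ha.1.2; omega⟩
  have h2 : (ρ / 8) * (ρ / 40 + 1) ≤ (ρ / 8) * D := Nat.mul_le_mul_left _ hcon
  have h3 : ρ * ρ ≤ (9 * (ρ / 8)) * (42 * (ρ / 40)) :=
    Nat.mul_le_mul (by have := h.le_radius; omega) (by have := h.le_radius; omega)
  rw [pow_two] at h1
  nlinarith

lemma touched (h : SparseOutsideBall f F ρ η) {k D T : ℕ} (hk : k ≤ 2 * (ρ / 40))
    (hD : (ρ / 8) * D ≤ (layers F ρ k).card + ρ / 8) (h1 : 1 ≤ D) (hDT : D ≤ T) (hTD : T ≤ D + 1)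
    (hV : VanishFrom f (ρ + k) T) (hV' : VanishFrom f (ρ + k - 1) (T - 1)) (hkT : k ≤ 2 * T)
    (hne : ¬ VanishFrom f (ρ + k + 1) T) : ∃ D', LayerState f F ρ η (k + 1) D' := by
  have hρ := h.le_radius
  have hdep := h.depth_le (by omega) hD
  obtain ⟨m, hm1, hm2, hm3, hm4, hm5⟩ := layer_touch h.mem h.gap (s := ρ + k + 1) (D := T)
    (l := ρ + k + 1 - 3 * T) (M := ρ / 5) (by omega) (by omega) h.nonneg
    (h.le_pow_of_le (by omega)) (fun b hb hbD => by
      rw [add_sub_cancel_right] at hb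
      have := h.rel_of_nonneg (by omega) hV b hb hbD
      convert this using 4 with i
      rw [hV' (b - stdv i), add_zero]
      · simp only [Pi.sub_apply, Finset.sum_sub_distrib, hb, sum_stdv]
      · intro k
        have := hbD k
        have : stdv i k ≤ 1 := stdv_le_one i k
        simp only [Pi.sub_apply]
        omega) hne (by omega) (by
      have h2 := h.card_le (p := fun a => ∑ i, a i = (ρ : ℤ) + k + 1 ∧ ∀ i, (T : ℤ) ≤ a i)
        fun a ha => ⟨fun k => by have := ha.2 k; omega, by omega⟩
      have h3 : ρ ^ 2 ≤ (2 * (ρ + k + 1 - 3 * T)) ^ 2 := Nat.pow_le_pow_left (by omega) 2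
      rw [mul_pow] at h3
      omega)
  have hg := hm5 (2 * (ρ / 8)) (by push_cast; omega)
  have hg' : (F.filter (fun a => ∑ i, a i = (ρ : ℤ) + k + 1 ∧ ∀ i, (T : ℤ) ≤ a i)).card ≤
      (F.filter (fun a => ∑ i, a i = (ρ : ℤ) + k + 1 ∧ ∀ i, 0 ≤ a i)).card :=
    Finset.card_le_card (Finset.monotone_filter_right _ fun a _ ha =>
      ⟨ha.1, fun k => by have := ha.2 k; omega⟩)
  have hl := card_layers_add_le F ρ k
  refine ⟨m + 1, by omega, ?_, ?_, Or.inl ⟨?_, ⟨0, by omega, ?_⟩, by omega⟩⟩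
  · push_cast at hm3 ⊢
    rw [← add_assoc]
    exact hm3
  · calc ρ / 8 * (m + 1) ≤ ρ / 8 * (D + 2 * (m + 1 - T)) := Nat.mul_le_mul_left _ (by omega)
      _ = ρ / 8 * D + (m + 1 - T) * (2 * (ρ / 8)) := by ring
      _ ≤ _ := Nat.add_le_add hD hg
      _ ≤ _ := by omega
  · have := hV.mono (D' := m) (by omega)
    push_cast
    convert this using 1 <;> ring
  · push_cast
    convert hm4 using 1 <;> ring

lemma step (h : SparseOutsideBall f F ρ η) {k D : ℕ} (hk : k ≤ 2 * (ρ / 40))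
    (hS : LayerState f F ρ η k D) : ∃ D', LayerState f F ρ η (k + 1) D' := by
  have hρ := h.le_radius
  obtain ⟨h1, hV, hD, hS⟩ := hS
  have hdep := h.depth_le (by omega) hD
  have hl := card_layers_add_le F ρ k
  rcases hS with ⟨hV', ⟨j, hj, hrow⟩, hkD⟩ | ⟨hV', ⟨j, hj, hrow⟩, hkD⟩
  · by_cases hne : VanishFrom f (ρ + k + 1) D
    · refine ⟨D, h1, ?_, by omega, Or.inr ⟨?_, ⟨j, by omega, ?_⟩, by omega⟩⟩ <;> push_cast
      · rwa [← add_assoc]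
      · convert hV using 1; ring
      · convert hrow using 1; ring
    · exact h.touched hk hD h1 le_rfl (by omega) hV hV' (by omega) hne
  · by_cases hne : VanishFrom f (ρ + k + 1) (D + 1 : ℕ)
    · have hrow' : RowNoAlt f (ρ / 5) η (ρ + k + 1) D (j + 1) :=
        hrow.step (h.le_pow_of_le (by omega)) (by omega) (by omega) hV' (by
          push_cast at hne; exact hne) (h.rel_of_nonneg (by omega) hV)
      have hc := hrow'.card_le h.mem (h.le_pow_of_le (by omega)) (by omega) (N := ρ / 8) (by
        push_cast; omega)
      refine ⟨D + 1, by omega, ?_, ?_, Or.inl ⟨?_, ⟨j + 1, by omega, ?_⟩, by omega⟩⟩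
      · push_cast at hne ⊢
        rwa [← add_assoc]
      · rw [Nat.mul_add]
        omega
      · push_cast
        convert hV using 1 <;> ring
      · push_cast
        convert hrow' using 1 <;> ring
    · refine h.touched hk hD h1 (by omega) le_rfl (hV.mono (by omega)) ?_ (by omega) hne
      push_cast
      rwa [add_sub_cancel_right]

/-- A function as above cannot be nonzero next to the `ℓ¹`-ball, away from its corners. -/
lemma false_of_ne_zero (h : SparseOutsideBall f F ρ η)
    (hne : (∃ a, (∀ k, 1 ≤ a k) ∧ ∑ k, a k = (ρ : ℤ) + 1 ∧ f a ≠ 0) ∨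
      ((∀ a, ∑ k, |a k| = (ρ : ℤ) + 1 → (∀ k, a k ≠ 0) → f a = 0) ∧
        ∃ a i, ∑ k, a k = (ρ : ℤ) + 1 ∧ a i = 0 ∧ 1 ≤ a (i + 1) ∧ 1 ≤ a (i + 2) ∧ f a ≠ 0)) :
    False := by
  have hρ := h.le_radius
  have hinit : ∃ D, LayerState f F ρ η 1 D := by
    have hV0 : VanishFrom f ρ 0 := fun a ha h0 => h.zero a (by
      simp only [fun k => abs_of_nonneg (h0 k)]; omega)
    rcases hne with ⟨a, h1, h2, h3⟩ | ⟨hz, a, i, h1, h2, h3, h4, h5⟩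
    · refine h.touched (k := 0) (D := 1) (T := 1) (by omega) (by omega) le_rfl le_rfl (by omega)
        ?_ ?_ (by omega) ?_
      · simpa using hV0.mono (D' := 1) (by norm_num)
      · intro a ha h0
        refine h.zero a ?_
        simp only [Nat.cast_one, sub_self] at h0
        simp only [fun k => abs_of_nonneg (h0 k)]
        push_cast at ha
        omega
      · intro hV
        exact h3 (hV a (by simpa using h2) (by simpa using h1))
    · have hV1 : VanishFrom f (ρ + 1) 1 := by
        intro a ha h0
        refine hz a ?_ fun k => by have := h0 k; omega
        simp only [fun k => abs_of_nonneg (zero_le_one.trans (h0 k)), ha]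
      obtain ⟨n1, n2, n3⟩ := fin3_ne i
      have hrel : ∀ x : ℕ, (x : ℤ) + 2 ≤ ρ →
          |f (pt (ρ + 1) i 0 1 x) + f (pt (ρ + 1) i 0 1 (x + 1))| ≤ η := by
        intro x hx
        have h6 : ∀ k, f (pt ρ i 0 1 x - stdv k) = 0 := by
          refine (fin3_forall i).2 ⟨hz _ ?_ ?_, h.zero _ ?_, h.zero _ ?_⟩
          · rw [fin3_sum _ i]
            simp only [Pi.sub_apply, pt_self, pt_one, pt_two, stdv_self, stdv_of_ne n1,
              stdv_of_ne n2]
            rw [abs_of_neg, abs_of_pos, abs_of_pos] <;> omega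
          · refine (fin3_forall i).2 ?_
            simp only [Pi.sub_apply, pt_self, pt_one, pt_two, stdv_self, stdv_of_ne n1,
              stdv_of_ne n2]
            omega
          · rw [fin3_sum _ i]
            simp only [Pi.sub_apply, pt_self, pt_one, pt_two, stdv_self, stdv_of_ne n1.symm,
              stdv_of_ne n3]
            rw [abs_of_nonneg, abs_of_nonneg, abs_of_nonneg] <;> omega
          · rw [fin3_sum _ i]
            simp only [Pi.sub_apply, pt_self, pt_one, pt_two, stdv_self, stdv_of_ne n2.symm,
              stdv_of_ne n3.symm]
            rw [abs_of_nonneg, abs_of_nonneg, abs_of_nonneg] <;> omega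
        have h7 := h.rel_of_nonneg (k := 0) (D := 0) (by omega) (by simpa using hV0)
          (pt ρ i 0 1 x) (by rw [sum_pt]; simp) ((fin3_forall i).2 ⟨by
            rw [pt_self]; omega, by rw [pt_one]; omega, by rw [pt_two]; omega⟩)
        simp only [h6, add_zero] at h7
        rw [fin3_sum _ i, pt_add_self, pt_add_one, pt_add_two, hV1 (pt (ρ + 1) i (0 + 1) 1 x)
          (sum_pt ..) ((fin3_forall i).2 ⟨by
            rw [pt_self]; omega, by rw [pt_one]; omega, by rw [pt_two]; omega⟩)] at h7
        rw [add_comm]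
        simpa using h7
      have hnz : ∀ x < ρ, f (pt (ρ + 1) i 0 1 x) ≠ 0 := by
        have h1' := h1
        rw [fin3_sum _ i] at h1'
        rw [eq_pt h1 h2 h3] at h5
        exact row_ne_zero (r := fun x => f (pt (ρ + 1) i 0 1 x)) (η := η)
          (lt_of_le_of_lt (h.le_pow_of_le (t := 1) (by omega)) (by norm_num)) (fun x => h.gap _)
          (fun x hx => hrel x (by omega)) (by omega) h5
      have hpt : ∀ x : ℕ, pt (ρ + 1) i 0 (ρ / 5 : ℕ) x = pt (ρ + 1) i 0 1 (ρ / 5 - 1 + x) := by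
        intro x
        refine fin3_ext i ?_ ?_ ?_
        · simp only [pt_self]
        · simp only [pt_one]; omega
        · simp only [pt_two]; omega
      refine ⟨1, le_rfl, by simpa using hV1, by omega, Or.inl ⟨by simpa using hV0, ⟨0, by omega, ?_⟩,
        le_rfl⟩⟩
      have hrow : RowNoAlt f (ρ / 5) η (ρ + 1) 0 0 := by
        refine rowNoAlt_zero h.gap (i := i) ?_ h.nonneg (fun x hx => ?_) (fun x hx => ?_)
        · refine (h.le_pow_of_le (t := 2) (by omega)).trans ?_
          norm_num
        · rw [hpt, hpt]
          exact hrel _ (by omega)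
        · rw [hpt]
          exact hnz _ (by omega)
      simpa using hrow
  have hall : ∀ k, k ≤ 2 * (ρ / 40) → ∃ D, LayerState f F ρ η (k + 1) D := by
    intro k
    induction k with
    | zero => exact fun _ => hinit
    | succ k ih =>
      intro hk
      obtain ⟨D, hD⟩ := ih (by omega)
      exact h.step hk hD
  obtain ⟨D, h1, hV, hD, hS⟩ := hall _ le_rfl
  have hdep := h.depth_le (by omega) hD
  rcases hS with ⟨-, -, hS⟩ | ⟨-, -, hS⟩ <;> omega

end SparseOutsideBall

namespace SparseOutsideBall

variable {f : (Fin 3 → ℤ) → ℝ} {F : Finset (Fin 3 → ℤ)} {ρ : ℕ} {η : ℝ}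

lemma reflect (h : SparseOutsideBall f F ρ η) {σ : Fin 3 → ℤ} (hσ : ∀ k, σ k = 1 ∨ σ k = -1) :
    SparseOutsideBall (fun a => f (σ * a)) (F.image (σ * ·)) ρ η := by
  have hinv : ∀ a, σ * (σ * a) = a := by
    intro a
    funext k
    rcases hσ k with e | e <;> simp [e]
  have habs : ∀ a k, |(σ * a) k| = |a k| := by
    intro a k
    rcases hσ k with e | e <;> simp [e]
  refine ⟨fun a ha => ?_, fun a => h.gap _, h.le_radius, h.nonneg, h.le_pow, fun b hb hfb => ?_,
    fun a ha => ?_, ?_⟩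
  · exact Finset.mem_image.2 ⟨σ * a, h.mem _ ha, hinv a⟩
  · have h1 := h.rel (σ * b) (fun k => (habs b k).trans_le (hb k)) hfb
    convert h1 using 3 with k
    have h2 : σ * stdv k = σ k • stdv k := by
      funext j
      by_cases hj : j = k
      · subst hj; simp
      · simp [stdv_of_ne hj]
    rw [mul_add, mul_sub, h2]
    rcases hσ k with e | e <;> rw [e]
    · rw [one_smul]
    · rw [neg_one_smul, sub_neg_eq_add, ← sub_eq_add_neg, add_comm]
  · refine h.zero _ ?_
    simpa only [habs] using ha
  · refine lt_of_le_of_lt (Nat.mul_le_mul_left _ ?_) h.card_lt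
    rw [Finset.filter_image]
    refine Finset.card_image_le.trans (le_of_eq ?_)
    simp only [habs]

lemma false_of_sphere_ne_zero (h : SparseOutsideBall f F ρ η)
    (hne : ∃ a, ∑ k, |a k| = (ρ : ℤ) + 1 ∧ f a ≠ 0) : False := by
  have hsign : ∀ a : Fin 3 → ℤ, ∃ σ : Fin 3 → ℤ, (∀ k, σ k = 1 ∨ σ k = -1) ∧
      (σ * fun k => |a k|) = a := by
    intro a
    refine ⟨fun k => if 0 ≤ a k then 1 else -1, fun k => ?_, funext fun k => ?_⟩
    · dsimp only
      split_ifs <;> simp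
    · simp only [Pi.mul_apply]
      split_ifs with h0
      · rw [abs_of_nonneg h0, one_mul]
      · rw [abs_of_neg (not_le.1 h0)]; ring
  have hz : ∀ a, ∑ k, |a k| = (ρ : ℤ) + 1 → (∀ k, a k ≠ 0) → f a = 0 := by
    intro a ha h0
    by_contra hfa
    obtain ⟨σ, hσ, e⟩ := hsign a
    refine (h.reflect hσ).false_of_ne_zero (Or.inl ⟨fun k => |a k|, fun k => ?_, ha, ?_⟩)
    · exact Int.one_le_abs (h0 k)
    · rwa [e]
  have hz' : ∀ a i, ∑ k, |a k| = (ρ : ℤ) + 1 → a i = 0 → a (i + 1) ≠ 0 → a (i + 2) ≠ 0 →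
      f a = 0 := by
    intro a i ha h0 h1 h2
    by_contra hfa
    obtain ⟨σ, hσ, e⟩ := hsign a
    have habs : ∀ a k, |(σ * a) k| = |a k| := by
      intro a k
      rcases hσ k with e | e <;> simp [e]
    refine (h.reflect hσ).false_of_ne_zero (Or.inr ⟨fun b hb hb0 => hz _ ?_ fun k => ?_,
      fun k => |a k|, i, ha, ?_, Int.one_le_abs h1, Int.one_le_abs h2, ?_⟩)
    · simpa only [habs] using hb
    · rw [← abs_pos, habs, abs_pos]
      exact hb0 k
    · simp [h0]
    · rwa [e]
  obtain ⟨a, ha, hfa⟩ := hne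
  have hρ := h.le_radius
  obtain ⟨i, h1, h2⟩ : ∃ i, a (i + 1) = 0 ∧ a (i + 2) = 0 := by
    by_contra! hcon
    have c0 : a (0 + 1) = 0 → a (0 + 2) ≠ 0 := hcon 0
    have c1 : a (0 + 2) = 0 → a 0 ≠ 0 := hcon 1
    have c2 : a 0 = 0 → a (0 + 1) ≠ 0 := hcon 2
    by_cases e0 : a 0 = 0
    · exact hfa (hz' a 0 ha e0 (c2 e0) fun e => c1 e e0)
    by_cases e1 : a (0 + 1) = 0
    · exact hfa (hz' a 1 ha e1 (c0 e1) e0)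
    by_cases e2 : a (0 + 2) = 0
    · exact hfa (hz' a 2 ha e2 e0 e1)
    · exact hfa (hz a ha ((fin3_forall 0).2 ⟨e0, e1, e2⟩))
  obtain ⟨n1, n2, n3⟩ := fin3_ne i
  have hai : |a i| = ρ + 1 := by
    rw [fin3_sum _ i, h1, h2] at ha
    simpa using ha
  obtain ⟨ε, hε, haε⟩ : ∃ ε : ℤ, (ε = 1 ∨ ε = -1) ∧ a i = ε * (ρ + 1) := by
    rcases eq_or_eq_neg_of_abs_eq hai with e | e
    · exact ⟨1, Or.inl rfl, by rw [e]; ring⟩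
    · exact ⟨-1, Or.inr rfl, by rw [e]; ring⟩
  set b : Fin 3 → ℤ := a - ε • stdv i with hb
  have hbi : b i = ε * ρ := by
    simp only [hb, Pi.sub_apply, Pi.smul_apply, stdv_self, haε, smul_eq_mul]; ring
  have hb1 : b (i + 1) = 0 := by simp [hb, h1, stdv_of_ne n1]
  have hb2 : b (i + 2) = 0 := by simp [hb, h2, stdv_of_ne n2]
  have hfb : f b = 0 := by
    refine h.zero b ?_
    rw [fin3_sum _ i, hbi, hb1, hb2]
    rcases hε with e | e <;> rw [e] <;> simp
  have hside1 : ∀ δ : ℤ, (δ = 1 ∨ δ = -1) → f (b + δ • stdv (i + 1)) = 0 := by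
    intro δ hδ
    have e : i + 2 + 1 = i := by rw [add_assoc]; exact add_zero i
    have e' : i + 2 + 2 = i + 1 := by rw [add_assoc]; rfl
    refine hz' _ (i + 2) ?_ ?_ ?_ ?_
    · rw [fin3_sum _ i]
      simp only [Pi.add_apply, Pi.smul_apply, stdv_self, stdv_of_ne n1.symm, stdv_of_ne n3, hbi,
        hb1, hb2]
      rcases hδ with d | d <;> rcases hε with c | c <;> rw [d, c] <;> simp
    · simp [stdv_of_ne n3, hb2]
    · rw [e]
      simp only [Pi.add_apply, Pi.smul_apply, stdv_of_ne n1.symm, hbi]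
      rcases hε with c | c <;> rw [c] <;> simp <;> omega
    · rw [e']
      simp only [Pi.add_apply, Pi.smul_apply, stdv_self, hb1]
      rcases hδ with d | d <;> rw [d] <;> simp
  have hside2 : ∀ δ : ℤ, (δ = 1 ∨ δ = -1) → f (b + δ • stdv (i + 2)) = 0 := by
    intro δ hδ
    have e : i + 1 + 1 = i + 2 := by rw [add_assoc]; rfl
    have e' : i + 1 + 2 = i := by rw [add_assoc]; exact add_zero i
    refine hz' _ (i + 1) ?_ ?_ ?_ ?_
    · rw [fin3_sum _ i]
      simp only [Pi.add_apply, Pi.smul_apply, stdv_self, stdv_of_ne n2.symm, stdv_of_ne n3.symm,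
        hbi, hb1, hb2]
      rcases hδ with d | d <;> rcases hε with c | c <;> rw [d, c] <;> simp
    · simp [stdv_of_ne n3.symm, hb1]
    · rw [e]
      simp only [Pi.add_apply, Pi.smul_apply, stdv_self, hb2]
      rcases hδ with d | d <;> rw [d] <;> simp
    · rw [e']
      simp only [Pi.add_apply, Pi.smul_apply, stdv_of_ne n2.symm, hbi]
      rcases hε with c | c <;> rw [c] <;> simp <;> omega
  have hfront : b + ε • stdv i = a := by simp [hb]
  have hback : f (b - ε • stdv i) = 0 := by
    refine h.zero _ ?_
    rw [fin3_sum _ i]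
    simp only [Pi.sub_apply, Pi.smul_apply, stdv_self, stdv_of_ne n1, stdv_of_ne n2, hbi, hb1, hb2]
    rcases hε with c | c <;> rw [c] <;> norm_num <;> rw [abs_le] <;> omega
  have hrel := h.rel b ((fin3_forall i).2 ⟨by
    rw [hbi, abs_le]; rcases hε with c | c <;> rw [c] <;> omega, by
    rw [hb1, abs_zero]; omega, by rw [hb2, abs_zero]; omega⟩) hfb
  have hp1 := hside1 1 (Or.inl rfl)
  have hm1 := hside1 (-1) (Or.inr rfl)
  have hp2 := hside2 1 (Or.inl rfl)
  have hm2 := hside2 (-1) (Or.inr rfl)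
  simp only [one_smul, neg_one_smul, ← sub_eq_add_neg] at hp1 hm1 hp2 hm2
  have hsum : f (b + stdv i) + f (b - stdv i) = f a := by
    rw [← hfront]
    rcases hε with c | c <;> rw [c] at hback ⊢
    · simp only [one_smul] at hback ⊢
      rw [hback, add_zero]
    · simp only [neg_one_smul, sub_neg_eq_add, ← sub_eq_add_neg] at hback ⊢
      rw [hback, zero_add]
  rw [fin3_sum _ i, hp1, hm1, hp2, hm2, hsum] at hrel
  simp only [add_zero] at hrel
  have h3 := (h.gap a).resolve_left hfa
  have h4 : η ≤ (1 / 2) ^ 1 := h.le_pow_of_le (by omega)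
  linarith

end SparseOutsideBall

/-- An almost harmonic function on a cube, with values in `{0} ∪ {|t| ≥ 1}` and nonzero at the
center, has a support of at least quadratic size. -/
lemma sq_le_card_support {f : (Fin 3 → ℤ) → ℝ} {F : Finset (Fin 3 → ℤ)} {N : ℕ} {η : ℝ}
    (hN : 1 ≤ N) (hF : ∀ a, f a ≠ 0 → a ∈ F) (hgap : ∀ a, f a = 0 ∨ 1 ≤ |f a|) (hη0 : 0 ≤ η)
    (hη : η ≤ (1 / 2) ^ (2 * N + 2)) (h0 : f 0 ≠ 0)
    (hrel : ∀ b, (∀ k, |b k| ≤ (N : ℤ)) → f b = 0 →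
      |∑ k, (f (b + stdv k) + f (b - stdv k))| ≤ η) :
    N ^ 2 ≤ 10 ^ 16 * F.card := by
  classical
  set m := N / 10 with hm
  set P : Finset (Fin 3 → ℤ) := Fintype.piFinset fun _ => Finset.Icc (0 - (m : ℤ)) (0 + m) with hP
  have hPmem : ∀ p ∈ P, ∀ k, |p k| ≤ (m : ℤ) := by
    intro p hp k
    have := Finset.mem_Icc.1 (Fintype.mem_piFinset.1 hp k)
    rw [abs_le]
    omega
  have hPcard : P.card = (2 * m + 1) ^ 3 := by
    rw [hP, Fintype.card_piFinset]
    simp only [card_Icc_symm]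
    simp
  have hlocal : ∀ p ∈ P, ∃ R : ℕ,
      (P.filter (fun a => ∀ k, |a k - p k| ≤ ((5 * R : ℕ) : ℤ))).card ≤
      (10 ^ 13 * N) * (F.filter (fun a => ∀ k, |a k - p k| ≤ (R : ℤ))).card := by
    intro p hp
    have hpm := hPmem p hp
    have hbox : ∀ R : ℕ, (P.filter (fun a => ∀ k, |a k - p k| ≤ ((5 * R : ℕ) : ℤ))).card ≤
        (2 * (5 * R) + 1) ^ 3 := fun R => card_box_le fun a ha => (Finset.mem_filter.1 ha).2
    have hsmall : ∀ R : ℕ, R ≤ 1000 → (∃ a, (∀ k, |a k - p k| ≤ (R : ℤ)) ∧ f a ≠ 0) →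
        (P.filter (fun a => ∀ k, |a k - p k| ≤ ((5 * R : ℕ) : ℤ))).card ≤
        (10 ^ 13 * N) * (F.filter (fun a => ∀ k, |a k - p k| ≤ (R : ℤ))).card := by
      rintro R hR ⟨a, ha, hfa⟩
      have h1 : 1 ≤ (F.filter (fun a => ∀ k, |a k - p k| ≤ (R : ℤ))).card :=
        Finset.card_pos.2 ⟨a, Finset.mem_filter.2 ⟨hF a hfa, ha⟩⟩
      calc _ ≤ (2 * (5 * R) + 1) ^ 3 := hbox R
        _ ≤ (2 * (5 * 1000) + 1) ^ 3 := Nat.pow_le_pow_left (by omega) 3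
        _ ≤ (10 ^ 13 * 1) * 1 := by norm_num
        _ ≤ _ := Nat.mul_le_mul (Nat.mul_le_mul_left _ hN) h1
    by_cases hfp : f p = 0
    swap
    · exact ⟨0, hsmall 0 (by norm_num) ⟨p, by simp, hfp⟩⟩
    have hp3 : ∑ k, |(-p) k| ≤ ((3 * m : ℕ) : ℤ) := by
      simp only [Pi.neg_apply, abs_neg]
      refine (Finset.sum_le_sum fun k _ => hpm k).trans ?_
      simp
    have hle : ∀ (a : Fin 3 → ℤ) (k : Fin 3), |a k| ≤ ∑ k, |a k| := fun a k =>
      Finset.single_le_sum (f := fun k => |a k|) (fun _ _ => abs_nonneg _) (Finset.mem_univ k)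
    have hex : ∃ t : ℕ, ∃ a, ∑ k, |a k| ≤ (t : ℤ) ∧ f (p + a) ≠ 0 := by
      exact ⟨3 * m, -p, hp3, by simpa using h0⟩
    have hfind : Nat.find hex ≠ 0 := by
      intro e
      obtain ⟨a, h1, h2⟩ := Nat.find_spec hex
      rw [e] at h1
      have : a = 0 := funext fun k => abs_nonpos_iff.1 ((hle a k).trans h1)
      rw [this, add_zero] at h2
      exact h2 hfp
    obtain ⟨ρ, hρ⟩ := Nat.exists_eq_succ_of_ne_zero hfind
    have hzero : ∀ a, ∑ k, |a k| ≤ (ρ : ℤ) → f (p + a) = 0 := by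
      have := Nat.find_min hex (m := ρ) (by omega)
      push Not at this
      exact this
    obtain ⟨a, ha, hfa⟩ := Nat.find_spec hex
    rw [hρ] at ha
    have hρm : ρ + 1 ≤ 3 * m := by
      rw [Nat.succ_eq_add_one] at hρ
      rw [← hρ]
      exact Nat.find_min' hex ⟨-p, hp3, by simpa using h0⟩
    by_cases hρ0 : ρ < 1000
    · refine ⟨ρ + 1, hsmall _ (by omega) ⟨p + a, fun k => ?_, hfa⟩⟩
      rw [Pi.add_apply, add_sub_cancel_left]
      exact (hle a k).trans ha
    refine ⟨2 * ρ, ?_⟩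
    have hgain : ρ ^ 2 ≤
        1000000 * (F.filter (fun a => ∀ k, |a k - p k| ≤ ((2 * ρ : ℕ) : ℤ))).card := by
      by_contra! hcon
      refine SparseOutsideBall.false_of_sphere_ne_zero (f := fun a => f (p + a))
        (F := F.image (· - p)) (ρ := ρ) (η := η) ⟨fun a ha => ?_, fun a => hgap _, by omega, hη0,
          hη.trans (pow_le_pow_of_le_one (by norm_num) (by norm_num) (by omega)),
          fun b hb hfb => ?_, hzero, ?_⟩ ⟨a, ?_, hfa⟩
      · exact Finset.mem_image.2 ⟨p + a, hF _ ha, add_sub_cancel_left _ _⟩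
      · have h1 := hrel (p + b) (fun k => ?_) hfb
        · simpa only [add_assoc, add_sub_assoc] using h1
        · have h2 := hb k
          have h3 := hpm k
          rw [Pi.add_apply]
          rw [abs_le] at h2 h3 ⊢
          omega
      · refine lt_of_le_of_lt (Nat.mul_le_mul_left _ ?_) hcon
        rw [Finset.filter_image]
        refine Finset.card_image_le.trans (le_of_eq ?_)
        simp only [Pi.sub_apply, Nat.cast_mul, Nat.cast_ofNat]
      · refine le_antisymm (by exact_mod_cast ha) ?_
        by_contra! hlt
        exact hfa (hzero a (by omega))
    calc _ ≤ (2 * (5 * (2 * ρ)) + 1) ^ 3 := hbox _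
      _ ≤ (21 * ρ) ^ 3 := Nat.pow_le_pow_left (by omega) 3
      _ = 9261 * ρ * ρ ^ 2 := by ring
      _ ≤ (10 ^ 7 * N) * (1000000 *
          (F.filter (fun a => ∀ k, |a k - p k| ≤ ((2 * ρ : ℕ) : ℤ))).card) :=
          Nat.mul_le_mul (by omega) hgain
      _ = _ := by ring
  choose! R hR using hlocal
  have h1 := vitali_card hR
  rw [hPcard] at h1
  have h2 : N ^ 3 ≤ (10 * (2 * m + 1)) ^ 3 := Nat.pow_le_pow_left (by omega) 3
  have h3 : N * N ^ 2 ≤ N * (10 ^ 16 * F.card) := by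
    calc N * N ^ 2 = N ^ 3 := by ring
      _ ≤ (10 * (2 * m + 1)) ^ 3 := h2
      _ = 1000 * (2 * m + 1) ^ 3 := by ring
      _ ≤ 1000 * (10 ^ 13 * N * F.card) := Nat.mul_le_mul_left _ h1
      _ = _ := by ring
  exact Nat.le_of_mul_le_mul_left h3 hN

/-- Along a decreasing sequence of levels, either the superlevel sets grow strictly or one of them
is stationary. -/
lemma le_card_or_exists_eq {α : Type*} {S : ℕ → Finset α} (hS : ∀ i, S i ⊆ S (i + 1)) (i : ℕ) :
    i ≤ (S i).card ∨ ∃ j < i, S j = S (j + 1) := by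
  induction i with
  | zero => simp
  | succ i ih =>
    rcases ih with h | ⟨j, hj, h⟩
    · by_cases he : S i = S (i + 1)
      · exact Or.inr ⟨i, by omega, he⟩
      · have := Finset.card_lt_card (lt_of_le_of_ne (hS i) he)
        exact Or.inl (by omega)
    · exact Or.inr ⟨j, by omega, h⟩

lemma mem_cube_zero {n : ℕ} {a : Fin 3 → ℤ} : a ∈ cube 0 (n : ℝ) ↔ ∀ k, |a k| ≤ (n : ℤ) := by
  simp only [cube, Set.mem_ofPred_eq, Pi.zero_apply, sub_zero]
  refine forall_congr' fun k => ?_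
  exact_mod_cast Iff.rfl

/-- If no value of `|u|` on the cube lies in `[t * ε, t)`, then the superlevel set of `u` at the
level `t` has at least quadratic size. -/
lemma sq_le_card_of_level_gap {u V : (Fin 3 → ℤ) → ℝ} {K t ε : ℝ} {n : ℕ} (hn : 2 ≤ n)
    (heq : ∀ a, (∀ k, |a k| ≤ (n : ℤ)) → discLap u a = V a * u a) (hV : ∀ a, |V a| ≤ K)
    (ht : 0 < t) (hε0 : 0 ≤ ε) (hε : (12 + K) * ε ≤ (1 / 2) ^ (2 * n)) (hu0 : t ≤ |u 0|)
    {S : Finset (Fin 3 → ℤ)} (hS : ∀ a, a ∈ S ↔ (∀ k, |a k| ≤ (n : ℤ)) ∧ t ≤ |u a|)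
    (hgap : ∀ a, (∀ k, |a k| ≤ (n : ℤ)) → a ∉ S → |u a| ≤ t * ε) :
    n ^ 2 ≤ 4 * 10 ^ 16 * S.card := by
  classical
  have hK : 0 ≤ K := (abs_nonneg _).trans (hV 0)
  set f : (Fin 3 → ℤ) → ℝ := fun a => if a ∈ S then u a / t else 0 with hf
  have hmain : (n - 1) ^ 2 ≤ 10 ^ 16 * S.card := by
    refine sq_le_card_support (f := f) (η := (12 + K) * ε) (by omega) (fun a ha => ?_) (fun a => ?_)
      (by positivity) ?_ ?_ (fun b hb hfb => ?_)
    · by_contra hcon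
      exact ha (by simp only [hf, if_neg hcon])
    · by_cases ha : a ∈ S
      · right
        simp only [hf, if_pos ha]
        rw [abs_div, abs_of_pos ht, one_le_div ht]
        exact ((hS a).1 ha).2
      · left
        simp only [hf, if_neg ha]
    · rwa [show 2 * (n - 1) + 2 = 2 * n by omega]
    · have h0 : (0 : Fin 3 → ℤ) ∈ S := (hS 0).2 ⟨fun k => by simp, hu0⟩
      simp only [hf, if_pos h0]
      have : u 0 ≠ 0 := fun e => by rw [e, abs_zero] at hu0; linarith
      positivity
    · have hclose : ∀ a, (∀ k, |a k| ≤ (n : ℤ)) → |f a - u a / t| ≤ ε := by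
        intro a ha
        by_cases haS : a ∈ S
        · simp only [hf, if_pos haS, sub_self, abs_zero]
          exact hε0
        · simp only [hf, if_neg haS, zero_sub, abs_neg]
          rw [abs_div, abs_of_pos ht, div_le_iff₀ ht, mul_comm]
          exact hgap a ha haS
      have hbn : ∀ k, |b k| ≤ (n : ℤ) := fun k => (hb k).trans (by omega)
      have hstd : ∀ i k, |(b + stdv i) k| ≤ (n : ℤ) ∧ |(b - stdv i) k| ≤ (n : ℤ) := by
        intro i k
        have h1 := hb k
        have h2 := stdv_nonneg i k
        have h3 := stdv_le_one i k
        rw [Pi.add_apply, Pi.sub_apply]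
        rw [abs_le] at h1 ⊢
        rw [abs_le]
        omega
      have hub : |u b / t| ≤ ε := by
        have := hclose b hbn
        rwa [hfb, zero_sub, abs_neg] at this
      have hlap : ∑ k, (u (b + stdv k) / t + u (b - stdv k) / t) = (6 + V b) * (u b / t) := by
        have := heq b hbn
        unfold discLap at this
        simp only [← add_div]
        rw [← Finset.sum_div, ← mul_div_assoc]
        congr 1
        linarith
      have hdiff : ∀ k, |(f (b + stdv k) + f (b - stdv k)) -
          (u (b + stdv k) / t + u (b - stdv k) / t)| ≤ 2 * ε := by
        intro k
        rw [add_sub_add_comm]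
        refine (abs_add_le _ _).trans ?_
        have h1 := hclose _ fun j => (hstd k j).1
        have h2 := hclose _ fun j => (hstd k j).2
        linarith
      have hVb : |(6 + V b) * (u b / t)| ≤ (6 + K) * ε := by
        rw [abs_mul]
        refine mul_le_mul ((abs_add_le _ _).trans ?_) hub (abs_nonneg _) (by linarith)
        rw [abs_of_pos (by norm_num : (0 : ℝ) < 6)]
        linarith [hV b]
      calc |∑ k, (f (b + stdv k) + f (b - stdv k))|
          = |∑ k, ((f (b + stdv k) + f (b - stdv k)) -
              (u (b + stdv k) / t + u (b - stdv k) / t)) + (6 + V b) * (u b / t)| := by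
            rw [Finset.sum_sub_distrib, hlap, sub_add_cancel]
        _ ≤ ∑ k, |(f (b + stdv k) + f (b - stdv k)) -
              (u (b + stdv k) / t + u (b - stdv k) / t)| + |(6 + V b) * (u b / t)| :=
            (abs_add_le _ _).trans (add_le_add_left (Finset.abs_sum_le_sum_abs _ _) _)
        _ ≤ ∑ _k : Fin 3, 2 * ε + (6 + K) * ε :=
            add_le_add (Finset.sum_le_sum fun k _ => hdiff k) hVb
        _ = (12 + K) * ε := by simp; ring
  calc n ^ 2 ≤ (2 * (n - 1)) ^ 2 := Nat.pow_le_pow_left (by omega) 2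
    _ = 4 * (n - 1) ^ 2 := by ring
    _ ≤ 4 * (10 ^ 16 * S.card) := Nat.mul_le_mul_left _ hmain
    _ = _ := by ring

/-- Weak 3D discrete unique continuation: the set of points of `Q_n` where
`|u| ≥ exp(-C₂ n³) |u(0)|` has cardinality at least `C₃ n² (log₂ n)⁻¹`. -/
theorem weak_discrete_unique_continuation :
    ∃ C₃ : ℝ, 0 < C₃ ∧
      ∀ K : ℝ, 0 < K → ∃ C₂ : ℝ, 0 < C₂ ∧
        ∀ n : ℕ, 2 ≤ n →
          ∀ u V : (Fin 3 → ℤ) → ℝ,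
            (∀ a ∈ cube 0 (n : ℝ), discLap u a = V a * u a) →
            (∀ a, |V a| ≤ K) →
            C₃ * (n : ℝ) ^ 2 * (Real.logb 2 n)⁻¹ ≤
              (({a | a ∈ cube 0 (n : ℝ) ∧
                Real.exp (-C₂ * (n : ℝ) ^ 3) * |u 0| ≤ |u a|}).ncard : ℝ) := by
  refine ⟨1 / (4 * 10 ^ 16), by norm_num, fun K hK => ⟨Real.log ((12 + K) * 4),
    Real.log_pos (by linarith), fun n hn u V hu hV => ?_⟩⟩
  suffices h : n ^ 2 ≤ 4 * 10 ^ 16 * ({a | a ∈ cube 0 (n : ℝ) ∧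
      Real.exp (-Real.log ((12 + K) * 4) * (n : ℝ) ^ 3) * |u 0| ≤ |u a|}).ncard by
    have hlog : (Real.logb 2 n)⁻¹ ≤ 1 := by
      refine inv_le_one_of_one_le₀ ?_
      rw [Real.le_logb_iff_rpow_le (by norm_num) (by positivity), Real.rpow_one]
      exact_mod_cast hn
    have h' : (n : ℝ) ^ 2 ≤ 4 * 10 ^ 16 * (({a | a ∈ cube 0 (n : ℝ) ∧
      Real.exp (-Real.log ((12 + K) * 4) * (n : ℝ) ^ 3) * |u 0| ≤ |u a|}).ncard : ℝ) := by
      exact_mod_cast h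
    refine (mul_le_of_le_one_right (by positivity) hlog).trans ?_
    rw [one_div, inv_mul_le_iff₀ (by norm_num)]
    exact h'
  set Q : Finset (Fin 3 → ℤ) := Fintype.piFinset fun _ => Finset.Icc (0 - (n : ℤ)) (0 + n) with hQ
  have hQmem : ∀ a, a ∈ Q ↔ ∀ k, |a k| ≤ (n : ℤ) := by
    intro a
    simp only [hQ, Fintype.mem_piFinset, Finset.mem_Icc, abs_le, zero_sub, zero_add]
  set ε : ℝ := Real.exp (-Real.log ((12 + K) * 4) * n) with hε
  set S : ℕ → Finset (Fin 3 → ℤ) := fun i => Q.filter fun a => |u 0| * ε ^ i ≤ |u a| with hS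
  have hSmem : ∀ i a, a ∈ S i ↔ (∀ k, |a k| ≤ (n : ℤ)) ∧ |u 0| * ε ^ i ≤ |u a| := by
    intro i a
    rw [hS, Finset.mem_filter, hQmem]
  have hε0 : 0 < ε := Real.exp_pos _
  have hεpow : ε = (((12 + K) * 4) ^ n)⁻¹ := by
    rw [hε, neg_mul, Real.exp_neg, mul_comm, Real.exp_nat_mul, Real.exp_log (by positivity)]
  have hε1 : ε ≤ 1 := by
    rw [hεpow]
    exact inv_le_one_of_one_le₀ (one_le_pow₀ (by linarith))
  have hεn : (12 + K) * ε ≤ (1 / 2) ^ (2 * n) := by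
    rw [hεpow, mul_pow, mul_inv, pow_mul, ← mul_assoc]
    have h1 : ((1 : ℝ) / 2) ^ 2 = 4⁻¹ := by norm_num
    rw [h1, inv_pow]
    refine mul_le_of_le_one_left (by positivity) ?_
    rw [← div_eq_mul_inv, div_le_one (by positivity)]
    exact le_self_pow₀ (by linarith) (by omega)
  have hanti : ∀ i j, i ≤ j → S i ⊆ S j := by
    intro i j hij a ha
    rw [hSmem] at ha ⊢
    exact ⟨ha.1, (mul_le_mul_of_nonneg_left (pow_le_pow_of_le_one hε0.le hε1 hij)
      (abs_nonneg _)).trans ha.2⟩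
  have hset : {a | a ∈ cube 0 (n : ℝ) ∧
      Real.exp (-Real.log ((12 + K) * 4) * (n : ℝ) ^ 3) * |u 0| ≤ |u a|} = ↑(S (n ^ 2)) := by
    ext a
    rw [Finset.mem_coe, hSmem, Set.mem_ofPred_eq, mem_cube_zero, hε, ← Real.exp_nat_mul,
      mul_comm |u 0|]
    push_cast
    ring_nf
  rw [hset, Set.ncard_coe_finset]
  rcases eq_or_ne (u 0) 0 with h0 | h0
  · have hall : S (n ^ 2) = Q := by
      rw [hS, Finset.filter_eq_self]
      intro a _
      rw [h0, abs_zero, zero_mul]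
      exact abs_nonneg _
    rw [hall, hQ, Fintype.card_piFinset]
    simp only [card_Icc_symm, Finset.prod_const, Finset.card_univ, Fintype.card_fin]
    nlinarith [sq_nonneg n]
  rcases le_card_or_exists_eq (fun i => hanti i (i + 1) (Nat.le_succ i)) (n ^ 2) with h | ⟨j, hj, h⟩
  · omega
  · have hpos : 0 < |u 0| * ε ^ j := by positivity
    have := sq_le_card_of_level_gap hn (fun a ha => hu a (mem_cube_zero.2 ha)) hV hpos hε0.le hεn
      (mul_le_of_le_one_right (abs_nonneg _) (pow_le_one₀ hε0.le hε1)) (hSmem j)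
      (fun a ha haS => by
        rw [h, hSmem, not_and, not_le, pow_succ, ← mul_assoc] at haS
        exact (haS ha).le)
    exact this.trans (Nat.mul_le_mul_left _ (Finset.card_le_card (hanti j _ hj.le)))
end
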